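/- arXiv:2002.12353 — 3 statements merged into one kernel-verified Lean document; each statement's English description precedes it below -/
import Mathlib

section
/- Let g ≥ 5 be a Sophie Germain prime, let p be a prime with p = x² + (2g+1)y² for some integers x, y and p ≠ 2g+1, and let a, s be integers with gcd(a, p) = 1, s ≠ 0, and a² − 4p = −(2g+1)s². Let O_K be the ring of integers of the imaginary quadratic field K = ℚ(√-(2g+1)) and let π ∈ O_K be a root of t² + a·p^((g−1)/2)·t + p^g. Then p·O_K = 𝔭·𝔮 for two distinct maximal ideals 𝔭, 𝔮 of O_K, and for a suitable labeling of these two ideals one has π·O_K = 𝔭^((g−1)/2)·𝔮^((g+1)/2). -/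
open Polynomial in
/-- In a quadratic field, the norm of a root of an irreducible `t² + a t + b` is `b`. -/
theorem Algebra.norm_eq_of_sq_add_mul_add_eq_zero {F K : Type*} [Field F] [Field K] [Algebra F K]
    (hK : Module.finrank F K = 2) {a b : F} (hab : ∀ r : F, r ^ 2 + a * r + b ≠ 0) {τ : K}
    (hτ : τ ^ 2 + algebraMap F K a * τ + algebraMap F K b = 0) : Algebra.norm F τ = b := by
  have : FiniteDimensional F K := Module.finite_of_finrank_pos (by omega)
  set f : F[X] := C 1 * X ^ 2 + C a * X + C b with hf
  have hdeg : f.natDegree = 2 := natDegree_quadratic one_ne_zero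
  have hmonic : f.Monic := leadingCoeff_quadratic one_ne_zero
  have hirr : Irreducible f := by
    refine irreducible_of_degree_le_three_of_not_isRoot (by simp [hdeg]) fun r hr => hab r ?_
    simpa [hf, IsRoot] using hr
  have hmin : f = minpoly F τ :=
    minpoly.eq_of_irreducible_of_monic hirr (by simpa [hf] using hτ) hmonic
  have hchar : (LinearMap.charpoly (Algebra.lmul F K τ)) = f := by
    refine (eq_of_monic_of_dvd_of_natDegree_le hmonic (LinearMap.charpoly_monic _) ?_ ?_)
    · rw [hmin]
      refine minpoly.dvd F τ ?_
      have h := LinearMap.aeval_self_charpoly (Algebra.lmul F K τ)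
      rw [aeval_algHom_apply] at h
      simpa using congrArg (fun l : Module.End F K => l 1) h
    · rw [LinearMap.charpoly_natDegree, hK, hdeg]
  have hdet := LinearMap.det_eq_sign_charpoly_coeff (Algebra.lmul F K τ)
  rw [hchar, hK] at hdet
  simpa [hf, Algebra.norm_apply] using hdet

/-- Let `K` be a quadratic field and `τ ∈ 𝓞 K` a root of `t² + a t + p`, where `p` is prime and
`a² < 4 p`. Then `τ` generates a maximal ideal. -/
theorem NumberField.RingOfIntegers.isMaximal_span_of_sq_add_mul_add_eq_zero
    {K : Type*} [Field K] [NumberField K] (hK : Module.finrank ℚ K = 2) {p : ℕ} (hp : p.Prime)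
    {a : ℤ} (hap : a ^ 2 < 4 * p) {τ : NumberField.RingOfIntegers K}
    (hτ : τ ^ 2 + a * τ + p = 0) : (Ideal.span {τ}).IsMaximal := by
  have hτK : (τ : K) ^ 2 + algebraMap ℚ K a * τ + algebraMap ℚ K p = 0 := by
    simpa using congrArg (algebraMap (NumberField.RingOfIntegers K) K) hτ
  have hnorm : Algebra.norm ℚ (τ : K) = p := by
    refine Algebra.norm_eq_of_sq_add_mul_add_eq_zero hK (fun r hr => ?_) hτK
    have : (a : ℚ) ^ 2 < 4 * p := by exact_mod_cast hap
    nlinarith [sq_nonneg (2 * r + a)]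
  have hnormZ : Algebra.norm ℤ τ = p := by
    rw [← Algebra.coe_norm_int] at hnorm
    exact_mod_cast hnorm
  have habs : Ideal.absNorm (Ideal.span {τ}) = p := by
    rw [Ideal.absNorm_span_singleton, hnormZ, Int.natAbs_natCast]
  have hprime : (Ideal.span {τ}).IsPrime :=
    Ideal.isPrime_of_irreducible_absNorm (habs ▸ hp)
  refine hprime.isMaximal fun hbot => hp.ne_zero ?_
  rw [← habs, hbot, Ideal.absNorm_bot]


/-- Let `g ≥ 5` be a Sophie Germain prime, `p` a prime with `p = x² + (2g+1)y²`, `p ≠ 2g+1`,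
and `a, s` integers with `gcd(a, p) = 1`, `s ≠ 0`, `a² − 4p = −(2g+1)s²`.  Let `K` be the
imaginary quadratic field `ℚ(√-(2g+1))` (a number field of degree `2` containing a square
root `δ` of `−(2g+1)`), `O_K` its ring of integers, and `π ∈ O_K` a root of
`t² + a·p^((g−1)/2)·t + p^g`.  Then `p·O_K = 𝔭·𝔮` for two distinct maximal ideals `𝔭, 𝔮`,
which can be labeled so that `π·O_K = 𝔭^((g−1)/2)·𝔮^((g+1)/2)`. -/
theorem stmt_11 (g : ℕ) (hg5 : 5 ≤ g) (hg : Nat.Prime g) (hsg : Nat.Prime (2 * g + 1))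
    (p : ℕ) (hp : p.Prime)
    (hrep : ∃ x y : ℤ, (p : ℤ) = x ^ 2 + (2 * g + 1) * y ^ 2)
    (hne : p ≠ 2 * g + 1)
    (a s : ℤ) (ha : Int.gcd a (p : ℤ) = 1) (hs : s ≠ 0)
    (heq : a ^ 2 - 4 * (p : ℤ) = -(2 * g + 1) * s ^ 2)
    (K : Type*) [Field K] [NumberField K]
    (hK : Module.finrank ℚ K = 2)
    (δ : K) (hδ : δ ^ 2 = -(2 * g + 1))
    (π : NumberField.RingOfIntegers K)
    (hroot : π ^ 2 + (a : NumberField.RingOfIntegers K)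
        * (p : NumberField.RingOfIntegers K) ^ ((g - 1) / 2) * π
        + (p : NumberField.RingOfIntegers K) ^ g = 0) :
    ∃ 𝔭 𝔮 : Ideal (NumberField.RingOfIntegers K),
      𝔭.IsMaximal ∧ 𝔮.IsMaximal ∧ 𝔭 ≠ 𝔮 ∧
      Ideal.span {(p : NumberField.RingOfIntegers K)} = 𝔭 * 𝔮 ∧
      Ideal.span {π} = 𝔭 ^ ((g - 1) / 2) * 𝔮 ^ ((g + 1) / 2) := by
  have hp0 : (p : K) ≠ 0 := by exact_mod_cast hp.ne_zero
  obtain ⟨m, rfl⟩ : ∃ m, g = 2 * m + 1 := hg.odd_of_ne_two (by omega)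
  have hm : (2 * m + 1 - 1) / 2 = m := by omega
  have hm' : (2 * m + 1 + 1) / 2 = m + 1 := by omega
  rw [hm] at hroot
  rw [hm, hm']
  have hap : a ^ 2 < 4 * (p : ℤ) := by
    have : 0 < s ^ 2 := by positivity
    push_cast at heq
    nlinarith
  have hrootK : (π : K) ^ 2 + a * p ^ m * π + p ^ (2 * m + 1) = 0 := by
    simpa using congrArg (algebraMap (NumberField.RingOfIntegers K) K) hroot
  have hquot : ((π : K) / p ^ m) ^ 2 + a * (π / p ^ m) + p = 0 := by
    field_simp
    linear_combination hrootK
  have hint : IsIntegral ℤ ((π : K) / p ^ m) := by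
    refine ⟨Polynomial.C 1 * Polynomial.X ^ 2 + Polynomial.C a * Polynomial.X +
      Polynomial.C (p : ℤ),
      Polynomial.leadingCoeff_quadratic one_ne_zero, ?_⟩
    simp only [Polynomial.eval₂_add, Polynomial.eval₂_mul, Polynomial.eval₂_pow, Polynomial.eval₂_C,
      Polynomial.eval₂_X, map_one, one_mul]
    simpa using hquot
  obtain ⟨τ, hτ⟩ : ∃ τ : NumberField.RingOfIntegers K, (τ : K) = π / p ^ m := ⟨⟨_, hint⟩, rfl⟩
  have hτroot : τ ^ 2 + a * τ + p = 0 := by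
    apply NumberField.RingOfIntegers.ext
    simpa [hτ] using hquot
  have hπ : π = p ^ m * τ := by
    apply NumberField.RingOfIntegers.ext
    simp [hτ]
    field_simp
  have hconj : (-a - τ) ^ 2 + a * (-a - τ) + p = 0 := by linear_combination hτroot
  have hmul : (p : NumberField.RingOfIntegers K) = (-a - τ) * τ := by linear_combination hτroot
  have hmax := NumberField.RingOfIntegers.isMaximal_span_of_sq_add_mul_add_eq_zero hK hp hap hτroot
  have hspan : Ideal.span {(p : NumberField.RingOfIntegers K)} =
      Ideal.span {-(a : NumberField.RingOfIntegers K) - τ} * Ideal.span {τ} := by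
    rw [Ideal.span_singleton_mul_span_singleton, hmul]
  refine ⟨Ideal.span {-(a : NumberField.RingOfIntegers K) - τ}, Ideal.span {τ},
    NumberField.RingOfIntegers.isMaximal_span_of_sq_add_mul_add_eq_zero hK hp hap hconj,
    hmax, fun h => hmax.ne_top ?_, hspan, ?_⟩
  · have hτmem : τ ∈ Ideal.span {τ} := Ideal.mem_span_singleton_self τ
    have hconjmem : -(a : NumberField.RingOfIntegers K) - τ ∈ Ideal.span {τ} :=
      h ▸ Ideal.mem_span_singleton_self _
    have hamem : (a : NumberField.RingOfIntegers K) ∈ Ideal.span {τ} := by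
      convert neg_mem (add_mem hconjmem hτmem) using 1
      ring
    have hpmem : (p : NumberField.RingOfIntegers K) ∈ Ideal.span {τ} :=
      hmul ▸ Ideal.mul_mem_left _ _ hτmem
    obtain ⟨u, v, huv⟩ := Int.isCoprime_iff_gcd_eq_one.mpr ha
    rw [Ideal.eq_top_iff_one]
    have hone : (1 : NumberField.RingOfIntegers K) = u * a + v * p := by exact_mod_cast huv.symm
    exact hone ▸ add_mem (Ideal.mul_mem_left _ _ hamem) (Ideal.mul_mem_left _ _ hpmem)
  · rw [hπ, ← Ideal.span_singleton_mul_span_singleton, ← Ideal.span_singleton_pow, hspan,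
      mul_pow, pow_succ, mul_assoc]
end

section
/- The set of primes p with p ≠ 23 such that p = x² + 23y² for some integers x, y and p ≢ 1 (mod 23) has relative natural density 5/33 among all primes; that is, #{p ≤ x : p prime, p ≠ 23, p = x₀² + 23y₀² for some integers x₀, y₀, p ≢ 1 (mod 23)} / #{p ≤ x : p prime} tends to 5/33 as x → ∞. -/
open Filter Topology MeasureTheory Set

/-- The Fejér kernel `2 (1 - cos u) / u ^ 2`. -/
noncomputable def fejer (u : ℝ) : ℝ := if u = 0 then 1 else 2 * (1 - Real.cos u) / u ^ 2

lemma fejer_nonneg (u : ℝ) : 0 ≤ fejer u := by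
  unfold fejer
  split_ifs
  · exact zero_le_one
  · have := Real.cos_le_one u
    have : 0 ≤ 1 - Real.cos u := by linarith
    positivity

lemma fejer_le (u : ℝ) : fejer u ≤ 5 * (1 + u ^ 2)⁻¹ := by
  unfold fejer
  split_ifs with h
  · simp [h]
  · have h1 := Real.one_sub_sq_div_two_le_cos (x := u)
    have h2 := Real.neg_one_le_cos u
    have hu : 0 < u ^ 2 := by positivity
    rw [← div_eq_mul_inv, div_le_div_iff₀ hu (by positivity)]
    nlinarith [mul_nonneg hu.le (sub_nonneg.2 h2)]

lemma measurable_fejer : Measurable fejer := by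
  unfold fejer
  refine Measurable.ite (measurableSet_singleton 0) measurable_const ?_
  fun_prop

lemma integrable_fejer : Integrable fejer := by
  refine (integrable_inv_one_add_sq.const_mul 5).mono' measurable_fejer.aestronglyMeasurable ?_
  filter_upwards with u
  rw [Real.norm_of_nonneg (fejer_nonneg u)]
  exact fejer_le u

lemma integral_fejer_pos : 0 < ∫ u, fejer u := by
  rw [integral_pos_iff_support_of_nonneg fejer_nonneg integrable_fejer]
  have : Ioo (0 : ℝ) 1 ⊆ Function.support fejer := by
    intro u hu
    have h0 : u ≠ 0 := hu.1.ne'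
    have h1 : Real.cos u < 1 := by
      have := Real.cos_lt_cos_of_nonneg_of_le_pi (x := 0) (y := u) le_rfl
        (by linarith [hu.2, Real.pi_gt_three]) hu.1
      simpa using this
    rw [Function.mem_support, fejer, if_neg h0]
    have : 0 < 1 - Real.cos u := by linarith
    positivity
  refine lt_of_lt_of_le ?_ (measure_mono this)
  simp

lemma integral_triangle_mul_cexp (u : ℝ) :
    ∫ τ in (-1 : ℝ)..1, ((1 - |τ| : ℝ) : ℂ) * Complex.exp (τ * u * Complex.I) = fejer u := by
  have hc : Continuous fun τ : ℝ => ((1 - |τ| : ℝ) : ℂ) * Complex.exp (τ * u * Complex.I) := by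
    fun_prop
  rw [← intervalIntegral.integral_add_adjacent_intervals (b := 0) (hc.intervalIntegrable _ _)
    (hc.intervalIntegrable _ _)]
  by_cases hu : u = 0
  · have e1 : ∫ τ in (-1 : ℝ)..0, ((1 - |τ| : ℝ) : ℂ) * Complex.exp (τ * u * Complex.I)
        = ∫ τ in (-1 : ℝ)..0, ((1 + τ : ℝ) : ℂ) := by
      refine intervalIntegral.integral_congr fun τ hτ => ?_
      rw [uIcc_of_le (by norm_num)] at hτ
      simp [hu, abs_of_nonpos hτ.2]
    have e2 : ∫ τ in (0 : ℝ)..1, ((1 - |τ| : ℝ) : ℂ) * Complex.exp (τ * u * Complex.I)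
        = ∫ τ in (0 : ℝ)..1, ((1 - τ : ℝ) : ℂ) := by
      refine intervalIntegral.integral_congr fun τ hτ => ?_
      rw [uIcc_of_le (by norm_num)] at hτ
      simp [hu, abs_of_nonneg hτ.1]
    rw [e1, e2, intervalIntegral.integral_ofReal, intervalIntegral.integral_ofReal]
    rw [intervalIntegral.integral_add (by simp) (by simp),
      intervalIntegral.integral_sub (by simp) (by simp)]
    simp [fejer, hu]
    norm_num
  · set a : ℂ := u * Complex.I with ha
    have ha0 : a ≠ 0 := by simp [ha, hu]
    have e1 : ∫ τ in (-1 : ℝ)..0, ((1 - |τ| : ℝ) : ℂ) * Complex.exp (τ * u * Complex.I)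
        = 1 / a - 1 / a ^ 2 + Complex.exp (-a) / a ^ 2 := by
      have : ∫ τ in (-1 : ℝ)..0, ((1 - |τ| : ℝ) : ℂ) * Complex.exp (τ * u * Complex.I)
        = ∫ τ in (-1 : ℝ)..0, (1 + (τ : ℂ)) * Complex.exp (τ * a) := by
        refine intervalIntegral.integral_congr fun τ hτ => ?_
        rw [uIcc_of_le (by norm_num)] at hτ
        simp [abs_of_nonpos hτ.2, ha, mul_assoc]
      rw [this, intervalIntegral.integral_eq_sub_of_hasDerivAt (f := fun τ : ℝ =>
        (1 + (τ : ℂ)) * Complex.exp (τ * a) / a - Complex.exp (τ * a) / a ^ 2)]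
      · simp
      · intro τ _
        have h1 : HasDerivAt (fun τ : ℝ => (τ : ℂ)) 1 τ := Complex.ofRealCLM.hasDerivAt
        have h2 := (h1.mul_const a).cexp
        refine ((((h1.const_add 1).mul h2).div_const a).sub (h2.div_const (a ^ 2))).congr_deriv ?_
        field_simp
        ring
      · exact (by fun_prop : Continuous fun τ : ℝ =>
          (1 + (τ : ℂ)) * Complex.exp (τ * a)).intervalIntegrable _ _
    have e2 : ∫ τ in (0 : ℝ)..1, ((1 - |τ| : ℝ) : ℂ) * Complex.exp (τ * u * Complex.I)
        = Complex.exp a / a ^ 2 - 1 / a - 1 / a ^ 2 := by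
      have : ∫ τ in (0 : ℝ)..1, ((1 - |τ| : ℝ) : ℂ) * Complex.exp (τ * u * Complex.I)
        = ∫ τ in (0 : ℝ)..1, (1 - (τ : ℂ)) * Complex.exp (τ * a) := by
        refine intervalIntegral.integral_congr fun τ hτ => ?_
        rw [uIcc_of_le (by norm_num)] at hτ
        simp [abs_of_nonneg hτ.1, ha, mul_assoc]
      rw [this, intervalIntegral.integral_eq_sub_of_hasDerivAt (f := fun τ : ℝ =>
        (1 - (τ : ℂ)) * Complex.exp (τ * a) / a + Complex.exp (τ * a) / a ^ 2)]
      · simp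
        ring
      · intro τ _
        have h1 : HasDerivAt (fun τ : ℝ => (τ : ℂ)) 1 τ := Complex.ofRealCLM.hasDerivAt
        have h2 := (h1.mul_const a).cexp
        refine ((((h1.const_sub 1).mul h2).div_const a).add (h2.div_const (a ^ 2))).congr_deriv ?_
        field_simp
        ring
      · exact (by fun_prop : Continuous fun τ : ℝ =>
          (1 - (τ : ℂ)) * Complex.exp (τ * a)).intervalIntegrable _ _
    rw [e1, e2, fejer, if_neg hu]
    have ha2 : a ^ 2 = -(u : ℂ) ^ 2 := by rw [ha, mul_pow, Complex.I_sq]; ring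
    have hcos : (Real.cos u : ℂ) = (Complex.exp a + Complex.exp (-a)) / 2 := by
      rw [Complex.ofReal_cos, Complex.cos, ha]; ring_nf
    push_cast [hcos] at *
    have hu' : (u : ℂ) ≠ 0 := by exact_mod_cast hu
    rw [hcos, ha2]
    field_simp
    ring

lemma tendsto_of_tendsto_fejer_average {S : ℝ → ℝ} {C A : ℝ} (hmeas : Measurable S)
    (h0 : ∀ u, 0 ≤ S u) (hC : ∀ u, S u ≤ C)
    (hmono : ∀ u v, 0 ≤ v → S u * Real.exp (-v) ≤ S (u + v))
    (hker : ∀ l : ℝ, 0 < l → Tendsto (fun x => ∫ v, S (x - v / l) * fejer v) atTop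
      (𝓝 (A * ∫ v, fejer v))) :
    Tendsto S atTop (𝓝 A) := by
  set J := ∫ v, fejer v with hJ
  have hJ0 : 0 < J := integral_fejer_pos
  have hC0 : 0 ≤ C := (h0 0).trans (hC 0)
  -- truncated mass
  set JR : ℝ → ℝ := fun R => ∫ v in (-R)..R, fejer v with hJR
  have hJRlim : Tendsto JR atTop (𝓝 J) :=
    intervalIntegral_tendsto_integral integrable_fejer tendsto_neg_atTop_atBot tendsto_id
  have hexp : ∀ c : ℝ, Tendsto (fun R : ℝ => Real.exp (c / R)) atTop (𝓝 1) := fun c => by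
    have : Tendsto (fun R : ℝ => c / R) atTop (𝓝 0) := tendsto_const_nhds.div_atTop tendsto_id
    rw [← Real.exp_zero]
    exact (Real.continuous_exp.tendsto 0).comp this
  have hSint : ∀ l x, Integrable fun v => S (x - v / l) * fejer v := fun l x => by
    refine integrable_fejer.bdd_mul (c := C) (hmeas.comp (by fun_prop)).aestronglyMeasurable ?_
    filter_upwards with v
    rw [Real.norm_of_nonneg (h0 _)]; exact hC _
  have hshift : ∀ R l x v, 0 < l → v ∈ Icc (-R) R →
      S (x - R / l) * Real.exp (-(2 * R / l)) ≤ S (x - v / l) ∧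
      S (x - v / l) ≤ S (x + R / l) * Real.exp (2 * R / l) := by
    intro R l x v hl hv
    have hv1 : 0 ≤ (R - v) / l := div_nonneg (by linarith [hv.2]) hl.le
    have hv2 : 0 ≤ (R + v) / l := div_nonneg (by linarith [hv.1]) hl.le
    constructor
    · have := hmono (x - R / l) ((R - v) / l) hv1
      rw [show x - R / l + (R - v) / l = x - v / l by ring] at this
      refine le_trans (mul_le_mul_of_nonneg_left (Real.exp_le_exp.2 ?_) (h0 _)) this
      rw [neg_le_neg_iff, div_le_div_iff_of_pos_right hl]
      linarith [hv.1]
    · have := hmono (x - v / l) ((R + v) / l) hv2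
      rw [show x - v / l + (R + v) / l = x + R / l by ring] at this
      have h3 : S (x - v / l) ≤ S (x + R / l) * Real.exp ((R + v) / l) := by
        rw [Real.exp_neg] at this
        rwa [← div_eq_mul_inv, div_le_iff₀ (Real.exp_pos _)] at this
      refine h3.trans (mul_le_mul_of_nonneg_left (Real.exp_le_exp.2 ?_) (h0 _))
      rw [div_le_div_iff_of_pos_right hl]
      linarith [hv.2]
  have hJRle : ∀ R, 0 ≤ R → JR R ≤ J := fun R hR => by
    rw [hJR, hJ]; simp only
    rw [intervalIntegral.integral_of_le (by linarith)]
    exact setIntegral_le_integral integrable_fejer (ae_of_all _ fejer_nonneg)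
  rw [tendsto_order]
  constructor
  · -- lower bound
    intro B hB
    have hlim : Tendsto (fun R : ℝ => (A * J - 1 / R - C * (J - JR R)) / (J * Real.exp (2 / R)))
        atTop (𝓝 ((A * J - 0 - C * (J - J)) / (J * 1))) := by
      refine Tendsto.div ?_ (tendsto_const_nhds.mul (hexp 2)) (by positivity)
      refine ((tendsto_const_nhds.sub ?_).sub (tendsto_const_nhds.mul
        (tendsto_const_nhds.sub hJRlim)))
      exact tendsto_const_nhds.div_atTop tendsto_id
    have hval : (A * J - 0 - C * (J - J)) / (J * 1) = A := by field_simp; ring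
    rw [hval] at hlim
    obtain ⟨R, hR, hR0⟩ := ((hlim.eventually_const_lt hB).and (eventually_gt_atTop 0)).exists
    have hl : (0 : ℝ) < R ^ 2 := by positivity
    have hev := (hker (R ^ 2) hl).eventually_const_lt
      (show A * J - 1 / R < A * J by have : 0 < 1 / R := by positivity
                                     linarith)
    have hev2 : ∀ᶠ x in atTop, B < S (x + R / R ^ 2) := by
      filter_upwards [hev] with x hx
      refine hR.trans_le ?_
      rw [div_le_iff₀ (by positivity)]
      have h1 : ∫ v, S (x - v / R ^ 2) * fejer v ≤
          C * (J - JR R) + S (x + R / R ^ 2) * Real.exp (2 / R) * JR R := by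
        rw [← integral_add_compl (measurableSet_Ioc (a := -R) (b := R)) (hSint _ _), add_comm]
        refine add_le_add ?_ ?_
        · have : J - JR R = ∫ v in (Ioc (-R) R)ᶜ, fejer v := by
            rw [hJ, hJR]; simp only
            rw [intervalIntegral.integral_of_le (by linarith),
              ← integral_add_compl (measurableSet_Ioc (a := -R) (b := R)) integrable_fejer]
            ring
          rw [this, ← integral_const_mul]
          refine setIntegral_mono (hSint _ _).integrableOn
            (integrable_fejer.const_mul _).integrableOn fun v => ?_
          exact mul_le_mul_of_nonneg_right (hC _) (fejer_nonneg _)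
        · rw [hJR]; simp only
          rw [intervalIntegral.integral_of_le (by linarith), ← integral_const_mul]
          refine setIntegral_mono_on (hSint _ _).integrableOn
            (integrable_fejer.const_mul _).integrableOn measurableSet_Ioc fun v hv => ?_
          refine mul_le_mul_of_nonneg_right ?_ (fejer_nonneg _)
          have := (hshift R (R ^ 2) x v hl ⟨hv.1.le, hv.2⟩).2
          rwa [show 2 * R / R ^ 2 = 2 / R by field_simp] at this
      have h2 : S (x + R / R ^ 2) * Real.exp (2 / R) * JR R ≤
          S (x + R / R ^ 2) * Real.exp (2 / R) * J :=
        mul_le_mul_of_nonneg_left (hJRle R hR0.le)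
          (mul_nonneg (h0 _) (Real.exp_pos _).le)
      linarith
    have := (tendsto_atTop_add_const_right atTop (-(R / R ^ 2)) tendsto_id).eventually hev2
    filter_upwards [this] with x hx
    simpa using hx
  · intro B hB
    have hlim : Tendsto (fun R : ℝ => (A * J + 1 / R) / (Real.exp (-2 / R) * JR R))
        atTop (𝓝 ((A * J + 0) / (1 * J))) := by
      refine Tendsto.div ?_ ((hexp (-2)).mul hJRlim) (by positivity)
      exact tendsto_const_nhds.add (tendsto_const_nhds.div_atTop tendsto_id)
    have hval : (A * J + 0) / (1 * J) = A := by field_simp; ring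
    rw [hval] at hlim
    obtain ⟨R, ⟨hR, hR0⟩, hRJ⟩ := (((hlim.eventually_lt_const hB).and
      (eventually_gt_atTop 0)).and (hJRlim.eventually_const_lt hJ0)).exists
    have hl : (0 : ℝ) < R ^ 2 := by positivity
    have hev := (hker (R ^ 2) hl).eventually_lt_const
      (show A * J < A * J + 1 / R by have : 0 < 1 / R := by positivity
                                     linarith)
    have hev2 : ∀ᶠ x in atTop, S (x - R / R ^ 2) < B := by
      filter_upwards [hev] with x hx
      refine lt_of_le_of_lt ?_ hR
      rw [le_div_iff₀ (by positivity), ← mul_assoc]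
      refine le_trans ?_ hx.le
      rw [← integral_add_compl (measurableSet_Ioc (a := -R) (b := R)) (hSint _ _)]
      refine le_add_of_le_of_nonneg ?_ (integral_nonneg fun v => mul_nonneg (h0 _) (fejer_nonneg _))
      rw [hJR]; simp only
      rw [intervalIntegral.integral_of_le (by linarith), ← integral_const_mul]
      refine setIntegral_mono_on (integrable_fejer.const_mul _).integrableOn
        (hSint _ _).integrableOn measurableSet_Ioc fun v hv => ?_
      refine mul_le_mul_of_nonneg_right ?_ (fejer_nonneg _)
      have := (hshift R (R ^ 2) x v hl ⟨hv.1.le, hv.2⟩).1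
      rwa [show -(2 * R / R ^ 2) = -2 / R by field_simp] at this
    have := (tendsto_atTop_add_const_right atTop (R / R ^ 2) tendsto_id).eventually hev2
    filter_upwards [this] with x hx
    simpa using hx

lemma tendsto_fejer_average {S : ℝ → ℝ} {C A : ℝ} (hmeas : Measurable S)
    (h0 : ∀ u, 0 ≤ S u) (hC : ∀ u, S u ≤ C) (hneg : ∀ u < 0, S u = 0) {k : ℂ → ℂ}
    (hkc : ContinuousOn k {z | 0 ≤ z.re})
    (hk : ∀ z : ℂ, 0 < z.re →
      ∫ u in Ioi (0 : ℝ), ((S u - A : ℝ) : ℂ) * Complex.exp (-z * u) = k z)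
    {l : ℝ} (hl : 0 < l) :
    Tendsto (fun x => ∫ v, S (x - v / l) * fejer v) atTop (𝓝 (A * ∫ v, fejer v)) := by
  set D := C + |A| with hD
  have hf : ∀ u, |S u - A| ≤ D := fun u => by
    refine (abs_sub _ _).trans ?_
    rw [abs_of_nonneg (h0 u)]
    linarith [hC u]
  have hD0 : 0 ≤ D := (abs_nonneg _).trans (hf 0)
  have hfm : Measurable fun u => S u - A := hmeas.sub_const A
  have hfej : ∀ x : ℝ, Integrable fun u => fejer (l * (x - u)) := fun x =>
    (integrable_fejer.comp_mul_left' hl.ne').comp_sub_left x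
  have hfejm : ∀ x : ℝ, Measurable fun u => fejer (l * (x - u)) := fun x =>
    measurable_fejer.comp (by fun_prop)
  -- Fubini at positive distance from the boundary line
  have step1 : ∀ ε : ℝ, 0 < ε → ∀ x : ℝ,
      ∫ τ in (-1 : ℝ)..1, ((1 - |τ| : ℝ) : ℂ) * Complex.exp (l * τ * x * Complex.I) *
        k (ε + l * τ * Complex.I) =
      ∫ u in Ioi (0 : ℝ), ((S u - A : ℝ) : ℂ) * Complex.exp (-ε * u) *
        (fejer (l * (x - u)) : ℂ) := by
    intro ε hε x
    have hF : ∀ τ u : ℝ, ((1 - |τ| : ℝ) : ℂ) * Complex.exp (l * τ * x * Complex.I) *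
        (((S u - A : ℝ) : ℂ) * Complex.exp (-(ε + l * τ * Complex.I) * u)) =
        ((S u - A : ℝ) : ℂ) * Complex.exp (-ε * u) *
        (((1 - |τ| : ℝ) : ℂ) * Complex.exp (τ * (l * (x - u) : ℝ) * Complex.I)) := by
      intro τ u
      rw [show Complex.exp (-(ε + l * τ * Complex.I) * u) =
        Complex.exp (-ε * u) * Complex.exp (-(l * τ * Complex.I) * u) by
          rw [← Complex.exp_add]; ring_nf]
      rw [show Complex.exp (τ * (l * (x - u) : ℝ) * Complex.I) =
        Complex.exp (l * τ * x * Complex.I) * Complex.exp (-(l * τ * Complex.I) * u) by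
          rw [← Complex.exp_add]; push_cast; ring_nf]
      ring
    have e1 : ∀ τ : ℝ, ((1 - |τ| : ℝ) : ℂ) * Complex.exp (l * τ * x * Complex.I) *
        k (ε + l * τ * Complex.I) = ∫ u in Ioi (0 : ℝ), ((S u - A : ℝ) : ℂ) *
          Complex.exp (-ε * u) *
        (((1 - |τ| : ℝ) : ℂ) * Complex.exp (τ * (l * (x - u) : ℝ) * Complex.I)) := by
      intro τ
      rw [← hk _ (by simpa using hε), ← integral_const_mul]
      simp_rw [hF]
    simp_rw [e1]
    rw [intervalIntegral.integral_of_le (by norm_num), integral_integral_swap]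
    · refine integral_congr_ae (ae_of_all _ fun u => ?_)
      simp only
      rw [integral_const_mul, ← intervalIntegral.integral_of_le (by norm_num),
        integral_triangle_mul_cexp]
    · have hb : Integrable (fun p : ℝ × ℝ => (1 : ℝ) * (D * Real.exp (-ε * p.2)))
          ((volume.restrict (Ioc (-1 : ℝ) 1)).prod (volume.restrict (Ioi 0))) := by
        exact Integrable.mul_prod (f := fun _ : ℝ => (1 : ℝ))
          (μ := volume.restrict (Ioc (-1 : ℝ) 1)) (integrable_const _)
          ((exp_neg_integrableOn_Ioi 0 hε).const_mul D)
      refine hb.mono' ?_ ?_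
      · refine Measurable.aestronglyMeasurable ?_
        unfold Function.uncurry
        refine Measurable.mul (Measurable.mul ?_ ?_) ?_
        · exact Complex.measurable_ofReal.comp (hfm.comp measurable_snd)
        · fun_prop
        · fun_prop
      · rw [Measure.prod_restrict]
        refine (ae_restrict_iff' (measurableSet_Ioc.prod measurableSet_Ioi)).2
          (ae_of_all _ fun p hp => ?_)
        simp only [Function.uncurry, norm_mul, Complex.norm_real, Complex.norm_exp]
        have hτ : |p.1| ≤ 1 := abs_le.2 ⟨hp.1.1.le, hp.1.2⟩
        have h1 : ‖1 - |p.1|‖ ≤ 1 := by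
          rw [Real.norm_eq_abs, abs_le]; constructor <;> linarith [abs_nonneg p.1]
        have h2 : ((p.1 : ℂ) * (l * (x - p.2) : ℝ) * Complex.I).re = 0 := by
          rw [← Complex.ofReal_mul]; simp
        have h3 : (-(ε : ℂ) * p.2).re = -ε * p.2 := by
          simp
        rw [h2, h3, Real.exp_zero, mul_one, one_mul]
        calc ‖S p.2 - A‖ * Real.exp (-ε * p.2) * ‖1 - |p.1|‖
            ≤ ‖S p.2 - A‖ * Real.exp (-ε * p.2) * 1 := by gcongr
          _ ≤ _ := by
            rw [mul_one]
            exact mul_le_mul_of_nonneg_right (hf _) (Real.exp_pos _).le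
  -- passage to the boundary line
  have hkcomp : ∀ ε : ℝ, 0 ≤ ε → Continuous fun τ : ℝ => k (ε + l * τ * Complex.I) := by
    intro ε hε
    refine hkc.comp_continuous (by fun_prop) fun τ => ?_
    simpa using hε
  have step2 : ∀ x : ℝ,
      ∫ τ in (-1 : ℝ)..1, ((1 - |τ| : ℝ) : ℂ) * Complex.exp (l * τ * x * Complex.I) *
        k (l * τ * Complex.I) =
      ∫ u in Ioi (0 : ℝ), ((S u - A : ℝ) : ℂ) * (fejer (l * (x - u)) : ℂ) := by
    intro x
    obtain ⟨M, hM⟩ : ∃ M, ∀ ε ∈ Icc (0 : ℝ) 1, ∀ τ ∈ Icc (-1 : ℝ) 1,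
        ‖k (ε + l * τ * Complex.I)‖ ≤ M := by
      have hcomp : IsCompact (Icc (0 : ℝ) 1 ×ˢ Icc (-1 : ℝ) 1) := isCompact_Icc.prod isCompact_Icc
      have hcont : ContinuousOn (fun p : ℝ × ℝ => k (p.1 + l * p.2 * Complex.I))
          (Icc (0 : ℝ) 1 ×ˢ Icc (-1 : ℝ) 1) := by
        refine hkc.comp (by fun_prop) fun p hp => ?_
        simpa using hp.1.1
      obtain ⟨M, hM⟩ := hcomp.exists_bound_of_continuousOn hcont
      exact ⟨M, fun ε hε τ hτ => hM (ε, τ) ⟨hε, hτ⟩⟩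
    have hev : ∀ᶠ ε : ℝ in 𝓝[>] 0, ε ∈ Ioo (0 : ℝ) 1 := Ioo_mem_nhdsGT one_pos
    have lim1 : Tendsto (fun ε : ℝ => ∫ τ in (-1 : ℝ)..1, ((1 - |τ| : ℝ) : ℂ) *
        Complex.exp (l * τ * x * Complex.I) * k (ε + l * τ * Complex.I)) (𝓝[>] 0)
        (𝓝 (∫ τ in (-1 : ℝ)..1, ((1 - |τ| : ℝ) : ℂ) * Complex.exp (l * τ * x * Complex.I) *
        k (l * τ * Complex.I))) := by
      refine intervalIntegral.tendsto_integral_filter_of_dominated_convergence (fun _ => M) ?_ ?_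
        (by simp) ?_
      · filter_upwards [hev] with ε hε
        exact ((by fun_prop : Continuous fun τ : ℝ => ((1 - |τ| : ℝ) : ℂ) *
          Complex.exp (l * τ * x * Complex.I)).mul (hkcomp ε hε.1.le)).aestronglyMeasurable
      · filter_upwards [hev] with ε hε
        refine ae_of_all _ fun τ hτ => ?_
        rw [uIoc_of_le (by norm_num)] at hτ
        have h1 : ‖((1 - |τ| : ℝ) : ℂ)‖ ≤ 1 := by
          have hτ : |τ| ≤ 1 := abs_le.2 ⟨hτ.1.le, hτ.2⟩
          rw [Complex.norm_real, Real.norm_eq_abs, abs_le]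
          constructor <;> linarith [abs_nonneg τ]
        have h2 : ‖Complex.exp (l * τ * x * Complex.I)‖ = 1 := by
          rw [Complex.norm_exp]
          rw [← Complex.ofReal_mul, ← Complex.ofReal_mul]; simp
        rw [norm_mul, norm_mul, h2, mul_one]
        exact (mul_le_of_le_one_left (norm_nonneg _) h1).trans
          (hM ε ⟨hε.1.le, hε.2.le⟩ τ ⟨hτ.1.le, hτ.2⟩)
      · refine ae_of_all _ fun τ _ => ?_
        refine Tendsto.mul tendsto_const_nhds ?_
        have hw : ContinuousWithinAt k {z | 0 ≤ z.re} (l * τ * Complex.I) :=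
          hkc _ (by simp)
        refine Tendsto.comp hw.tendsto (tendsto_nhdsWithin_iff.2 ⟨?_, ?_⟩)
        · have : Tendsto (fun ε : ℝ => (ε : ℂ) + l * τ * Complex.I) (𝓝 0)
              (𝓝 (((0 : ℝ) : ℂ) + l * τ * Complex.I)) :=
            Continuous.tendsto (by fun_prop) 0
          simpa using this.mono_left nhdsWithin_le_nhds
        · filter_upwards [hev] with ε hε
          simpa using hε.1.le
    have lim2 : Tendsto (fun ε : ℝ => ∫ u in Ioi (0 : ℝ), ((S u - A : ℝ) : ℂ) *
        Complex.exp (-ε * u) * (fejer (l * (x - u)) : ℂ)) (𝓝[>] 0)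
        (𝓝 (∫ u in Ioi (0 : ℝ), ((S u - A : ℝ) : ℂ) * (fejer (l * (x - u)) : ℂ))) := by
      refine tendsto_integral_filter_of_dominated_convergence
        (fun u => D * fejer (l * (x - u))) ?_ ?_ ((hfej x).const_mul D).integrableOn ?_
      · refine Eventually.of_forall fun ε => Measurable.aestronglyMeasurable ?_
        refine Measurable.mul (Measurable.mul (Complex.measurable_ofReal.comp hfm) (by fun_prop))
          (Complex.measurable_ofReal.comp (hfejm x))
      · filter_upwards [hev] with ε hε
        refine (ae_restrict_iff' measurableSet_Ioi).2 (ae_of_all _ fun u hu => ?_)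
        rw [norm_mul, norm_mul, Complex.norm_real, Complex.norm_real, Complex.norm_exp,
          Real.norm_of_nonneg (fejer_nonneg _)]
        refine mul_le_mul_of_nonneg_right ?_ (fejer_nonneg _)
        have h3 : (-(ε : ℂ) * u).re = -ε * u := by simp
        rw [h3]
        refine (mul_le_of_le_one_right (norm_nonneg _) ?_).trans (hf u)
        rw [Real.exp_le_one_iff]
        have := mul_pos hε.1 (mem_Ioi.1 hu)
        linarith
      · refine ae_of_all _ fun u => ?_
        refine Tendsto.mul ?_ tendsto_const_nhds
        have : Tendsto (fun ε : ℝ => ((S u - A : ℝ) : ℂ) * Complex.exp (-ε * u)) (𝓝 0)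
            (𝓝 (((S u - A : ℝ) : ℂ) * Complex.exp (-(0 : ℝ) * u))) :=
          Continuous.tendsto (by fun_prop) 0
        simpa using this.mono_left nhdsWithin_le_nhds
    refine tendsto_nhds_unique lim1 (lim2.congr' ?_)
    filter_upwards [hev] with ε hε
    exact (step1 ε hε.1 x).symm
  -- Riemann-Lebesgue
  have step3 : Tendsto (fun x : ℝ => ∫ τ in (-1 : ℝ)..1, ((1 - |τ| : ℝ) : ℂ) *
      Complex.exp (l * τ * x * Complex.I) * k (l * τ * Complex.I)) atTop (𝓝 0) := by
    have hRL := Real.tendsto_integral_exp_smul_cocompact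
      (indicator (Ioc (-1 : ℝ) 1) fun τ : ℝ => ((1 - |τ| : ℝ) : ℂ) * k (l * τ * Complex.I))
    have hw : Tendsto (fun x : ℝ => -(l * x / (2 * Real.pi))) atTop (cocompact ℝ) := by
      refine Tendsto.mono_right ?_ atBot_le_cocompact
      refine tendsto_neg_atTop_atBot.comp ?_
      refine Tendsto.atTop_div_const (by positivity) ?_
      exact tendsto_id.const_mul_atTop hl
    refine (hRL.comp hw).congr fun x => ?_
    rw [intervalIntegral.integral_of_le (by norm_num), ← integral_indicator measurableSet_Ioc]
    refine integral_congr_ae (ae_of_all _ fun τ => ?_)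
    by_cases hτ : τ ∈ Ioc (-1 : ℝ) 1
    · simp only [indicator_of_mem hτ, Circle.smul_def, Real.fourierChar_apply, smul_eq_mul]
      rw [show ((2 * Real.pi * -(τ * -(l * x / (2 * Real.pi))) : ℝ) : ℂ) * Complex.I =
        l * τ * x * Complex.I by
          have : (Real.pi : ℂ) ≠ 0 := by exact_mod_cast Real.pi_ne_zero
          push_cast; field_simp]
      ring
    · simp [indicator_of_notMem hτ]
  have step4 : Tendsto (fun x : ℝ => ∫ u in Ioi (0 : ℝ), (S u - A) * fejer (l * (x - u)))
      atTop (𝓝 0) := by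
    have h := (Complex.continuous_re.tendsto _).comp (step3.congr step2)
    refine h.congr fun x => ?_
    have : ∫ u in Ioi (0 : ℝ), ((S u - A : ℝ) : ℂ) * (fejer (l * (x - u)) : ℂ) =
        ((∫ u in Ioi (0 : ℝ), (S u - A) * fejer (l * (x - u)) : ℝ) : ℂ) := by
      rw [← integral_complex_ofReal]
      simp only [Complex.ofReal_mul]
    simp only [Function.comp, this, Complex.ofReal_re]
  have step5 : ∀ x : ℝ, ∫ v, S (x - v / l) * fejer v =
      l * (∫ u in Ioi (0 : ℝ), (S u - A) * fejer (l * (x - u))) +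
        A * ∫ v in Iio (l * x), fejer v := by
    intro x
    have c1 : ∀ G : ℝ → ℝ, ∫ v, G v = l * ∫ u, G (l * (x - u)) := by
      intro G
      have := integral_sub_left_eq_self (fun u => G (l * u)) volume x
      rw [this, Measure.integral_comp_mul_left, abs_of_pos (inv_pos.2 hl), smul_eq_mul,
        ← mul_assoc, mul_inv_cancel₀ hl.ne', one_mul]
    have i1 : Integrable fun v => S (x - v / l) * fejer v := by
      refine integrable_fejer.bdd_mul (c := C) (hmeas.comp (by fun_prop)).aestronglyMeasurable ?_
      filter_upwards with v
      rw [Real.norm_of_nonneg (h0 _)]; exact hC _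
    rw [← integral_indicator measurableSet_Ioi, ← integral_indicator measurableSet_Iio]
    rw [show (∫ u, (Ioi (0 : ℝ)).indicator (fun u => (S u - A) * fejer (l * (x - u))) u) =
      ∫ u, (fun v => S (x - v / l) * fejer v - A * (Iio (l * x)).indicator fejer v)
        (l * (x - u)) from ?_]
    · rw [← c1 fun v => S (x - v / l) * fejer v - A * (Iio (l * x)).indicator fejer v,
        integral_sub i1 ((integrable_fejer.indicator measurableSet_Iio).const_mul A),
        integral_const_mul]
      ring
    · refine integral_congr_ae ?_
      have : ∀ᵐ u : ℝ, u ≠ 0 := by simp [ae_iff]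
      filter_upwards [this] with u hu
      have e : x - l * (x - u) / l = u := by field_simp; ring
      simp only [e]
      rcases lt_or_gt_of_ne hu with h | h
      · rw [indicator_of_notMem (by simpa using h.le), indicator_of_notMem, hneg u h]
        · ring
        · simp only [mem_Iio, not_lt]
          exact mul_le_mul_of_nonneg_left (by linarith) hl.le
      · rw [indicator_of_mem (by simpa using h), indicator_of_mem]
        · ring
        · simp only [mem_Iio]
          exact mul_lt_mul_of_pos_left (by linarith) hl
  have step6 : Tendsto (fun x : ℝ => ∫ v in Iio (l * x), fejer v) atTop (𝓝 (∫ v, fejer v)) :=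
    (aecover_Iio (tendsto_id.const_mul_atTop hl)).integral_tendsto_of_countably_generated
      integrable_fejer
  have := (step4.const_mul l).add (step6.const_mul A)
  rw [mul_zero, zero_add] at this
  exact this.congr fun x => (step5 x).symm

/-- The Wiener–Ikehara theorem, under the additional assumption of a Chebyshev bound. -/
theorem wienerIkehara_of_le {w : ℕ → ℝ} {C A : ℝ} (h0 : ∀ n, 0 ≤ w n)
    (hC : ∀ n : ℕ, ∑ k ∈ Finset.Icc 1 n, w k ≤ C * n) {g : ℂ → ℂ}
    (hg : ContinuousOn g {s | 1 ≤ s.re})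
    (hL : ∀ s : ℂ, 1 < s.re → LSeries (fun n => w n) s = A / (s - 1) + g s) :
    Tendsto (fun n : ℕ => (∑ k ∈ Finset.Icc 1 n, w k) / n) atTop (𝓝 A) := by
  set ψ : ℝ → ℝ := fun x => ∑ k ∈ Finset.Icc 1 ⌊x⌋₊, w k with hψ
  have ψmono : Monotone ψ := fun x y hxy =>
    Finset.sum_le_sum_of_subset_of_nonneg
      (Finset.Icc_subset_Icc_right (Nat.floor_mono hxy)) fun i _ _ => h0 i
  have ψ0 : ∀ x, 0 ≤ ψ x := fun x => Finset.sum_nonneg fun i _ => h0 i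
  have hC0 : 0 ≤ C := by
    have := hC 1
    simp only [Finset.Icc_self, Finset.sum_singleton, Nat.cast_one, mul_one] at this
    exact (h0 1).trans this
  have ψle : ∀ x, 0 ≤ x → ψ x ≤ C * x := fun x hx =>
    (hC _).trans (mul_le_mul_of_nonneg_left (Nat.floor_le hx) hC0)
  set S : ℝ → ℝ := fun u => ψ (Real.exp u) * Real.exp (-u) with hS
  have Sm : Measurable S := (ψmono.measurable.comp Real.measurable_exp).mul (by fun_prop)
  have S0 : ∀ u, 0 ≤ S u := fun u => mul_nonneg (ψ0 _) (Real.exp_pos _).le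
  have SC : ∀ u, S u ≤ C := fun u => by
    have := mul_le_mul_of_nonneg_right (ψle _ (Real.exp_pos u).le) (Real.exp_pos (-u)).le
    rwa [mul_assoc, ← Real.exp_add, add_neg_cancel, Real.exp_zero, mul_one] at this
  have Sneg : ∀ u < 0, S u = 0 := fun u hu => by
    have : ⌊Real.exp u⌋₊ = 0 := Nat.floor_eq_zero.2 (Real.exp_lt_one_iff.2 hu)
    simp [hS, hψ, this]
  have Smono : ∀ u v, 0 ≤ v → S u * Real.exp (-v) ≤ S (u + v) := fun u v hv => by
    simp only [hS, neg_add, Real.exp_add (-u), ← mul_assoc]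
    gcongr
    exact ψmono (Real.exp_le_exp.2 (by linarith))
  have hkc : ContinuousOn (fun z : ℂ => (g (z + 1) - A) / (z + 1)) {z | 0 ≤ z.re} := by
    refine ContinuousOn.div (ContinuousOn.sub (hg.comp (by fun_prop) fun z hz => ?_)
      continuousOn_const) (by fun_prop) fun z hz h => ?_
    · simp only [mem_ofPred_eq, Complex.add_re, Complex.one_re] at hz ⊢
      linarith
    · have := congrArg Complex.re h
      simp only [mem_ofPred_eq, Complex.add_re, Complex.one_re, Complex.zero_re] at hz this
      linarith
  have hO : (fun n : ℕ => ∑ k ∈ Finset.Icc 1 n, w k) =O[atTop] fun n : ℕ => (n : ℝ) ^ (1 : ℝ) := by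
    refine Asymptotics.IsBigO.of_bound C (Eventually.of_forall fun n => ?_)
    rw [Real.rpow_one, Real.norm_of_nonneg (Finset.sum_nonneg fun i _ => h0 i),
      Real.norm_of_nonneg (Nat.cast_nonneg n)]
    exact hC n
  have hk : ∀ z : ℂ, 0 < z.re → ∫ u in Ioi (0 : ℝ), ((S u - A : ℝ) : ℂ) * Complex.exp (-z * u)
      = (g (z + 1) - A) / (z + 1) := by
    intro z hz
    have hz1 : 1 < (z + 1).re := by simpa using hz
    have hz0 : z ≠ 0 := by rintro rfl; simp at hz
    have hz2 : z + 1 ≠ 0 := by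
      intro h; rw [h] at hz1; norm_num at hz1
    have iexp : IntegrableOn (fun u : ℝ => Complex.exp (-z * u)) (Ioi 0) :=
      integrableOn_exp_mul_complex_Ioi (by simpa using hz) 0
    have iS : IntegrableOn (fun u : ℝ => (S u : ℂ) * Complex.exp (-z * u)) (Ioi 0) := by
      refine Integrable.bdd_mul (c := C) iexp
        (Complex.measurable_ofReal.comp Sm).aestronglyMeasurable (ae_of_all _ fun u => ?_)
      rw [Complex.norm_real, Real.norm_of_nonneg (S0 u)]
      exact SC u
    have e1 : ∫ u in Ioi (0 : ℝ), (S u : ℂ) * Complex.exp (-z * u) =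
        LSeries (fun n => w n) (z + 1) / (z + 1) := by
      rw [LSeries_eq_mul_integral_of_nonneg w zero_le_one hz1 hO h0, mul_div_cancel_left₀ _ hz2]
      have himg : Real.exp '' Ioi 0 = Ioi 1 := by
        ext t
        constructor
        · rintro ⟨u, hu, rfl⟩
          exact Real.one_lt_exp_iff.2 hu
        · intro ht
          exact ⟨Real.log t, Real.log_pos ht, Real.exp_log (zero_lt_one.trans ht)⟩
      rw [← himg, integral_image_eq_integral_abs_deriv_smul measurableSet_Ioi
        (fun x _ => (Real.hasDerivAt_exp x).hasDerivWithinAt) Real.exp_injective.injOn]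
      refine setIntegral_congr_fun measurableSet_Ioi fun u _ => ?_
      simp only [abs_of_pos (Real.exp_pos u), Complex.real_smul, hS, hψ]
      push_cast
      rw [Complex.cpow_def_of_ne_zero (Complex.exp_ne_zero _), ← Complex.ofReal_exp,
        ← Complex.ofReal_log (Real.exp_pos u).le, Real.log_exp, mul_assoc, ← Complex.exp_add,
        Complex.ofReal_exp, mul_left_comm, ← Complex.exp_add]
      congr 2
      ring
    have e2 : ∫ u in Ioi (0 : ℝ), Complex.exp (-z * u) = 1 / z := by
      rw [integral_exp_mul_complex_Ioi (by simpa using hz)]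
      simp
    calc _ = ∫ u in Ioi (0 : ℝ), ((S u : ℂ) * Complex.exp (-z * u) -
          A * Complex.exp (-z * u)) := by
          refine integral_congr_ae (ae_of_all _ fun u => ?_)
          push_cast; ring
      _ = _ := by
          rw [integral_sub iS (iexp.const_mul _), integral_const_mul, e1, e2, hL _ hz1]
          rw [add_sub_cancel_right]
          field_simp
          ring
  have hSlim := tendsto_of_tendsto_fejer_average Sm S0 SC Smono
    fun l hl => tendsto_fejer_average Sm S0 SC Sneg hkc hk hl
  have := hSlim.comp (Real.tendsto_log_atTop.comp tendsto_natCast_atTop_atTop)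
  refine this.congr' ?_
  filter_upwards [eventually_gt_atTop 0] with n hn
  have hn' : (0 : ℝ) < n := by exact_mod_cast hn
  simp [hS, hψ, Real.exp_neg, Real.exp_log hn', div_eq_mul_inv]

/-- The binary quadratic form `A x² + B x y + C y²`. -/
def quadForm (A B C : ℤ) (v : ℤ × ℤ) : ℤ := A * v.1 ^ 2 + B * v.1 * v.2 + C * v.2 ^ 2

/-- The number of representations of `n` by the form `A x² + B x y + C y²`. -/
noncomputable def repCount (A B C n : ℤ) : ℕ := {v | quadForm A B C v = n}.ncard

lemma repCount_congr {A B C A' B' C' : ℤ} (e : ℤ × ℤ ≃ ℤ × ℤ)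
    (h : ∀ v, quadForm A B C (e v) = quadForm A' B' C' v) (n : ℤ) :
    repCount A B C n = repCount A' B' C' n := by
  have : {v | quadForm A B C v = n} = e '' {v | quadForm A' B' C' v = n} := by
    ext v
    simp only [mem_ofPred_eq, mem_image, ← h]
    exact ⟨fun hv => ⟨e.symm v, by simpa using hv, by simp⟩, by rintro ⟨w, hw, rfl⟩; exact hw⟩
  rw [repCount, repCount, this, ncard_image_of_injective _ e.injective]

lemma repCount_swap (A B C n : ℤ) : repCount A B C n = repCount C B A n :=
  repCount_congr (Equiv.prodComm ℤ ℤ) (fun v => by simp [quadForm]; ring) n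

lemma repCount_neg (A B C n : ℤ) : repCount A B C n = repCount A (-B) C n :=
  repCount_congr (Equiv.prodCongr (Equiv.neg ℤ) (Equiv.refl ℤ))
    (fun v => by simp [quadForm]) n

/-- The shear `(x, y) ↦ (x + k y, y)`. -/
def shearEquiv (k : ℤ) : ℤ × ℤ ≃ ℤ × ℤ where
  toFun v := (v.1 + k * v.2, v.2)
  invFun v := (v.1 - k * v.2, v.2)
  left_inv v := by simp
  right_inv v := by simp

lemma repCount_shear (A B C k n : ℤ) :
    repCount A B C n = repCount A (B + 2 * k * A) (A * k ^ 2 + B * k + C) n :=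
  repCount_congr (shearEquiv k) (fun v => by simp [quadForm, shearEquiv]; ring) n

/-- A positive form of discriminant `-23` represents each integer as often as
`x² + x y + 6 y²` does, or as often as `2 x² + x y + 3 y²` does. -/
lemma repCount_eq_or_of_discrim {A B C : ℤ} (hA : 0 < A) (hD : B ^ 2 - 4 * A * C = -23) :
    (∀ n, repCount A B C n = repCount 1 1 6 n) ∨ ∀ n, repCount A B C n = repCount 2 1 3 n := by
  induction hm : A.natAbs using Nat.strong_induction_on generalizing A B C with
  | _ m ih =>
  subst hm
  obtain ⟨k, hk1, hk2⟩ : ∃ k : ℤ, -A ≤ B + 2 * k * A ∧ B + 2 * k * A < A := by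
    refine ⟨-((B + A) / (2 * A)), ?_, ?_⟩
    · have := Int.emod_nonneg (B + A) (b := 2 * A) (by lia)
      have := Int.emod_add_mul_ediv (B + A) (2 * A)
      linarith
    · have := Int.emod_lt_of_pos (B + A) (b := 2 * A) (by lia)
      have := Int.emod_add_mul_ediv (B + A) (2 * A)
      linarith
  simp only [repCount_shear A B C k]
  set B' := B + 2 * k * A with hB'
  set C' := A * k ^ 2 + B * k + C with hC'
  have hD' : B' ^ 2 - 4 * A * C' = -23 := by rw [hB', hC', ← hD]; ring
  have hB2 : B' ^ 2 ≤ A ^ 2 := sq_le_sq' hk1 hk2.le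
  rcases lt_or_ge C' A with hCA | hCA
  · have hC0 : 0 < C' := by
      by_contra! h
      nlinarith [mul_nonneg hA.le (neg_nonneg.2 h), sq_nonneg B']
    simp only [repCount_swap A B' C']
    exact ih _ (by lia) hC0 (by linarith) rfl
  · have hA3 : A < 3 := by nlinarith
    clear_value B' C'
    clear hB' hC' hD ih
    have h0 : C' < 8 := by nlinarith
    have hC1 : 0 < C' := by lia
    have : -3 < B' := by lia
    have : B' < 3 := by lia
    interval_cases A
    · interval_cases B'
      · left; intro n; rw [repCount_neg, show C' = 6 by lia]; norm_num
      · lia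
    · interval_cases B'
      · lia
      · right; intro n; rw [repCount_neg, show C' = 3 by lia]; norm_num
      · lia
      · right; intro n; rw [show C' = 3 by lia]

/-- Positive definiteness, in a form convenient for finiteness arguments. -/
lemma finite_quadForm_le {A B C : ℤ} (hA : 0 < A) (hD : B ^ 2 - 4 * A * C = -23) (n : ℤ) :
    {v | quadForm A B C v ≤ n}.Finite := by
  have hC : 0 < C := by
    by_contra! h
    nlinarith [mul_nonneg hA.le (neg_nonneg.2 h), sq_nonneg B]
  refine (((finite_Icc (-(4 * C * |n|)) (4 * C * |n|))).prod
    (finite_Icc (-(4 * A * |n|)) (4 * A * |n|))).subset ?_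
  rintro ⟨x, y⟩ h
  simp only [quadForm, mem_ofPred_eq] at h
  have hn := le_abs_self n
  have hx : 23 * x ^ 2 ≤ 4 * C * |n| := by
    have : 4 * C * (A * x ^ 2 + B * x * y + C * y ^ 2) = (2 * C * y + B * x) ^ 2 + 23 * x ^ 2 := by
      linear_combination x ^ 2 * (-hD)
    nlinarith [sq_nonneg (2 * C * y + B * x)]
  have hy : 23 * y ^ 2 ≤ 4 * A * |n| := by
    have : 4 * A * (A * x ^ 2 + B * x * y + C * y ^ 2) = (2 * A * x + B * y) ^ 2 + 23 * y ^ 2 := by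
      linear_combination y ^ 2 * (-hD)
    nlinarith [sq_nonneg (2 * A * x + B * y)]
  have key : ∀ z : ℤ, |z| ≤ z ^ 2 := fun z => by
    rw [← sq_abs]; nlinarith [abs_nonneg z, Int.le_self_sq |z|]
  refine ⟨mem_Icc.2 (abs_le.1 ?_), mem_Icc.2 (abs_le.1 ?_)⟩
  · have := key x; dsimp only; nlinarith [sq_nonneg x]
  · have := key y; dsimp only; nlinarith [sq_nonneg y]

lemma finite_quadForm_eq {A B C : ℤ} (hA : 0 < A) (hD : B ^ 2 - 4 * A * C = -23) (n : ℤ) :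
    {v | quadForm A B C v = n}.Finite :=
  (finite_quadForm_le hA hD n).subset fun _ h => le_of_eq h

/-- `n ↦ repCount A B C (n / p)`, extended by zero to the integers that `p` does not divide. -/
noncomputable def repCountDiv (A B C p n : ℤ) : ℕ := if p ∣ n then repCount A B C (n / p) else 0

/-- The pairs of multiples of `p`. -/
lemma ncard_quadForm_eq_of_dvd {A B C p : ℤ} (hp : p ≠ 0) (n : ℤ) :
    {v : ℤ × ℤ | quadForm A B C v = p * n ∧ p ∣ v.1 ∧ p ∣ v.2}.ncard = repCountDiv A B C p n := by
  unfold repCountDiv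
  split_ifs with h
  · obtain ⟨m, rfl⟩ := h
    rw [Int.mul_ediv_cancel_left _ hp, repCount]
    have : {v : ℤ × ℤ | quadForm A B C v = p * (p * m) ∧ p ∣ v.1 ∧ p ∣ v.2} =
        (fun v : ℤ × ℤ => (p * v.1, p * v.2)) '' {v | quadForm A B C v = m} := by
      ext ⟨x, y⟩
      simp only [mem_ofPred_eq, mem_image, Prod.mk.injEq, Prod.exists]
      constructor
      · rintro ⟨h, ⟨a, rfl⟩, ⟨b, rfl⟩⟩
        refine ⟨a, b, ?_, rfl, rfl⟩
        refine mul_left_cancel₀ hp (mul_left_cancel₀ hp ?_)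
        rw [← h]; simp only [quadForm]; ring
      · rintro ⟨a, b, h, rfl, rfl⟩
        refine ⟨?_, Dvd.intro _ rfl, Dvd.intro _ rfl⟩
        rw [← h]; simp only [quadForm]; ring
    rw [this, ncard_image_of_injective]
    rintro ⟨a, b⟩ ⟨c, d⟩ h
    simpa [hp] using h
  · refine (congrArg ncard ?_).trans (ncard_empty (ℤ × ℤ))
    rw [eq_empty_iff_forall_notMem]
    rintro ⟨x, y⟩ ⟨h1, ⟨a, ha⟩, ⟨b, hb⟩⟩
    simp only at ha hb
    subst ha hb
    refine h ⟨A * a ^ 2 + B * a * b + C * b ^ 2, mul_left_cancel₀ hp ?_⟩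
    rw [← h1]; simp only [quadForm]; ring

/-- The sublattice `x ≡ t y (mod p)`. -/
lemma ncard_quadForm_eq_of_dvd_sub {A B C p t D : ℤ} (hp : p ≠ 0)
    (ht : A * t ^ 2 + B * t + C = p * D) (n : ℤ) :
    {v : ℤ × ℤ | quadForm A B C v = p * n ∧ p ∣ v.1 - t * v.2}.ncard =
      repCount (A * p) (2 * A * t + B) D n := by
  have : {v : ℤ × ℤ | quadForm A B C v = p * n ∧ p ∣ v.1 - t * v.2} =
      (fun v : ℤ × ℤ => (t * v.2 + p * v.1, v.2)) ''
        {v | quadForm (A * p) (2 * A * t + B) D v = n} := by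
    ext ⟨x, y⟩
    simp only [mem_ofPred_eq, mem_image, Prod.mk.injEq, Prod.exists]
    constructor
    · rintro ⟨h, ⟨a, ha⟩⟩
      obtain rfl : x = t * y + p * a := by linarith
      refine ⟨a, y, mul_left_cancel₀ hp ?_, rfl, rfl⟩
      rw [← h]; simp only [quadForm]; linear_combination -y ^ 2 * ht
    · rintro ⟨a, b, h, rfl, rfl⟩
      refine ⟨?_, a, by ring⟩
      rw [← h]; simp only [quadForm]; linear_combination b ^ 2 * ht
  rw [this, repCount, ncard_image_of_injective]
  rintro ⟨a, b⟩ ⟨c, d⟩ h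
  simp only [Prod.mk.injEq] at h
  obtain ⟨h, rfl⟩ := h
  simpa [hp] using h

lemma repCount_mul_add {A B C p t₁ t₂ D₁ D₂ : ℤ} (hp : Prime p) (hA : 0 < A) 
    (hD : B ^ 2 - 4 * A * C = -23) (hpA : ¬ p ∣ A) (ht : ¬ p ∣ t₁ - t₂)
    (h1 : A * t₁ ^ 2 + B * t₁ + C = p * D₁) (h2 : A * t₂ ^ 2 + B * t₂ + C = p * D₂) (n : ℤ) :
    repCount A B C (p * n) + repCountDiv A B C p n =
      repCount (A * p) (2 * A * t₁ + B) D₁ n + repCount (A * p) (2 * A * t₂ + B) D₂ n := by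
  have hsum : p ∣ A * (t₁ + t₂) + B := by
    have : p ∣ (t₁ - t₂) * (A * (t₁ + t₂) + B) := ⟨D₁ - D₂, by linear_combination h1 - h2⟩
    exact (hp.dvd_or_dvd this).resolve_left ht
  obtain ⟨s, hs⟩ := hsum
  rw [← ncard_quadForm_eq_of_dvd_sub hp.ne_zero h1, ← ncard_quadForm_eq_of_dvd_sub hp.ne_zero h2,
    ← ncard_quadForm_eq_of_dvd hp.ne_zero, repCount]
  have fin := finite_quadForm_eq hA hD (p * n)
  rw [← ncard_union_add_ncard_inter {v : ℤ × ℤ | quadForm A B C v = p * n ∧ p ∣ v.1 - t₁ * v.2}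
    {v : ℤ × ℤ | quadForm A B C v = p * n ∧ p ∣ v.1 - t₂ * v.2} (fin.subset fun v hv => hv.1)
    (fin.subset fun v hv => hv.1)]
  congr 2
  · ext ⟨x, y⟩
    simp only [mem_ofPred_eq, mem_union]
    constructor
    · intro h
      have : p ∣ A * ((x - t₁ * y) * (x - t₂ * y)) := by
        refine ⟨n - s * x * y - (D₁ - s * t₁) * y ^ 2, ?_⟩
        simp only [quadForm] at h
        linear_combination h - y ^ 2 * h1 + (t₁ * y ^ 2 - x * y) * hs
      rcases hp.dvd_or_dvd ((hp.dvd_or_dvd this).resolve_left hpA) with h' | h'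
      · exact Or.inl ⟨h, h'⟩
      · exact Or.inr ⟨h, h'⟩
    · rintro (h | h) <;> exact h.1
  · ext ⟨x, y⟩
    simp only [mem_ofPred_eq, mem_inter_iff]
    constructor
    · rintro ⟨h, hx, hy⟩
      exact ⟨⟨h, dvd_sub hx (hy.mul_left _)⟩, h, dvd_sub hx (hy.mul_left _)⟩
    · rintro ⟨⟨h, ha⟩, -, hb⟩
      have : p ∣ (t₁ - t₂) * y := by
        obtain ⟨c, hc⟩ := ha
        obtain ⟨d, hd⟩ := hb
        exact ⟨d - c, by linear_combination hd - hc⟩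
      have hy := (hp.dvd_or_dvd this).resolve_left ht
      exact ⟨h, by simpa using dvd_add ha (hy.mul_left t₁), hy⟩

lemma repCount_one_one_six_zero : repCount 1 1 6 0 = 1 := by
  have : {v | quadForm 1 1 6 v = 0} = {((0 : ℤ), (0 : ℤ))} := by
    ext ⟨x, y⟩
    simp only [quadForm, mem_ofPred_eq, mem_singleton_iff, Prod.mk.injEq]
    constructor
    · intro h
      have hy : y = 0 := by
        by_contra h0
        have : 0 < y ^ 2 := by positivity
        nlinarith [sq_nonneg (2 * x + y)]
      subst hy
      simpa using h
    · rintro ⟨rfl, rfl⟩; norm_num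
  rw [repCount, this, ncard_singleton]

lemma repCount_two_one_three_zero : repCount 2 1 3 0 = 1 := by
  have : {v | quadForm 2 1 3 v = 0} = {((0 : ℤ), (0 : ℤ))} := by
    ext ⟨x, y⟩
    simp only [quadForm, mem_ofPred_eq, mem_singleton_iff, Prod.mk.injEq]
    constructor
    · intro h
      have hy : y = 0 := by
        by_contra h0
        have : 0 < y ^ 2 := by positivity
        nlinarith [sq_nonneg (4 * x + y)]
      subst hy
      simpa using h
    · rintro ⟨rfl, rfl⟩; norm_num
  rw [repCount, this, ncard_singleton]

lemma repCount_one_one_six_one : repCount 1 1 6 1 = 2 := by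
  have : {v | quadForm 1 1 6 v = 1} = {((1 : ℤ), (0 : ℤ)), (-1, 0)} := by
    ext ⟨x, y⟩
    simp only [quadForm, mem_ofPred_eq, mem_insert_iff, mem_singleton_iff, Prod.mk.injEq]
    constructor
    · intro h
      have hy : y = 0 := by
        by_contra h0
        have : 0 < y ^ 2 := by positivity
        nlinarith [sq_nonneg (2 * x + y)]
      subst hy
      have : x * x = 1 := by linarith
      simpa using mul_self_eq_one_iff.1 this
    · rintro (⟨rfl, rfl⟩ | ⟨rfl, rfl⟩) <;> norm_num
  rw [repCount, this, ncard_pair (by norm_num)]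

lemma repCount_one_one_six_two : repCount 1 1 6 2 = 0 := by
  have : {v | quadForm 1 1 6 v = 2} = ∅ := by
    rw [eq_empty_iff_forall_notMem]
    rintro ⟨x, y⟩ h
    simp only [quadForm, mem_ofPred_eq] at h
    have hy : y = 0 := by
      by_contra h0
      have : 0 < y ^ 2 := by positivity
      nlinarith [sq_nonneg (2 * x + y)]
    subst hy
    have h1 : x < 2 := by nlinarith
    have h2 : -2 < x := by nlinarith
    interval_cases x <;> simp at h
  rw [repCount, this, ncard_empty]

lemma repCount_two_one_three_one : repCount 2 1 3 1 = 0 := by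
  have : {v | quadForm 2 1 3 v = 1} = ∅ := by
    rw [eq_empty_iff_forall_notMem]
    rintro ⟨x, y⟩ h
    simp only [quadForm, mem_ofPred_eq] at h
    have hy : y = 0 := by
      by_contra h0
      have : 0 < y ^ 2 := by positivity
      nlinarith [sq_nonneg (4 * x + y)]
    subst hy
    lia
  rw [repCount, this, ncard_empty]

lemma repCount_two_one_three_two : repCount 2 1 3 2 = 2 := by
  have : {v | quadForm 2 1 3 v = 2} = {((1 : ℤ), (0 : ℤ)), (-1, 0)} := by
    ext ⟨x, y⟩
    simp only [quadForm, mem_ofPred_eq, mem_insert_iff, mem_singleton_iff, Prod.mk.injEq]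
    constructor
    · intro h
      have hy : y = 0 := by
        by_contra h0
        have : 0 < y ^ 2 := by positivity
        nlinarith [sq_nonneg (4 * x + y)]
      subst hy
      have : x * x = 1 := by linarith
      simpa using mul_self_eq_one_iff.1 this
    · rintro (⟨rfl, rfl⟩ | ⟨rfl, rfl⟩) <;> norm_num
  rw [repCount, this, ncard_pair (by norm_num)]

lemma repCount_one_one_six_two_mul (n : ℤ) :
    repCount 1 1 6 (2 * n) + repCountDiv 1 1 6 2 n = 2 * repCount 2 1 3 n := by
  rw [repCount_mul_add (t₁ := 0) (t₂ := 1) (D₁ := 3) (D₂ := 4) Int.prime_two one_pos (by norm_num)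
    (by norm_num) (by norm_num) (by norm_num) (by norm_num), repCount_shear _ _ 4 (-1),
    repCount_neg _ _ (_ + 4)]
  norm_num
  ring

lemma repCount_two_one_three_two_mul (n : ℤ) :
    repCount 2 1 3 (2 * n) + repCountDiv 2 1 3 2 n = repCount 1 1 6 n + repCount 2 1 3 n := by
  have : repCountDiv 2 1 3 2 n = repCountDiv 3 1 2 2 n := by
    simp only [repCountDiv, repCount_swap 2 1 3]
  rw [this, repCount_swap, repCount_mul_add (t₁ := 0) (t₂ := 1) (D₁ := 1) (D₂ := 3) Int.prime_two
    (by norm_num) (by norm_num) (by norm_num) (by norm_num) (by norm_num) (by norm_num),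
    repCount_swap _ _ 1, repCount_swap _ _ 3, repCount_shear 3 _ _ (-1), repCount_neg 3,
    repCount_swap 3]
  norm_num
  rw [repCount_neg 2 (-1), neg_neg]

lemma exists_repCount_mul_add {A B C p s : ℤ} (hp : Prime p) (hp0 : 0 < p) (hp2 : ¬ p ∣ 2)
    (hp23 : ¬ p ∣ 23) (hA : 0 < A) (hpA : ¬ p ∣ A) (hD : B ^ 2 - 4 * A * C = -23)
    (hs : p ∣ s ^ 2 + 23) :
    ∃ i ≤ 2, ∀ n, repCount A B C (p * n) + repCountDiv A B C p n =
      i * repCount 1 1 6 n + (2 - i) * repCount 2 1 3 n := by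
  obtain ⟨u, v, huv⟩ : IsCoprime (2 * A) p :=
    (Prime.coprime_iff_not_dvd hp).2 (fun h => (hp.dvd_or_dvd h).elim hp2 hpA) |>.symm
  have root : ∀ s, p ∣ s ^ 2 + 23 → p ∣ A * (u * (s - B)) ^ 2 + B * (u * (s - B)) + C := by
    rintro s ⟨k, hk⟩
    have : p ∣ 2 * (2 * (A * (A * (u * (s - B)) ^ 2 + B * (u * (s - B)) + C))) := by
      refine ⟨k - v * (s - B) * (2 * s - v * p * (s - B)), ?_⟩
      linear_combination hk - hD + (s - B) * (2 * A * u * (s - B) + 2 * B + (s - B) * (1 - v * p))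
        * huv
    exact (hp.dvd_or_dvd ((hp.dvd_or_dvd ((hp.dvd_or_dvd this).resolve_left hp2)).resolve_left
      hp2)).resolve_left hpA
  obtain ⟨D₁, h1⟩ := root s hs
  obtain ⟨D₂, h2⟩ := root (-s) (by simpa using hs)
  have hne : ¬ p ∣ u * (s - B) - u * (-s - B) := by
    rintro ⟨k, hk⟩
    have : p ∣ 2 * s := ⟨k * 2 * A + v * (2 * s), by linear_combination 2 * A * hk - 2 * s * huv⟩
    have := (hp.dvd_or_dvd this).resolve_left hp2
    exact hp23 ((Int.dvd_add_right (dvd_pow this two_ne_zero)).1 hs)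
  have key := repCount_mul_add hp hA hD hpA hne h1 h2
  have d : ∀ {t D : ℤ}, A * t ^ 2 + B * t + C = p * D →
      (2 * A * t + B) ^ 2 - 4 * (A * p) * D = -23 := fun {t D} h => by
    linear_combination hD + 4 * A * h
  have hAp : 0 < A * p := mul_pos hA hp0
  rcases repCount_eq_or_of_discrim hAp (d h1) with e1 | e1 <;>
  rcases repCount_eq_or_of_discrim hAp (d h2) with e2 | e2
  · exact ⟨2, le_rfl, fun n => by rw [key, e1, e2]; lia⟩
  · exact ⟨1, one_le_two, fun n => by rw [key, e1, e2]; lia⟩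
  · exact ⟨1, one_le_two, fun n => by rw [key, e1, e2]; lia⟩
  · exact ⟨0, zero_le_two, fun n => by rw [key, e1, e2]; lia⟩

/-- The action of a split prime on the representation numbers: either the prime is represented
by the principal form, or it exchanges the two forms. -/
lemma repCount_mul_of_dvd_sq_add {p s : ℤ} (hp : Prime p) (hp0 : 0 < p) (hp2 : ¬ p ∣ 2)
    (hp23 : ¬ p ∣ 23) (hs : p ∣ s ^ 2 + 23) :
    (repCount 1 1 6 p ≠ 0 ∧
      (∀ n, repCount 1 1 6 (p * n) + repCountDiv 1 1 6 p n = 2 * repCount 1 1 6 n) ∧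
      ∀ n, repCount 2 1 3 (p * n) + repCountDiv 2 1 3 p n = 2 * repCount 2 1 3 n) ∨
    (repCount 1 1 6 p = 0 ∧
      (∀ n, repCount 1 1 6 (p * n) + repCountDiv 1 1 6 p n = 2 * repCount 2 1 3 n) ∧
      ∀ n, repCount 2 1 3 (p * n) + repCountDiv 2 1 3 p n =
        repCount 1 1 6 n + repCount 2 1 3 n) := by
  obtain ⟨i, hi, h1⟩ := exists_repCount_mul_add hp hp0 hp2 hp23 one_pos
    (fun h => hp.not_isUnit (isUnit_of_dvd_one h)) (B := 1) (C := 6) (by norm_num) hs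
  obtain ⟨j, hj, h2⟩ := exists_repCount_mul_add hp hp0 hp2 hp23 two_pos hp2 (B := 1) (C := 3)
    (by norm_num) hs
  have hp1 : ¬ p ∣ 1 := fun h => hp.not_isUnit (isUnit_of_dvd_one h)
  have hp2' : ¬ 2 ∣ p := fun h => hp2 ((Int.prime_two.dvd_prime_iff_associated hp).1 h).symm.dvd
  have a1 := h1 1
  have a2 := h1 2
  have b1 := h2 1
  have b2 := h2 2
  have c := repCount_one_one_six_two_mul p
  rw [mul_comm 2 p] at c
  simp only [repCountDiv, hp1, hp2, hp2', if_false, mul_one, repCount_one_one_six_one,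
    repCount_one_one_six_two, repCount_two_one_three_one, repCount_two_one_three_two] at a1 a2 b1 b2 c
  interval_cases i <;> interval_cases j <;> try (exfalso; lia)
  · right
    exact ⟨by lia, fun n => by rw [h1]; lia, fun n => by rw [h2]; lia⟩
  · left
    exact ⟨by lia, fun n => by rw [h1]; lia, fun n => by rw [h2]; lia⟩

lemma repCount_mul_of_not_dvd_sq_add {A B C p : ℤ} (hp : Prime p) (hp2 : ¬ p ∣ 2) (hpA : ¬ p ∣ A)
    (hD : B ^ 2 - 4 * A * C = -23) (hs : ∀ s, ¬ p ∣ s ^ 2 + 23) (n : ℤ) :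
    repCount A B C (p * n) = repCountDiv A B C p n := by
  rw [← ncard_quadForm_eq_of_dvd hp.ne_zero, repCount]
  congr 1
  ext ⟨x, y⟩
  simp only [mem_ofPred_eq]
  refine ⟨fun h => ⟨h, ?_⟩, fun h => h.1⟩
  have e : (2 * A * x + B * y) ^ 2 + 23 * y ^ 2 = p * (4 * A * n) := by
    simp only [quadForm] at h
    linear_combination 4 * A * h + y ^ 2 * hD
  have hy : p ∣ y := by
    by_contra hy
    obtain ⟨u, v, huv⟩ : IsCoprime y p := ((Prime.coprime_iff_not_dvd hp).2 hy).symm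
    refine hs (u * (2 * A * x + B * y)) ⟨u ^ 2 * (4 * A * n) + 23 * v * (u * y + 1), ?_⟩
    linear_combination u ^ 2 * e - 23 * (u * y + 1) * huv
  refine ⟨?_, hy⟩
  obtain ⟨z, rfl⟩ := hy
  have : p ∣ 2 * A * x + B * (p * z) := by
    refine hp.dvd_of_dvd_pow (n := 2) ⟨4 * A * n - 23 * p * z ^ 2, ?_⟩
    linear_combination e
  have : p ∣ 2 * A * x := by
    rwa [Int.dvd_add_left (Dvd.intro_left _ (by ring : B * z * p = _))] at this
  exact ((hp.dvd_or_dvd this).resolve_left fun h => (hp.dvd_or_dvd h).elim hp2 hpA)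

instance fact_prime_twentyThree : Fact (Nat.Prime 23) := ⟨by norm_num⟩

/-- Half the difference of the numbers of representations of `n` by the forms
`x² + x y + 6 y²` and `2 x² + x y + 3 y²`. -/
noncomputable def formCoeff (n : ℕ) : ℝ := ((repCount 1 1 6 n : ℝ) - repCount 2 1 3 n) / 2

lemma formCoeff_zero : formCoeff 0 = 0 := by
  simp [formCoeff, repCount_one_one_six_zero, repCount_two_one_three_zero]

lemma formCoeff_one : formCoeff 1 = 1 := by
  simp [formCoeff, repCount_one_one_six_one, repCount_two_one_three_one]

lemma legendreSym_twentyThree_eq {p : ℕ} [Fact p.Prime] (hp2 : p ≠ 2) :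
    legendreSym 23 p = legendreSym p (-23) := by
  have h := legendreSym.quadratic_reciprocity' (p := p) (q := 23) hp2 (by norm_num)
  have h1 : legendreSym p (-23) = ZMod.χ₄ p * legendreSym p 23 := by
    rw [← legendreSym.at_neg_one hp2, ← legendreSym.mul]
    norm_num
  have hp : p % 2 = 1 := (Fact.out : p.Prime).eq_two_or_odd.resolve_left hp2
  rw [h, h1, ZMod.χ₄_eq_neg_one_pow hp, mul_comm (p / 2), pow_mul]
  norm_num

lemma legendreSym_twentyThree_eq_one_iff {p : ℕ} (hp : p.Prime) (hp2 : p ≠ 2) (hp23 : p ≠ 23) :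
    legendreSym 23 p = 1 ↔ ∃ s : ℤ, (p : ℤ) ∣ s ^ 2 + 23 := by
  have := Fact.mk hp
  have h0 : ((-23 : ℤ) : ZMod p) ≠ 0 := by
    rw [Ne, ZMod.intCast_zmod_eq_zero_iff_dvd, dvd_neg]
    intro h
    exact hp23 ((Nat.prime_dvd_prime_iff_eq hp (by norm_num)).1 (by exact_mod_cast h))
  rw [legendreSym_twentyThree_eq hp2, legendreSym.eq_one_iff p h0]
  constructor
  · rintro ⟨r, hr⟩
    obtain ⟨s, rfl⟩ := ZMod.intCast_surjective r
    refine ⟨s, (ZMod.intCast_zmod_eq_zero_iff_dvd _ p).1 ?_⟩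
    push_cast at hr ⊢
    rw [sq, ← hr]; ring
  · rintro ⟨s, hs⟩
    refine ⟨s, ?_⟩
    rw [← ZMod.intCast_zmod_eq_zero_iff_dvd] at hs
    push_cast at hs ⊢
    linear_combination -hs

lemma legendreSym_twentyThree_two : legendreSym 23 (2 : ℕ) = 1 := by
  rw [legendreSym.eq_one_iff 23 (by decide)]
  exact ⟨5, by decide⟩

lemma legendreSym_twentyThree_eq_neg_one {p : ℕ} (hp : p.Prime) (hp23 : p ≠ 23)
    (h : legendreSym 23 p ≠ 1) : legendreSym 23 p = -1 := by
  refine (legendreSym.eq_one_or_neg_one 23 ?_).resolve_left h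
  rw [Int.cast_natCast, Ne, ZMod.natCast_eq_zero_iff]
  exact fun h => hp23 ((Nat.prime_dvd_prime_iff_eq (by norm_num) hp).1 h).symm

/-- `n ↦ formCoeff (n / p)`, extended by zero to the integers that `p` does not divide. -/
noncomputable def formCoeffDiv (p n : ℕ) : ℝ := if p ∣ n then formCoeff (n / p) else 0

lemma formCoeffDiv_eq (p n : ℕ) :
    formCoeffDiv p n = ((repCountDiv 1 1 6 p n : ℝ) - repCountDiv 2 1 3 p n) / 2 := by
  simp only [formCoeffDiv, repCountDiv, Int.natCast_dvd_natCast]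
  split_ifs with h
  · simp [formCoeff]
  · simp

/-- The possible shapes of the Hecke relation at a prime different from `23`. -/
lemma formCoeff_prime_mul_cases {p : ℕ} (hp : p.Prime) (hp23 : p ≠ 23) :
    (legendreSym 23 p = 1 ∧ repCount 1 1 6 p ≠ 0 ∧
      ∀ n, formCoeff (p * n) = 2 * formCoeff n - formCoeffDiv p n) ∨
    (legendreSym 23 p = 1 ∧ repCount 1 1 6 p = 0 ∧
      ∀ n, formCoeff (p * n) = -1 * formCoeff n - formCoeffDiv p n) ∨
    (legendreSym 23 p = -1 ∧ repCount 1 1 6 p = 0 ∧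
      ∀ n, formCoeff (p * n) = 0 * formCoeff n + formCoeffDiv p n) := by
  by_cases hp2 : p = 2
  · subst hp2
    refine Or.inr (Or.inl ⟨legendreSym_twentyThree_two, repCount_one_one_six_two, fun n => ?_⟩)
    have h1 := repCount_one_one_six_two_mul n
    have h2 := repCount_two_one_three_two_mul n
    simp only [formCoeffDiv_eq, formCoeff]
    push_cast
    have h1' : (repCount 1 1 6 (2 * n) : ℝ) + repCountDiv 1 1 6 2 n = 2 * repCount 2 1 3 n := by
      exact_mod_cast h1
    have h2' : (repCount 2 1 3 (2 * n) : ℝ) + repCountDiv 2 1 3 2 n =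
      repCount 1 1 6 n + repCount 2 1 3 n := by exact_mod_cast h2
    linarith
  have hpp : Prime (p : ℤ) := Nat.prime_iff_prime_int.1 hp
  have hd2 : ¬ (p : ℤ) ∣ 2 := fun h =>
    hp2 ((Nat.prime_dvd_prime_iff_eq hp Nat.prime_two).1 (by exact_mod_cast h))
  have hd23 : ¬ (p : ℤ) ∣ 23 := fun h =>
    hp23 ((Nat.prime_dvd_prime_iff_eq hp (by norm_num)).1 (by exact_mod_cast h))
  have hd1 : ¬ (p : ℤ) ∣ 1 := fun h => hpp.not_isUnit (isUnit_of_dvd_one h)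
  have hp0 : (0 : ℤ) < p := by exact_mod_cast hp.pos
  by_cases hs : ∃ s : ℤ, (p : ℤ) ∣ s ^ 2 + 23
  · have hl := (legendreSym_twentyThree_eq_one_iff hp hp2 hp23).2 hs
    obtain ⟨s, hs⟩ := hs
    rcases repCount_mul_of_dvd_sq_add hpp hp0 hd2 hd23 hs with ⟨h0, h1, h2⟩ | ⟨h0, h1, h2⟩
    · refine Or.inl ⟨hl, h0, fun n => ?_⟩
      have h1' : (repCount 1 1 6 (p * n) : ℝ) + repCountDiv 1 1 6 p n = 2 * repCount 1 1 6 n := by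
        exact_mod_cast h1 n
      have h2' : (repCount 2 1 3 (p * n) : ℝ) + repCountDiv 2 1 3 p n = 2 * repCount 2 1 3 n := by
        exact_mod_cast h2 n
      simp only [formCoeffDiv_eq, formCoeff]
      push_cast
      linarith
    · refine Or.inr (Or.inl ⟨hl, h0, fun n => ?_⟩)
      have h1' : (repCount 1 1 6 (p * n) : ℝ) + repCountDiv 1 1 6 p n = 2 * repCount 2 1 3 n := by
        exact_mod_cast h1 n
      have h2' : (repCount 2 1 3 (p * n) : ℝ) + repCountDiv 2 1 3 p n =
        repCount 1 1 6 n + repCount 2 1 3 n := by exact_mod_cast h2 n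
      simp only [formCoeffDiv_eq, formCoeff]
      push_cast
      linarith
  · have hl := mt (legendreSym_twentyThree_eq_one_iff hp hp2 hp23).1 hs
    push Not at hs
    have h1 := repCount_mul_of_not_dvd_sq_add (A := 1) (B := 1) (C := 6) hpp hd2 hd1
      (by norm_num) hs
    have h2 := repCount_mul_of_not_dvd_sq_add (A := 2) (B := 1) (C := 3) hpp hd2 hd2
      (by norm_num) hs
    refine Or.inr (Or.inr ⟨legendreSym_twentyThree_eq_neg_one hp hp23 hl, ?_, fun n => ?_⟩)
    · have := h1 1
      rwa [mul_one, repCountDiv, if_neg hd1] at this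
    · simp only [formCoeffDiv_eq, formCoeff]
      push_cast
      rw [h1, h2]
      ring

lemma formCoeff_prime_mul {p : ℕ} (hp : p.Prime) (hp23 : p ≠ 23) (n : ℕ) :
    formCoeff (p * n) = formCoeff p * formCoeff n - legendreSym 23 p * formCoeffDiv p n := by
  have hd : formCoeffDiv p 1 = 0 := by simp [formCoeffDiv, hp.ne_one]
  rcases formCoeff_prime_mul_cases hp hp23 with ⟨h, -, h'⟩ | ⟨h, -, h'⟩ | ⟨h, -, h'⟩
  all_goals
    have h1 := h' 1
    rw [mul_one, formCoeff_one, hd] at h1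
    rw [h, h', h1]
    push_cast
    ring

lemma repCount_one_one_six_ne_zero_iff {p : ℕ} (hp : p.Prime) (hp2 : p ≠ 2) :
    repCount 1 1 6 p ≠ 0 ↔ ∃ x y : ℤ, (p : ℤ) = x ^ 2 + 23 * y ^ 2 := by
  rw [repCount, ← Nat.pos_iff_ne_zero, ncard_pos (finite_quadForm_eq one_pos (by norm_num) _)]
  constructor
  · rintro ⟨⟨x, y⟩, h⟩
    simp only [quadForm, mem_ofPred_eq] at h
    rcases Int.even_or_odd' y with ⟨w, rfl | rfl⟩
    · exact ⟨x + w, w, by rw [← h]; ring⟩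
    · exfalso
      have : Even (p : ℤ) := by
        rw [← h, show 1 * x ^ 2 + 1 * x * (2 * w + 1) + 6 * (2 * w + 1) ^ 2 =
          x * (x + 1) + 2 * (x * w + 3 * (2 * w + 1) ^ 2) by ring]
        exact (Int.even_mul_succ_self x).add (even_two_mul _)
      exact hp2 ((Nat.Prime.even_iff hp).1 (by exact_mod_cast this))
  · rintro ⟨u, w, h⟩
    refine ⟨(u - w, 2 * w), ?_⟩
    simp only [quadForm, mem_ofPred_eq, h]
    ring

lemma formCoeff_prime {p : ℕ} (hp : p.Prime) (hp23 : p ≠ 23) :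
    (legendreSym 23 p = 1 ∧ (∃ x y : ℤ, (p : ℤ) = x ^ 2 + 23 * y ^ 2) ∧ formCoeff p = 2) ∨
    (legendreSym 23 p = 1 ∧ (¬ ∃ x y : ℤ, (p : ℤ) = x ^ 2 + 23 * y ^ 2) ∧ formCoeff p = -1) ∨
    (legendreSym 23 p = -1 ∧ (¬ ∃ x y : ℤ, (p : ℤ) = x ^ 2 + 23 * y ^ 2) ∧ formCoeff p = 0) := by
  have key : (∃ x y : ℤ, (p : ℤ) = x ^ 2 + 23 * y ^ 2) ↔ repCount 1 1 6 p ≠ 0 := by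
    by_cases hp2 : p = 2
    · subst hp2
      simp only [Nat.cast_ofNat, repCount_one_one_six_two, ne_eq, not_true_eq_false, iff_false]
      rintro ⟨x, y, h⟩
      have hy : y = 0 := by
        by_contra h0
        have : 0 < y ^ 2 := by positivity
        nlinarith [sq_nonneg x]
      subst hy
      have h1 : x < 2 := by nlinarith
      have h2 : -2 < x := by nlinarith
      interval_cases x <;> simp at h
    · exact (repCount_one_one_six_ne_zero_iff hp hp2).symm
  have hd : formCoeffDiv p 1 = 0 := by simp [formCoeffDiv, hp.ne_one]
  rw [key, not_not]
  rcases formCoeff_prime_mul_cases hp hp23 with ⟨h, h0, h'⟩ | ⟨h, h0, h'⟩ | ⟨h, h0, h'⟩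
  all_goals
    have h1 := h' 1
    rw [mul_one, formCoeff_one, hd] at h1
    norm_num [h, h0, h1]

/-- The integer points of the ellipse `x² + x y + 6 y² ≤ N`. -/
noncomputable def principalRegion (N : ℕ) : Finset (ℤ × ℤ) :=
  (finite_quadForm_le (A := 1) (B := 1) (C := 6) one_pos (by norm_num) N).toFinset

/-- The integer points of the ellipse `2 x² + x y + 3 y² ≤ N`. -/
noncomputable def secondRegion (N : ℕ) : Finset (ℤ × ℤ) :=
  (finite_quadForm_le (A := 2) (B := 1) (C := 3) two_pos (by norm_num) N).toFinset

lemma mem_principalRegion {N : ℕ} {v : ℤ × ℤ} :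
    v ∈ principalRegion N ↔ quadForm 1 1 6 v ≤ N := by simp [principalRegion]

lemma mem_secondRegion {N : ℕ} {v : ℤ × ℤ} :
    v ∈ secondRegion N ↔ quadForm 2 1 3 v ≤ N := by simp [secondRegion]

lemma quadForm_one_one_six_nonneg (v : ℤ × ℤ) : 0 ≤ quadForm 1 1 6 v := by
  unfold quadForm; nlinarith [sq_nonneg (2 * v.1 + v.2), sq_nonneg v.2]

lemma quadForm_two_one_three_nonneg (v : ℤ × ℤ) : 0 ≤ quadForm 2 1 3 v := by
  unfold quadForm; nlinarith [sq_nonneg (4 * v.1 + v.2), sq_nonneg v.2]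

lemma sum_repCount_mul {A B C : ℤ} (hQ : ∀ v, 0 ≤ quadForm A B C v) {N : ℕ}
    {D : Finset (ℤ × ℤ)} (hD : ∀ v, v ∈ D ↔ quadForm A B C v ≤ N) (f : ℤ → ℂ) :
    ∑ k ∈ Finset.range (N + 1), (repCount A B C k : ℂ) * f k = ∑ v ∈ D, f (quadForm A B C v) := by
  rw [← Finset.sum_fiberwise_of_maps_to (t := Finset.range (N + 1))
    (g := fun v => (quadForm A B C v).toNat)]
  · refine Finset.sum_congr rfl fun k hk => ?_
    rw [Finset.mem_range] at hk
    have e : ∀ v, v ∈ D.filter (fun v => (quadForm A B C v).toNat = k) ↔ quadForm A B C v = k := by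
      intro v
      have := hQ v
      rw [Finset.mem_filter, hD]
      lia
    rw [Finset.sum_congr rfl (g := fun _ => f k) fun v hv => by rw [(e v).1 hv],
      Finset.sum_const, nsmul_eq_mul, repCount, ← ncard_coe_finset]
    congr 3
    ext v
    simp only [mem_ofPred_eq, Finset.mem_coe, e]
  · intro v hv
    have := (hD v).1 hv
    have := hQ v
    rw [Finset.mem_range]
    lia

lemma abs_le_sqrt {x : ℤ} {M : ℕ} (h : x ^ 2 ≤ M) : x ∈ Finset.Icc (-(Nat.sqrt M : ℤ)) (Nat.sqrt M) := by
  rw [Finset.mem_Icc, ← abs_le, Int.abs_eq_natAbs]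
  norm_cast
  rw [Nat.le_sqrt']
  zify
  rwa [sq_abs]

/-- A sum over an interval of an antiperiodic function is bounded. -/
lemma norm_sum_range_le_of_antiperiodic {f : ℤ → ℂ} (hf : ∀ y, f (y + 23) = -f y)
    (h1 : ∀ y, ‖f y‖ ≤ 1) (n : ℕ) (a : ℤ) : ‖∑ i ∈ Finset.range n, f (a + i)‖ ≤ 46 := by
  induction n using Nat.strong_induction_on generalizing a with
  | _ n ih =>
  rcases lt_or_ge n 46 with hn | hn
  · refine (norm_sum_le_of_le _ (n := fun _ => 1) fun (i : ℕ) _ => h1 (a + i)).trans ?_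
    simp only [Finset.sum_const, Finset.card_range, nsmul_eq_mul, mul_one]
    exact_mod_cast hn.le
  · obtain ⟨m, rfl⟩ := Nat.exists_eq_add_of_le hn
    have e : ∀ i : ℕ, f (a + (23 + i : ℕ)) = -f (a + i) := fun i => by
      rw [← hf]; congr 1; push_cast; ring
    rw [Finset.sum_range_add, show 46 = 23 + 23 from rfl, Finset.sum_range_add]
    simp only [e, Finset.sum_neg_distrib, add_neg_cancel, zero_add]
    have := ih m (by lia) (a + (23 + 23 : ℕ))
    simpa [add_assoc] using this

lemma norm_sum_le_of_antiperiodic {f : ℤ → ℂ} (hf : ∀ y, f (y + 23) = -f y)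
    (h1 : ∀ y, ‖f y‖ ≤ 1) {s : Finset ℤ}
    (hs : ∀ y₁ ∈ s, ∀ y₂ ∈ s, ∀ y, y₁ ≤ y → y ≤ y₂ → y ∈ s) : ‖∑ y ∈ s, f y‖ ≤ 46 := by
  rcases s.eq_empty_or_nonempty with rfl | hne
  · simp
  have : s = (Finset.range (s.max' hne + 1 - s.min' hne).toNat).image
      (fun i : ℕ => s.min' hne + i) := by
    ext y
    simp only [Finset.mem_image, Finset.mem_range]
    constructor
    · intro hy
      have h1 := s.min'_le y hy
      have h2 := s.le_max' y hy
      exact ⟨(y - s.min' hne).toNat, by lia, by lia⟩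
    · rintro ⟨i, hi, rfl⟩
      exact hs _ (s.min'_mem hne) _ (s.max'_mem hne) _ (by lia) (by lia)
  rw [this, Finset.sum_image (fun i _ j _ h => by simpa using h)]
  exact norm_sum_range_le_of_antiperiodic hf h1 _ _

/-- The difference of the indicator functions of two index two sublattices. -/
noncomputable def latticeSign (v : ℤ × ℤ) : ℂ :=
  (if Even v.2 then 1 else 0) - (if Even (v.1 + v.2) then 1 else 0)

lemma latticeSign_add (x y : ℤ) : latticeSign (x, y + 23) = -latticeSign (x, y) := by
  have h1 : Even (y + 23) ↔ ¬ Even y := by rw [Int.even_add]; simp [show ¬ Even (23 : ℤ) by decide]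
  have h2 : Even (x + (y + 23)) ↔ ¬ Even (x + y) := by
    rw [← add_assoc, Int.even_add]; simp [show ¬ Even (23 : ℤ) by decide]
  simp only [latticeSign, h1, h2]
  split_ifs <;> norm_num

lemma norm_latticeSign_le (v : ℤ × ℤ) : ‖latticeSign v‖ ≤ 1 := by
  unfold latticeSign
  split_ifs <;> norm_num

lemma norm_sum_latticeSign_le (χ : DirichletCharacter ℂ 23) (N : ℕ) :
    ‖∑ v ∈ secondRegion (2 * N), χ (quadForm 2 1 3 v : ℤ) * latticeSign v‖ ≤
      46 * (2 * Nat.sqrt (2 * N) + 1) := by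
  have maps : ∀ v ∈ secondRegion (2 * N),
      v.1 ∈ Finset.Icc (-(Nat.sqrt (2 * N) : ℤ)) (Nat.sqrt (2 * N)) := by
    intro v hv
    rw [mem_secondRegion] at hv
    refine abs_le_sqrt ?_
    simp only [quadForm] at hv
    push_cast at hv ⊢
    nlinarith [sq_nonneg (6 * v.2 + v.1)]
  rw [← Finset.sum_fiberwise_of_maps_to maps]
  refine (norm_sum_le_of_le _ (f := fun x => _) (n := fun _ => 46) fun x _ => ?_).trans ?_
  · have e : ∑ v ∈ secondRegion (2 * N) with v.1 = x, χ (quadForm 2 1 3 v : ℤ) * latticeSign v =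
        ∑ y ∈ ((secondRegion (2 * N)).filter (fun v => v.1 = x)).image Prod.snd,
          χ (quadForm 2 1 3 (x, y) : ℤ) * latticeSign (x, y) := by
      rw [Finset.sum_image]
      · refine Finset.sum_congr rfl fun v hv => ?_
        rw [← (Finset.mem_filter.1 hv).2]
      · intro v hv w hw h
        exact Prod.ext ((Finset.mem_filter.1 hv).2.trans (Finset.mem_filter.1 hw).2.symm) h
    rw [e]
    refine norm_sum_le_of_antiperiodic (f := fun y =>
      χ (quadForm 2 1 3 (x, y) : ℤ) * latticeSign (x, y)) (fun y => ?_) (fun y => ?_) ?_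
    · have h23 : (23 : ZMod 23) = 0 := by decide
      rw [latticeSign_add, mul_neg]
      congr 3
      simp only [quadForm]
      push_cast
      linear_combination (x + 3 * (2 * y + 23)) * h23
    · rw [norm_mul]
      exact mul_le_one₀ (DirichletCharacter.norm_le_one _ _) (norm_nonneg _) (norm_latticeSign_le _)
    · have mem : ∀ y, y ∈ ((secondRegion (2 * N)).filter (fun v => v.1 = x)).image Prod.snd ↔
          2 * x ^ 2 + x * y + 3 * y ^ 2 ≤ 2 * N := by
        intro y
        simp [mem_secondRegion, quadForm]
      intro y₁ h₁ y₂ h₂ y hy₁ hy₂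
      rw [mem] at *
      rcases le_total 0 (3 * (y₁ + y₂) + x) with h | h
      · nlinarith [mul_nonneg (sub_nonneg.2 hy₁) (sub_nonneg.2 hy₂), mul_nonneg h (sub_nonneg.2 hy₂)]
      · nlinarith [mul_nonneg (sub_nonneg.2 hy₁) (sub_nonneg.2 hy₂),
          mul_nonneg (neg_nonneg.2 h) (sub_nonneg.2 hy₁)]
  · rw [Finset.sum_const, Int.card_Icc, nsmul_eq_mul, mul_comm]
    gcongr
    rw [show ((Nat.sqrt (2 * N) : ℤ) + 1 - -(Nat.sqrt (2 * N) : ℤ)).toNat =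
      2 * Nat.sqrt (2 * N) + 1 by lia]
    push_cast
    rfl

lemma sum_principalRegion_eq (f : ℤ → ℂ) (N : ℕ) :
    ∑ v ∈ principalRegion N, f (2 * quadForm 1 1 6 v) =
      ∑ v ∈ secondRegion (2 * N), if Even v.2 then f (quadForm 2 1 3 v) else 0 := by
  rw [← Finset.sum_filter]
  refine Finset.sum_nbij' (fun v => (v.1, 2 * v.2)) (fun v => (v.1, v.2 / 2)) ?_ ?_ ?_ ?_ ?_
  · intro v hv
    rw [mem_principalRegion, quadForm] at hv
    simp only [Finset.mem_filter, mem_secondRegion, quadForm]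
    exact ⟨by push_cast; linarith, even_two_mul _⟩
  · rintro ⟨x, y⟩ hv
    rw [Finset.mem_filter, mem_secondRegion] at hv
    obtain ⟨hv, w, hw⟩ := hv
    simp only at hw
    subst hw
    rw [mem_principalRegion, ← two_mul, Int.mul_ediv_cancel_left _ two_ne_zero]
    simp only [quadForm] at hv ⊢
    push_cast at hv
    linarith
  · intro v _
    simp
  · rintro ⟨x, y⟩ hv
    obtain ⟨-, w, hw⟩ := Finset.mem_filter.1 hv
    simp only at hw
    subst hw
    rw [← two_mul, Int.mul_ediv_cancel_left _ two_ne_zero]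
  · intro v _
    congr 1
    simp only [quadForm]
    ring

lemma sum_secondRegion_eq (f : ℤ → ℂ) (N : ℕ) :
    ∑ v ∈ secondRegion N, f (2 * quadForm 2 1 3 v) =
      ∑ v ∈ secondRegion (2 * N), if Even (v.1 + v.2) then f (quadForm 2 1 3 v) else 0 := by
  rw [← Finset.sum_filter]
  refine Finset.sum_nbij' (fun v => (v.2 - v.1, v.1 + v.2))
    (fun v => ((v.2 - v.1) / 2, (v.1 + v.2) / 2)) ?_ ?_ ?_ ?_ ?_
  · intro v hv
    rw [mem_secondRegion, quadForm] at hv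
    simp only [Finset.mem_filter, mem_secondRegion, quadForm]
    exact ⟨by push_cast; nlinarith, ⟨v.2, by ring⟩⟩
  · rintro ⟨x, y⟩ hv
    rw [Finset.mem_filter, mem_secondRegion] at hv
    obtain ⟨hv, w, hw⟩ := hv
    simp only at hw
    obtain rfl : y = w + w - x := by linarith
    rw [mem_secondRegion, show (w + w - x - x) / 2 = w - x by lia,
      show (x + (w + w - x)) / 2 = w by lia]
    simp only [quadForm] at hv ⊢
    push_cast at hv
    nlinarith
  · rintro ⟨x, y⟩ _
    simp only [Prod.mk.injEq]
    constructor <;> lia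
  · rintro ⟨x, y⟩ hv
    obtain ⟨-, w, hw⟩ := Finset.mem_filter.1 hv
    simp only [Prod.mk.injEq] at hw ⊢
    constructor <;> lia
  · intro v _
    congr 1
    simp only [quadForm]
    ring

lemma norm_sum_formCoeff_mul_le (χ : DirichletCharacter ℂ 23) (N : ℕ) :
    ‖∑ n ∈ Finset.Icc 1 N, (formCoeff n : ℂ) * χ n‖ ≤ 23 * (2 * Nat.sqrt (2 * N) + 1) := by
  have e0 : ∑ n ∈ Finset.Icc 1 N, (formCoeff n : ℂ) * χ n =
      ∑ n ∈ Finset.range (N + 1), (formCoeff n : ℂ) * χ n := by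
    rw [Finset.range_eq_Ico, Finset.sum_eq_sum_Ico_succ_bot (Nat.succ_pos N), formCoeff_zero]
    simp
    rfl
  have hχ : ‖χ 2‖ = 1 := χ.unit_norm_eq_one (ZMod.unitOfCoprime 2 (by norm_num))
  have key : 2 * χ 2 * ∑ n ∈ Finset.range (N + 1), (formCoeff n : ℂ) * χ n =
      ∑ v ∈ secondRegion (2 * N), χ (quadForm 2 1 3 v : ℤ) * latticeSign v := by
    have h1 := sum_repCount_mul quadForm_one_one_six_nonneg
      (fun v => mem_principalRegion (N := N) (v := v)) fun k => χ ((2 * k : ℤ) : ZMod 23)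
    have h2 := sum_repCount_mul quadForm_two_one_three_nonneg
      (fun v => mem_secondRegion (N := N) (v := v)) fun k => χ ((2 * k : ℤ) : ZMod 23)
    rw [sum_principalRegion_eq (fun k => χ (k : ZMod 23))] at h1
    rw [sum_secondRegion_eq (fun k => χ (k : ZMod 23))] at h2
    simp only [latticeSign, mul_sub, mul_ite, mul_one, mul_zero, Finset.sum_sub_distrib]
    rw [← h1, ← h2, ← Finset.sum_sub_distrib, Finset.mul_sum]
    refine Finset.sum_congr rfl fun n _ => ?_
    simp only [formCoeff]
    push_cast
    rw [map_mul]
    ring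
  have := norm_sum_latticeSign_le χ N
  rw [← key, ← e0, norm_mul, norm_mul, hχ] at this
  norm_num at this
  linarith

lemma sum_abs_formCoeff_le (N : ℕ) :
    ∑ n ∈ Finset.Icc 1 N, |formCoeff n| ≤ (2 * Nat.sqrt (2 * N) + 1) ^ 2 := by
  set K : ℤ := ((Nat.sqrt (2 * N) : ℕ) : ℤ) with hK
  have c1 : (principalRegion N).card ≤ (Finset.Icc (-K) K ×ˢ Finset.Icc (-K) K).card := by
    refine Finset.card_le_card fun v hv => ?_
    rw [mem_principalRegion, quadForm] at hv
    refine Finset.mem_product.2 ⟨abs_le_sqrt ?_, abs_le_sqrt ?_⟩ <;> push_cast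
    · nlinarith [sq_nonneg (12 * v.2 + v.1)]
    · nlinarith [sq_nonneg (2 * v.1 + v.2)]
  have c2 : (secondRegion N).card ≤ (Finset.Icc (-K) K ×ˢ Finset.Icc (-K) K).card := by
    refine Finset.card_le_card fun v hv => ?_
    rw [mem_secondRegion, quadForm] at hv
    refine Finset.mem_product.2 ⟨abs_le_sqrt ?_, abs_le_sqrt ?_⟩ <;> push_cast
    · nlinarith [sq_nonneg (6 * v.2 + v.1)]
    · nlinarith [sq_nonneg (4 * v.1 + v.2)]
  have c3 : (Finset.Icc (-K) K ×ˢ Finset.Icc (-K) K).card = (2 * Nat.sqrt (2 * N) + 1) ^ 2 := by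
    rw [Finset.card_product, Int.card_Icc, sq, show (K + 1 - -K).toNat = 2 * Nat.sqrt (2 * N) + 1
      by lia]
  have h1 := sum_repCount_mul quadForm_one_one_six_nonneg
      (fun v => mem_principalRegion (N := N) (v := v)) fun k => 1
  have h2 := sum_repCount_mul quadForm_two_one_three_nonneg
      (fun v => mem_secondRegion (N := N) (v := v)) fun k => 1
  simp only [mul_one, Finset.sum_const, nsmul_eq_mul] at h1 h2
  have h1' : ∑ k ∈ Finset.range (N + 1), repCount 1 1 6 k = (principalRegion N).card := by
    exact_mod_cast h1
  have h2' : ∑ k ∈ Finset.range (N + 1), repCount 2 1 3 k = (secondRegion N).card := by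
    exact_mod_cast h2
  calc ∑ n ∈ Finset.Icc 1 N, |formCoeff n|
      ≤ ∑ n ∈ Finset.range (N + 1), |formCoeff n| := by
        refine Finset.sum_le_sum_of_subset_of_nonneg (fun n hn => ?_) fun _ _ _ => abs_nonneg _
        rw [Finset.mem_Icc] at hn
        exact Finset.mem_range.2 (by lia)
    _ ≤ ∑ n ∈ Finset.range (N + 1), ((repCount 1 1 6 n : ℝ) + repCount 2 1 3 n) / 2 := by
        refine Finset.sum_le_sum fun n _ => ?_
        rw [formCoeff, abs_div, abs_two]
        gcongr
        exact (abs_sub _ _).trans (by simp)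
    _ = (((principalRegion N).card : ℝ) + (secondRegion N).card) / 2 := by
        rw [← h1', ← h2', ← Finset.sum_div, Finset.sum_add_distrib]
        push_cast
        rfl
    _ ≤ _ := by
        rw [c3] at c1 c2
        have c1' : ((principalRegion N).card : ℝ) ≤ (2 * Nat.sqrt (2 * N) + 1) ^ 2 := by
          exact_mod_cast c1
        have c2' : ((secondRegion N).card : ℝ) ≤ (2 * Nat.sqrt (2 * N) + 1) ^ 2 := by
          exact_mod_cast c2
        linarith

/-- A Dirichlet series whose partial sums are `O(n ^ r)` continues analytically to `re s > r`. -/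
lemma exists_analytic_continuation_LSeries {b : ℕ → ℂ} {r : ℝ} (hr : 0 ≤ r)
    (hO : (fun n => ∑ k ∈ Finset.Icc 1 n, b k) =O[atTop] fun n => (n : ℝ) ^ r) :
    ∃ L : ℂ → ℂ, DifferentiableOn ℂ L {s | r < s.re} ∧
      ∀ s : ℂ, r < s.re → LSeriesSummable b s → L s = LSeries b s := by
  set S : ℝ → ℂ := fun t => ∑ k ∈ Finset.Icc 1 ⌊t⌋₊, b k with hS
  have S0 : ∀ t < 1, S t = 0 := fun t ht => by simp [hS, Nat.floor_eq_zero.2 ht]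
  have Sloc : LocallyIntegrableOn S (Ioi 0) := by
    have := locallyIntegrableOn_mul_sum_Icc b (a := 0) (m := 1) le_rfl (g := fun _ => (1 : ℂ))
      ((locallyIntegrable_const (1 : ℂ)).locallyIntegrableOn _)
    simp only [one_mul] at this
    exact this.mono_set Ioi_subset_Ici_self
  have Stop : S =O[atTop] fun t : ℝ => t ^ (-(-r)) := by
    refine (hO.comp_tendsto tendsto_nat_floor_atTop).trans (Asymptotics.IsBigO.of_bound 1 ?_)
    filter_upwards [eventually_ge_atTop 0] with t ht
    simp only [Function.comp_apply, neg_neg, one_mul]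
    rw [Real.norm_of_nonneg (by positivity), Real.norm_of_nonneg (by positivity)]
    exact Real.rpow_le_rpow (Nat.cast_nonneg _) (Nat.floor_le ht) hr
  refine ⟨fun s => s * mellin S (-s), fun s hs => ?_, fun s hs hsum => ?_⟩
  · have hs : r < s.re := hs
    have hd : DifferentiableAt ℂ (mellin S) (-s) := by
      refine mellin_differentiableAt_of_isBigO_rpow (a := -r) (b := -s.re - 1) Sloc Stop
        (by simpa using hs) ?_ (by simp)
      refine Asymptotics.IsBigO.of_bound 1 ?_
      filter_upwards [nhdsWithin_le_nhds (Iio_mem_nhds (zero_lt_one (α := ℝ)))] with t ht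
      rw [S0 t ht]
      simp
    exact (differentiableAt_id.mul (hd.comp s differentiableAt_id.neg)).differentiableWithinAt
  · simp only
    rw [LSeries_eq_mul_integral b hr hs hsum hO, mellin]
    congr 1
    rw [← integral_Ici_eq_integral_Ioi (x := (1 : ℝ))]
    rw [setIntegral_eq_of_subset_of_forall_sdiff_eq_zero measurableSet_Ioi
      (s := Ici (1 : ℝ)) (t := Ioi 0)]
    · refine setIntegral_congr_fun measurableSet_Ici fun t _ => ?_
      simp only [smul_eq_mul, hS]
      rw [mul_comm, neg_add']
    · intro t ht
      exact zero_lt_one.trans_le (mem_Ici.1 ht)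
    · intro t ht
      rw [S0 t (not_le.1 ht.2), smul_zero]

/-- The twist of `formCoeff` by a Dirichlet character. -/
noncomputable def twistedCoeff (χ : DirichletCharacter ℂ 23) (n : ℕ) : ℂ := formCoeff n * χ n

lemma natSqrt_le_rpow (N : ℕ) : (Nat.sqrt (2 * N) : ℝ) ≤ 2 * (N : ℝ) ^ (1 / 2 : ℝ) := by
  rw [← Real.sqrt_eq_rpow]
  calc (Nat.sqrt (2 * N) : ℝ) ≤ √((2 * N : ℕ) : ℝ) := Real.nat_sqrt_le_real_sqrt
    _ ≤ √(2 ^ 2 * N) := Real.sqrt_le_sqrt (by push_cast; nlinarith [(Nat.cast_nonneg N : (0:ℝ) ≤ N)])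
    _ = 2 * √N := by rw [Real.sqrt_mul (by norm_num), Real.sqrt_sq (by norm_num)]

lemma isBigO_sum_twistedCoeff (χ : DirichletCharacter ℂ 23) :
    (fun n => ∑ k ∈ Finset.Icc 1 n, twistedCoeff χ k) =O[atTop]
      fun n => (n : ℝ) ^ (1 / 2 : ℝ) := by
  refine Asymptotics.IsBigO.of_bound 115 ?_
  filter_upwards [eventually_ge_atTop 1] with N hN
  refine (norm_sum_formCoeff_mul_le χ N).trans ?_
  have h1 : (1 : ℝ) ≤ (N : ℝ) ^ (1 / 2 : ℝ) := Real.one_le_rpow (by exact_mod_cast hN) (by norm_num)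
  rw [Real.norm_of_nonneg (by positivity)]
  linarith [natSqrt_le_rpow N]

lemma isBigO_sum_norm_twistedCoeff (χ : DirichletCharacter ℂ 23) :
    (fun n => ∑ k ∈ Finset.Icc 1 n, ‖twistedCoeff χ k‖) =O[atTop] fun n => (n : ℝ) ^ (1 : ℝ) := by
  refine Asymptotics.IsBigO.of_bound 25 ?_
  filter_upwards [eventually_ge_atTop 1] with N hN
  rw [Real.norm_of_nonneg (by positivity), Real.norm_of_nonneg (by positivity)]
  have h1 : (1 : ℝ) ≤ (N : ℝ) ^ (1 / 2 : ℝ) := Real.one_le_rpow (by exact_mod_cast hN) (by norm_num)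
  have h2 : (N : ℝ) ^ (1 : ℝ) = ((N : ℝ) ^ (1 / 2 : ℝ)) ^ 2 := by
    rw [← Real.rpow_natCast, ← Real.rpow_mul (Nat.cast_nonneg N)]; norm_num
  have h3 : ∑ k ∈ Finset.Icc 1 N, ‖twistedCoeff χ k‖ ≤ ∑ k ∈ Finset.Icc 1 N, |formCoeff k| := by
    refine Finset.sum_le_sum fun k _ => ?_
    rw [twistedCoeff, norm_mul, Complex.norm_real, Real.norm_eq_abs]
    exact mul_le_of_le_one_right (abs_nonneg _) (χ.norm_le_one _)
  refine (h3.trans (sum_abs_formCoeff_le N)).trans ?_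
  rw [h2]
  calc _ ≤ (5 * (N : ℝ) ^ (1 / 2 : ℝ)) ^ 2 := by
        gcongr
        linarith [natSqrt_le_rpow N]
    _ = _ := by ring

lemma LSeriesSummable_twistedCoeff (χ : DirichletCharacter ℂ 23) {s : ℂ} (hs : 1 < s.re) :
    LSeriesSummable (twistedCoeff χ) s :=
  LSeriesSummable_of_sum_norm_bigO (isBigO_sum_norm_twistedCoeff χ) zero_le_one hs

open scoped ArithmeticFunction.vonMangoldt LSeries.notation

/-- The power sums `α ^ k + β ^ k` of the roots of `X ^ 2 - c X + e`. -/
def powerSum (c e : ℝ) : ℕ → ℝ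
  | 0 => 2
  | 1 => c
  | (k + 2) => c * powerSum c e (k + 1) - e * powerSum c e k

lemma powerSum_mul {c e : ℝ} {h : ℕ → ℝ} (h1 : h 1 = c * h 0)
    (h2 : ∀ k, h (k + 2) = c * h (k + 1) - e * h k) (k : ℕ) :
    powerSum c e (k + 2) * h 0 = c * h (k + 1) - 2 * e * h k := by
  induction k using Nat.twoStepInduction with
  | zero => simp only [powerSum, h1]; ring
  | one => simp only [powerSum]; rw [h2 0]; simp only [zero_add]; rw [h1]; ring
  | more k ih1 ih2 =>
    rw [powerSum, sub_mul, mul_assoc, mul_assoc, ih1, ih2]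
    rw [show k + 2 + 1 = k + 1 + 2 by ring, h2 (k + 1), h2 k]
    ring

lemma sum_powerSum_mul {c e : ℝ} {h : ℕ → ℝ} (h1 : h 1 = c * h 0)
    (h2 : ∀ k, h (k + 2) = c * h (k + 1) - e * h k) (v : ℕ) :
    ∑ i ∈ Finset.range v, powerSum c e (i + 1) * h (v - (i + 1)) = v * h v := by
  induction v using Nat.twoStepInduction with
  | zero => simp
  | one => simp [powerSum, h1]
  | more v ih1 ih2 =>
    have e1 : ∑ i ∈ Finset.range v, powerSum c e (i + 1) * h (v + 2 - (i + 1)) =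
        c * ∑ i ∈ Finset.range v, powerSum c e (i + 1) * h (v + 1 - (i + 1)) -
          e * ∑ i ∈ Finset.range v, powerSum c e (i + 1) * h (v - (i + 1)) := by
      rw [Finset.mul_sum, Finset.mul_sum, ← Finset.sum_sub_distrib]
      refine Finset.sum_congr rfl fun i hi => ?_
      rw [Finset.mem_range] at hi
      obtain ⟨w, rfl⟩ := Nat.exists_eq_add_of_le (Nat.succ_le_of_lt hi)
      rw [show i.succ + w + 2 - (i + 1) = w + 2 by lia, show i.succ + w + 1 - (i + 1) = w + 1 by lia,
        show i.succ + w - (i + 1) = w by lia, h2]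
      ring
    have e2 := powerSum_mul h1 h2 v
    rw [Finset.sum_range_succ] at ih2
    rw [Finset.sum_range_succ, Finset.sum_range_succ, e1, ih1, show v + 2 - (v + 1) = 1 by lia,
      show v + 2 - (v + 1 + 1) = 0 by lia, h1]
    rw [show v + 1 - (v + 1) = 0 by lia] at ih2
    push_cast at ih2 ⊢
    rw [h2 v]
    linear_combination c * ih2 + e2

lemma formCoeff_prime_mul_of_not_dvd {p : ℕ} (hp : p.Prime) (hp23 : p ≠ 23) {m : ℕ} (hm : ¬ p ∣ m) :
    formCoeff (p * m) = formCoeff p * formCoeff m := by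
  rw [formCoeff_prime_mul hp hp23, formCoeffDiv, if_neg hm]
  ring

lemma formCoeff_prime_pow_mul {p : ℕ} (hp : p.Prime) (hp23 : p ≠ 23) (m k : ℕ) :
    formCoeff (p ^ (k + 2) * m) =
      formCoeff p * formCoeff (p ^ (k + 1) * m) - legendreSym 23 p * formCoeff (p ^ k * m) := by
  rw [show p ^ (k + 2) * m = p * (p ^ (k + 1) * m) by ring, formCoeff_prime_mul hp hp23,
    formCoeffDiv, show p ^ (k + 1) * m = p * (p ^ k * m) by ring, if_pos (Dvd.intro _ rfl),
    Nat.mul_div_cancel_left _ hp.pos]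

lemma formCoeff_prime_pow_mul_of_not_dvd {p : ℕ} (hp : p.Prime) (hp23 : p ≠ 23) {m : ℕ}
    (hm : ¬ p ∣ m) (k : ℕ) : formCoeff (p ^ k * m) = formCoeff (p ^ k) * formCoeff m := by
  induction k using Nat.twoStepInduction with
  | zero => simp [formCoeff_one]
  | one => simpa using formCoeff_prime_mul_of_not_dvd hp hp23 hm
  | more k ih1 ih2 =>
    have := formCoeff_prime_pow_mul hp hp23 1 k
    simp only [mul_one] at this
    rw [formCoeff_prime_pow_mul hp hp23, this, ih1, ih2]
    ring

lemma formCoeff_mul_of_coprime {m n : ℕ} (h : m.Coprime n) (hm : ¬ 23 ∣ m) :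
    formCoeff (m * n) = formCoeff m * formCoeff n := by
  induction m using Nat.recOnPrimeCoprime generalizing n with
  | zero => simp at hm
  | prime_pow p k hp =>
    rcases Nat.eq_zero_or_pos k with rfl | hk
    · simp [formCoeff_one]
    · refine formCoeff_prime_pow_mul_of_not_dvd hp ?_ ?_ k
      · rintro rfl
        exact hm (dvd_pow_self _ hk.ne')
      · exact (Nat.Prime.coprime_iff_not_dvd hp).1 (Nat.Coprime.coprime_dvd_left
          (dvd_pow_self _ hk.ne') h)
  | coprime a b ha hb hab iha ihb =>
    rw [mul_assoc, iha (hab.mul_right (Nat.Coprime.coprime_mul_right h))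
      (fun h => hm (h.mul_right _)), ihb (Nat.Coprime.coprime_mul_left h)
      (fun h => hm (h.mul_left _)), iha hab (fun h => hm (h.mul_right _)), mul_assoc]

/-- The multiplier of `Λ n` in the logarithmic derivative of the Dirichlet series of `formCoeff`:
at a prime power `p ^ k`, the sum of the `k`-th powers of the Frobenius eigenvalues. -/
noncomputable def frobTrace (n : ℕ) : ℝ :=
  if 23 ∣ n then 0
  else powerSum (formCoeff n.minFac) (legendreSym 23 n.minFac) (n.factorization n.minFac)

lemma frobTrace_prime_pow {p : ℕ} (hp : p.Prime) (hp23 : p ≠ 23) {k : ℕ} (hk : k ≠ 0) :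
    frobTrace (p ^ k) = powerSum (formCoeff p) (legendreSym 23 p) k := by
  have h : ¬ 23 ∣ p ^ k := fun h => hp23 (((Nat.prime_dvd_prime_iff_eq (by norm_num) hp).1
    (Nat.Prime.dvd_of_dvd_pow (by norm_num) h)).symm)
  rw [frobTrace, if_neg h, hp.pow_minFac hk, hp.factorization_pow, Finsupp.single_eq_same]

lemma powerSum_values {c e : ℝ} (h : (e = 1 ∧ c = 2) ∨ (e = 1 ∧ c = -1) ∨ (e = -1 ∧ c = 0)) (k : ℕ) :
    (e ^ k = 1 ∧ (powerSum c e k = 2 ∨ powerSum c e k = -1)) ∨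
      (e ^ k = -1 ∧ powerSum c e k = 0) := by
  rcases h with ⟨rfl, rfl⟩ | ⟨rfl, rfl⟩ | ⟨rfl, rfl⟩
  · left
    refine ⟨one_pow _, Or.inl ?_⟩
    induction k using Nat.twoStepInduction with
    | zero => rfl
    | one => rfl
    | more k h1 h2 => rw [powerSum, h1, h2]; norm_num
  · left
    refine ⟨one_pow _, ?_⟩
    have : (powerSum (-1) 1 k = 2 ∧ powerSum (-1) 1 (k + 1) = -1) ∨
        (powerSum (-1) 1 k = -1 ∧ powerSum (-1) 1 (k + 1) = -1) ∨
        (powerSum (-1) 1 k = -1 ∧ powerSum (-1) 1 (k + 1) = 2) := by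
      induction k with
      | zero => norm_num [powerSum]
      | succ k ih =>
        rw [powerSum]
        rcases ih with ⟨h, h'⟩ | ⟨h, h'⟩ | ⟨h, h'⟩ <;> norm_num [h, h']
    rcases this with ⟨h, -⟩ | ⟨h, -⟩ | ⟨h, -⟩ <;> simp [h]
  · have : ((-1 : ℝ) ^ k = 1 ∧ powerSum 0 (-1) k = 2 ∧ powerSum 0 (-1) (k + 1) = 0) ∨
        ((-1 : ℝ) ^ k = -1 ∧ powerSum 0 (-1) k = 0 ∧ powerSum 0 (-1) (k + 1) = 2) := by
      induction k with
      | zero => norm_num [powerSum]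
      | succ k ih =>
        rw [powerSum, pow_succ]
        rcases ih with ⟨h, h', h''⟩ | ⟨h, h', h''⟩ <;> norm_num [h, h', h'']
    rcases this with ⟨h, h', -⟩ | ⟨h, h', -⟩ <;> simp [h, h']

lemma frobTrace_values {n : ℕ} (hn : IsPrimePow n) (h23 : ¬ 23 ∣ n) :
    (legendreSym 23 n = 1 ∧ (frobTrace n = 2 ∨ frobTrace n = -1)) ∨
      (legendreSym 23 n = -1 ∧ frobTrace n = 0) := by
  obtain ⟨p, k, hp, hk, rfl⟩ := hn
  have hp : p.Prime := hp.nat_prime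
  have hp23 : p ≠ 23 := by
    rintro rfl
    exact h23 (dvd_pow_self _ hk.ne')
  rw [frobTrace_prime_pow hp hp23 hk.ne']
  have hl : legendreSym 23 (p ^ k : ℕ) = legendreSym 23 p ^ k := by
    push_cast
    exact map_pow (legendreSym.hom 23) _ _
  rw [hl]
  have := powerSum_values (c := formCoeff p) (e := legendreSym 23 p) (by
    rcases formCoeff_prime hp hp23 with ⟨h, -, h'⟩ | ⟨h, -, h'⟩ | ⟨h, -, h'⟩ <;> simp [h, h']
    ) k
  exact_mod_cast this

lemma frobTrace_prime {p : ℕ} (hp : p.Prime) (hp23 : p ≠ 23) : frobTrace p = formCoeff p := by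
  simpa [powerSum] using frobTrace_prime_pow hp hp23 one_ne_zero

lemma vonMangoldt_mul_abs_frobTrace_le (n : ℕ) : |Λ n * frobTrace n| ≤ 2 * Λ n := by
  rw [abs_mul, abs_of_nonneg ArithmeticFunction.vonMangoldt_nonneg, mul_comm]
  by_cases hn : IsPrimePow n
  · refine mul_le_mul_of_nonneg_right ?_ ArithmeticFunction.vonMangoldt_nonneg
    by_cases h : 23 ∣ n
    · simp [frobTrace, h]
    · rcases frobTrace_values hn h with ⟨-, h | h⟩ | ⟨-, h⟩ <;> norm_num [h]
  · have : Λ n = 0 := by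
      by_contra h
      exact hn (ArithmeticFunction.vonMangoldt_ne_zero_iff.1 h)
    simp [this]

/-- The logarithmic derivative of the Euler product of `formCoeff`, at the level of coefficients. -/
lemma sum_vonMangoldt_mul_frobTrace {n : ℕ} (hn : ¬ 23 ∣ n) :
    ∑ d ∈ n.divisors, Λ d * frobTrace d * formCoeff (n / d) = formCoeff n * Real.log n := by
  have hfilter : ∀ n m : ℕ, ∑ d ∈ n.divisors, Λ d * frobTrace d * formCoeff (m / d) =
      ∑ d ∈ n.divisors with IsPrimePow d, Λ d * frobTrace d * formCoeff (m / d) := by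
    intro n m
    rw [Finset.sum_filter_of_ne]
    intro d _ h
    exact ArithmeticFunction.vonMangoldt_ne_zero_iff.1 (left_ne_zero_of_mul (left_ne_zero_of_mul h))
  induction n using Nat.recOnPrimeCoprime with
  | zero => simp
  | prime_pow p k hp =>
    rcases Nat.eq_zero_or_pos k with rfl | hk
    · simp
    have hp23 : p ≠ 23 := by
      rintro rfl
      exact hn (dvd_pow_self _ hk.ne')
    rw [Nat.sum_divisors_prime_pow hp, Finset.sum_range_succ', pow_zero,
      ArithmeticFunction.vonMangoldt_apply_one, zero_mul, zero_mul, add_zero]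
    have h2 := formCoeff_prime_pow_mul hp hp23 1
    simp only [mul_one] at h2
    have key := sum_powerSum_mul (c := formCoeff p) (e := legendreSym 23 p)
      (h := fun k => formCoeff (p ^ k)) (by simp [formCoeff_one]) h2 k
    have e : ∀ i ∈ Finset.range k, Λ (p ^ (i + 1)) * frobTrace (p ^ (i + 1)) *
        formCoeff (p ^ k / p ^ (i + 1)) = Real.log p *
        (powerSum (formCoeff p) (legendreSym 23 p) (i + 1) * formCoeff (p ^ (k - (i + 1)))) := by
      intro i hi
      rw [Finset.mem_range] at hi
      rw [ArithmeticFunction.vonMangoldt_apply_pow (Nat.succ_ne_zero _),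
        ArithmeticFunction.vonMangoldt_apply_prime hp,
        frobTrace_prime_pow hp hp23 (Nat.succ_ne_zero _), Nat.pow_div hi hp.pos]
      ring
    rw [Finset.sum_congr rfl e, ← Finset.mul_sum, key]
    push_cast
    rw [Real.log_pow]
    ring
  | coprime a b ha hb hab iha ihb =>
    have ha23 : ¬ 23 ∣ a := fun h => hn (h.mul_right _)
    have hb23 : ¬ 23 ∣ b := fun h => hn (h.mul_left _)
    have iha := iha ha23
    have ihb := ihb hb23
    rw [hfilter, Nat.mul_divisors_filter_prime_pow hab, Finset.filter_union,
      Finset.sum_union (Nat.disjoint_divisors_filter_isPrimePow hab), ← hfilter, ← hfilter]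
    have e1 : ∑ d ∈ a.divisors, Λ d * frobTrace d * formCoeff (a * b / d) =
        formCoeff a * Real.log a * formCoeff b := by
      rw [← iha, Finset.sum_mul]
      refine Finset.sum_congr rfl fun d hd => ?_
      obtain ⟨c, rfl⟩ := Nat.dvd_of_mem_divisors hd
      have hd0 : 0 < d := Nat.pos_of_mem_divisors hd
      rw [mul_assoc d, Nat.mul_div_cancel_left _ hd0, Nat.mul_div_cancel_left _ hd0,
        formCoeff_mul_of_coprime (Nat.Coprime.coprime_mul_left hab)
        (fun h => ha23 (h.mul_left _))]
      ring
    have e2 : ∑ d ∈ b.divisors, Λ d * frobTrace d * formCoeff (a * b / d) =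
        formCoeff b * Real.log b * formCoeff a := by
      rw [← ihb, Finset.sum_mul]
      refine Finset.sum_congr rfl fun d hd => ?_
      obtain ⟨c, rfl⟩ := Nat.dvd_of_mem_divisors hd
      have hd0 : 0 < d := Nat.pos_of_mem_divisors hd
      rw [mul_left_comm, Nat.mul_div_cancel_left _ hd0, Nat.mul_div_cancel_left _ hd0,
        formCoeff_mul_of_coprime (Nat.Coprime.coprime_mul_left_right hab) ha23]
      ring
    rw [e1, e2, formCoeff_mul_of_coprime hab ha23, Nat.cast_mul, Real.log_mul
      (by exact_mod_cast (pos_of_gt ha).ne') (by exact_mod_cast (pos_of_gt hb).ne')]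
    ring

/-- The coefficients of minus the logarithmic derivative of the twisted series. -/
noncomputable def twistedLogCoeff (χ : DirichletCharacter ℂ 23) (n : ℕ) : ℂ :=
  ((Λ n * frobTrace n : ℝ) : ℂ) * χ n

lemma LSeriesSummable_twistedLogCoeff (χ : DirichletCharacter ℂ 23) {s : ℂ} (hs : 1 < s.re) :
    LSeriesSummable (twistedLogCoeff χ) s := by
  have h := (ArithmeticFunction.LSeriesSummable_vonMangoldt hs).smul (2 : ℂ)
  refine h.norm.of_norm_bounded fun n => LSeries.norm_term_le s ?_
  rw [twistedLogCoeff, norm_mul, Complex.norm_real]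
  refine (mul_le_of_le_one_right (norm_nonneg _) (χ.norm_le_one _)).trans ?_
  rw [Real.norm_eq_abs, Pi.smul_apply, smul_eq_mul, norm_mul, Complex.norm_real,
    Real.norm_of_nonneg ArithmeticFunction.vonMangoldt_nonneg]
  simpa using vonMangoldt_mul_abs_frobTrace_le n

lemma twistedCoeff_convolution (χ : DirichletCharacter ℂ 23) :
    twistedCoeff χ ⍟ twistedLogCoeff χ = LSeries.logMul (twistedCoeff χ) := by
  ext n
  rw [LSeries.convolution_def, LSeries.logMul]
  simp only
  rw [Nat.sum_divisorsAntidiagonal' (f := fun i j => twistedCoeff χ i * twistedLogCoeff χ j)]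
  by_cases h : 23 ∣ n
  · have h0 : χ n = 0 := by
      rw [(ZMod.natCast_eq_zero_iff n 23).2 h]
      exact χ.map_zero
    rw [twistedCoeff, h0, mul_zero, mul_zero]
    refine Finset.sum_eq_zero fun d hd => ?_
    rw [twistedCoeff, twistedLogCoeff, mul_mul_mul_comm, ← map_mul, ← Nat.cast_mul,
      Nat.div_mul_cancel (Nat.dvd_of_mem_divisors hd), h0, mul_zero]
  · have key := congrArg (fun x : ℝ => (x : ℂ)) (sum_vonMangoldt_mul_frobTrace h)
    simp only [Complex.ofReal_sum, Complex.ofReal_mul] at key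
    rw [twistedCoeff, ← Complex.natCast_log, ← mul_assoc, mul_comm (Complex.ofReal _) (formCoeff n : ℂ), ← key, Finset.sum_mul]
    refine Finset.sum_congr rfl fun d hd => ?_
    rw [twistedCoeff, twistedLogCoeff, mul_mul_mul_comm, ← map_mul, ← Nat.cast_mul,
      Nat.div_mul_cancel (Nat.dvd_of_mem_divisors hd)]
    push_cast
    ring

lemma deriv_LSeries_twistedCoeff (χ : DirichletCharacter ℂ 23) {s : ℂ} (hs : 1 < s.re) :
    deriv (LSeries (twistedCoeff χ)) s =
      -(LSeries (twistedCoeff χ) s * LSeries (twistedLogCoeff χ) s) := by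
  have : LSeries.abscissaOfAbsConv (twistedCoeff χ) < s.re := by
    refine lt_of_le_of_lt (LSeries.abscissaOfAbsConv_le_of_forall_lt_LSeriesSummable (x := 1)
      fun y hy => LSeriesSummable_twistedCoeff χ (by simpa using hy)) (by exact_mod_cast hs)
  rw [LSeries_deriv this, ← twistedCoeff_convolution, LSeries_convolution'
    (LSeriesSummable_twistedCoeff χ hs) (LSeriesSummable_twistedLogCoeff χ hs)]

lemma exists_tendsto_sub_mul_logDeriv {f : ℂ → ℂ} {z₀ : ℂ} (hf : AnalyticAt ℂ f z₀)
    (hne : ¬ ∀ᶠ z in 𝓝 z₀, f z = 0) :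
    ∃ m : ℕ, (f z₀ = 0 → m ≠ 0) ∧
      Tendsto (fun z => (z - z₀) * (deriv f z / f z)) (𝓝[≠] z₀) (𝓝 m) := by
  obtain ⟨m, g, hg, hg0, hfg⟩ := hf.exists_eventuallyEq_pow_smul_nonzero_iff.2 hne
  refine ⟨m, ?_, ?_⟩
  · rintro h rfl
    have := hfg.self_of_nhds
    simp [h] at this
    exact hg0 this.symm
  have h1 : Tendsto (fun z => (m : ℂ) + (z - z₀) * (deriv g z / g z)) (𝓝[≠] z₀) (𝓝 m) := by
    have : ContinuousAt (fun z => (m : ℂ) + (z - z₀) * (deriv g z / g z)) z₀ :=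
      continuousAt_const.add ((continuousAt_id.sub continuousAt_const).mul
        (hg.deriv.continuousAt.div hg.continuousAt hg0))
    have h := this.tendsto
    simp only [sub_self, zero_mul, add_zero] at h
    exact h.mono_left nhdsWithin_le_nhds
  refine h1.congr' ?_
  filter_upwards [nhdsWithin_le_nhds hfg.eventually_nhds,
    nhdsWithin_le_nhds hg.eventually_analyticAt,
    nhdsWithin_le_nhds (hg.continuousAt.eventually_ne hg0), self_mem_nhdsWithin] with z hz hga hz0 hzz
  have hzz : z - z₀ ≠ 0 := sub_ne_zero.2 hzz
  have hd : HasDerivAt (fun z => (z - z₀) ^ m • g z)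
      ((m * (z - z₀) ^ (m - 1) * 1) * g z + (z - z₀) ^ m * deriv g z) z :=
    (((hasDerivAt_id z).sub_const z₀).pow m).mul hga.differentiableAt.hasDerivAt
  rw [EventuallyEq.deriv_eq hz, hd.deriv, hz.self_of_nhds]
  rcases m with _ | m
  · simp
  · simp only [smul_eq_mul, Nat.add_sub_cancel, pow_succ]
    field_simp

/-- The analytic continuation to `1 / 2 < re s` of the twisted series of `formCoeff`. -/
noncomputable def twistedLFunction (χ : DirichletCharacter ℂ 23) : ℂ → ℂ :=
  Classical.choose (exists_analytic_continuation_LSeries (by norm_num) (isBigO_sum_twistedCoeff χ))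

lemma analyticOnNhd_twistedLFunction (χ : DirichletCharacter ℂ 23) :
    AnalyticOnNhd ℂ (twistedLFunction χ) {s | 1 / 2 < s.re} :=
  (Classical.choose_spec (exists_analytic_continuation_LSeries (by norm_num)
    (isBigO_sum_twistedCoeff χ))).1.analyticOnNhd (isOpen_lt continuous_const Complex.continuous_re)

lemma twistedLFunction_eq (χ : DirichletCharacter ℂ 23) {s : ℂ} (hs : 1 < s.re) :
    twistedLFunction χ s = LSeries (twistedCoeff χ) s :=
  (Classical.choose_spec (exists_analytic_continuation_LSeries (by norm_num)
    (isBigO_sum_twistedCoeff χ))).2 s (by linarith) (LSeriesSummable_twistedCoeff χ hs)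

lemma deriv_twistedLFunction (χ : DirichletCharacter ℂ 23) {s : ℂ} (hs : 1 < s.re) :
    deriv (twistedLFunction χ) s = -(twistedLFunction χ s * LSeries (twistedLogCoeff χ) s) := by
  rw [twistedLFunction_eq χ hs, ← deriv_LSeries_twistedCoeff χ hs]
  refine EventuallyEq.deriv_eq ?_
  filter_upwards [(isOpen_lt continuous_const Complex.continuous_re).mem_nhds hs] with z hz
  exact twistedLFunction_eq χ hz

lemma abscissaOfAbsConv_twistedCoeff_le (χ : DirichletCharacter ℂ 23) :
    LSeries.abscissaOfAbsConv (twistedCoeff χ) ≤ 1 :=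
  LSeries.abscissaOfAbsConv_le_of_forall_lt_LSeriesSummable (x := 1)
    fun y hy => LSeriesSummable_twistedCoeff χ (by simpa using hy)

lemma abscissaOfAbsConv_twistedLogCoeff_le (χ : DirichletCharacter ℂ 23) :
    LSeries.abscissaOfAbsConv (twistedLogCoeff χ) ≤ 1 :=
  LSeries.abscissaOfAbsConv_le_of_forall_lt_LSeriesSummable (x := 1)
    fun y hy => LSeriesSummable_twistedLogCoeff χ (by simpa using hy)

lemma not_eventually_twistedLFunction_eq_zero (χ : DirichletCharacter ℂ 23) {s : ℂ}
    (hs : 1 / 2 < s.re) : ¬ ∀ᶠ z in 𝓝 s, twistedLFunction χ z = 0 := by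
  intro h
  have h0 := (analyticOnNhd_twistedLFunction χ).eqOn_zero_of_preconnected_of_eventuallyEq_zero
    (convex_halfSpace_re_gt _).isPreconnected hs h
  rcases (LSeries_eventually_eq_zero_iff' (f := twistedCoeff χ)).1 (by
    filter_upwards [eventually_gt_atTop 1] with x hx
    have h2 : 1 < (x : ℂ).re := by simpa using hx
    rw [← twistedLFunction_eq χ h2]
    exact h0 (show 1 / 2 < (x : ℂ).re by linarith)) with h | h
  · have := h 1 one_ne_zero
    simp [twistedCoeff, formCoeff_one] at this
  · have := abscissaOfAbsConv_twistedCoeff_le χ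
    rw [h, top_le_iff] at this
    exact EReal.coe_ne_top 1 this

/-- The order of vanishing on the line `re s = 1` seen through the logarithmic derivative. -/
lemma exists_tendsto_twistedLogCoeff (χ : DirichletCharacter ℂ 23) (t : ℝ) :
    ∃ m : ℕ, (twistedLFunction χ (1 + t * Complex.I) = 0 → m ≠ 0) ∧
      Tendsto (fun σ : ℝ => ((σ : ℂ) - 1) * LSeries (twistedLogCoeff χ) (σ + t * Complex.I))
        (𝓝[>] 1) (𝓝 (-m)) := by
  have hre : (1 / 2 : ℝ) < (1 + t * Complex.I : ℂ).re := by norm_num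
  have hne := not_eventually_twistedLFunction_eq_zero χ hre
  have han := analyticOnNhd_twistedLFunction χ _ hre
  obtain ⟨m, hm, h⟩ := exists_tendsto_sub_mul_logDeriv han hne
  refine ⟨m, hm, ?_⟩
  have hmap : Tendsto (fun σ : ℝ => (σ : ℂ) + t * Complex.I) (𝓝[>] 1)
      (𝓝[≠] (1 + t * Complex.I)) := by
    refine tendsto_nhdsWithin_iff.2 ⟨?_, ?_⟩
    · have : Continuous (fun σ : ℝ => (σ : ℂ) + t * Complex.I) := by fun_prop
      simpa using (this.tendsto 1).mono_left nhdsWithin_le_nhds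
    · filter_upwards [self_mem_nhdsWithin] with σ hσ
      simpa using (mem_Ioi.1 hσ).ne'
  have hnz := hmap.eventually
    ((han.eventually_eq_zero_or_eventually_ne_zero).resolve_left hne)
  refine ((h.comp hmap).neg).congr' ?_
  filter_upwards [hnz, self_mem_nhdsWithin] with σ hσ hσ1
  simp only [Function.comp_apply]
  rw [deriv_twistedLFunction χ (by simpa using hσ1)]
  field_simp
  ring

open ArithmeticFunction.vonMangoldt (residueClass)

lemma LSeriesSummable_residueClass {q : ℕ} (c : ZMod q) {s : ℂ} (hs : 1 < s.re) :
    LSeriesSummable ↗(residueClass c) s :=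
  LSeriesSummable_of_abscissaOfAbsConv_lt_re <|
    (ArithmeticFunction.vonMangoldt.abscissaOfAbsConv_residueClass_le_one c).trans_lt
      (by exact_mod_cast hs)

lemma exists_LSeries_sum_residueClass {q : ℕ} [NeZero q] (U : Finset (ZMod q))
    (hU : ∀ c ∈ U, IsUnit c) :
    ∃ g : ℂ → ℂ, ContinuousOn g {s | 1 ≤ s.re} ∧ ∀ s : ℂ, 1 < s.re →
      ∑ c ∈ U, LSeries ↗(residueClass c) s = (U.card / q.totient : ℂ) / (s - 1) + g s := by
  refine ⟨fun s => ∑ c ∈ U, ArithmeticFunction.vonMangoldt.LFunctionResidueClassAux c s,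
    continuousOn_finsetSum _ fun c _ =>
      ArithmeticFunction.vonMangoldt.continuousOn_LFunctionResidueClassAux c, fun s hs => ?_⟩
  simp only
  rw [Finset.sum_congr rfl fun c hc =>
    ArithmeticFunction.vonMangoldt.eqOn_LFunctionResidueClassAux (hU c hc) (mem_ofPred.2 hs)]
  simp only [Finset.sum_sub_distrib, Finset.sum_const, nsmul_eq_mul]
  ring

/-- The nonzero squares modulo `23`. -/
def nonzeroSquares : Finset (ZMod 23) := Finset.univ.filter fun c => c ≠ 0 ∧ IsSquare c

lemma card_nonzeroSquares : nonzeroSquares.card = 11 := by decide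

lemma isUnit_of_mem_nonzeroSquares {c : ZMod 23} (hc : c ∈ nonzeroSquares) : IsUnit c :=
  (Finset.mem_filter.1 hc).2.1.isUnit

lemma natCast_mem_nonzeroSquares_iff (n : ℕ) :
    (n : ZMod 23) ∈ nonzeroSquares ↔ ¬ 23 ∣ n ∧ legendreSym 23 n = 1 := by
  rw [nonzeroSquares, Finset.mem_filter, ← ZMod.natCast_eq_zero_iff]
  simp only [Finset.mem_univ, true_and]
  refine and_congr_right fun h => ?_
  rw [legendreSym.eq_one_iff 23 (by simpa using h)]
  simp

lemma sum_residueClass (U : Finset (ZMod 23)) (n : ℕ) :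
    ∑ c ∈ U, residueClass c n = if (n : ZMod 23) ∈ U then Λ n else 0 := by
  simp only [residueClass, indicator_apply, mem_ofPred_eq]
  rw [Finset.sum_ite_eq]

lemma three_four_one (z : ℂ) (hz : ‖z‖ = 1) {τ : ℝ} (hτ : τ = 2 ∨ τ = -1) :
    0 ≤ 6 + 4 * τ * z.re + τ * (z ^ 2).re := by
  have h : z.re ^ 2 + z.im ^ 2 = 1 := by
    have := Complex.sq_norm z
    rw [hz, Complex.normSq_apply] at this
    linarith
  have h2 : (z ^ 2).re = z.re ^ 2 - z.im ^ 2 := by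
    rw [sq, Complex.mul_re]; ring
  rw [h2]
  rcases hτ with rfl | rfl
  · nlinarith [sq_nonneg (z.re + 1)]
  · nlinarith [sq_nonneg (z.re - 1), sq_nonneg (z.im)]

lemma vonMangoldt_three_four_one (χ : DirichletCharacter ℂ 23) (t σ : ℝ) (n : ℕ) :
    0 ≤ (6 * ∑ c ∈ nonzeroSquares, LSeries.term ↗(residueClass c) σ n +
      4 * LSeries.term (twistedLogCoeff χ) (σ + t * Complex.I) n +
      LSeries.term (twistedLogCoeff (χ ^ 2)) (σ + (2 * t : ℝ) * Complex.I) n).re := by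
  rcases Nat.eq_zero_or_pos n with rfl | hn
  · simp
  have hn0 : (n : ℂ) ≠ 0 := by exact_mod_cast hn.ne'
  have hsum : ∑ c ∈ nonzeroSquares, LSeries.term ↗(residueClass c) σ n =
      ((if (n : ZMod 23) ∈ nonzeroSquares then Λ n else 0 : ℝ) : ℂ) / (n : ℂ) ^ (σ : ℂ) := by
    rw [← sum_residueClass, Complex.ofReal_sum, Finset.sum_div]
    exact Finset.sum_congr rfl fun c _ => LSeries.term_of_ne_zero hn.ne' _ _
  set u : ℂ := (n : ℂ) ^ (t * Complex.I) with hu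
  have hun : ‖u‖ = 1 := by
    rw [hu, Complex.norm_natCast_cpow_of_pos hn]
    simp
  have hu2 : (n : ℂ) ^ ((2 * t : ℝ) * Complex.I) = u ^ 2 := by
    rw [hu, ← Complex.cpow_nat_mul]
    congr 1
    push_cast
    ring
  set z : ℂ := χ n * u⁻¹ with hz
  have e : 6 * ∑ c ∈ nonzeroSquares, LSeries.term ↗(residueClass c) σ n +
      4 * LSeries.term (twistedLogCoeff χ) (σ + t * Complex.I) n +
      LSeries.term (twistedLogCoeff (χ ^ 2)) (σ + (2 * t : ℝ) * Complex.I) n =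
      (((n : ℝ) ^ σ)⁻¹ * (6 * if (n : ZMod 23) ∈ nonzeroSquares then Λ n else 0) : ℝ) +
      (((n : ℝ) ^ σ)⁻¹ * Λ n * frobTrace n : ℝ) * (4 * z + z ^ 2) := by
    rw [hsum, LSeries.term_of_ne_zero hn.ne', LSeries.term_of_ne_zero hn.ne',
      Complex.cpow_add _ _ hn0, Complex.cpow_add _ _ hn0, ← hu, hu2, twistedLogCoeff,
      twistedLogCoeff, MulChar.pow_apply' _ two_ne_zero, hz]
    simp only [Complex.ofReal_mul, Complex.ofReal_inv, Complex.ofReal_cpow (Nat.cast_nonneg n),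
      Complex.ofReal_natCast, Complex.ofReal_ofNat]
    ring
  rw [e, Complex.add_re, Complex.ofReal_re, Complex.re_ofReal_mul]
  have hpos : 0 ≤ ((n : ℝ) ^ σ)⁻¹ := by positivity
  by_cases hpp : IsPrimePow n
  swap
  · have : Λ n = 0 := by
      by_contra h
      exact hpp (ArithmeticFunction.vonMangoldt_ne_zero_iff.1 h)
    simp [this]
  by_cases h23 : 23 ∣ n
  · have : frobTrace n = 0 := if_pos h23
    rw [this]
    have : 0 ≤ (6 * if (n : ZMod 23) ∈ nonzeroSquares then Λ n else 0) := by
      split_ifs <;> simp [ArithmeticFunction.vonMangoldt_nonneg]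
    simpa using mul_nonneg hpos this
  · rcases frobTrace_values hpp h23 with ⟨h1, hτ⟩ | ⟨h1, hτ⟩
    · rw [if_pos ((natCast_mem_nonzeroSquares_iff n).2 ⟨h23, h1⟩)]
      have hzn : ‖z‖ = 1 := by
        have : IsUnit (n : ZMod 23) := by
          refine (Ne.isUnit ?_)
          rwa [Ne, ZMod.natCast_eq_zero_iff]
        rw [hz, norm_mul, norm_inv, hun, ← this.unit_spec, χ.unit_norm_eq_one]
        norm_num
      have := mul_nonneg (mul_nonneg hpos (ArithmeticFunction.vonMangoldt_nonneg (n := n)))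
        (three_four_one z hzn hτ)
      refine this.trans_eq ?_
      simp only [Complex.add_re, Complex.mul_re, Complex.re_ofNat, Complex.im_ofNat]
      ring
    · rw [hτ, if_neg (fun h => by
        have := ((natCast_mem_nonzeroSquares_iff n).1 h).2
        omega)]
      simp

lemma LSeries_three_four_one (χ : DirichletCharacter ℂ 23) (t : ℝ) {σ : ℝ} (hσ : 1 < σ) :
    0 ≤ (6 * ∑ c ∈ nonzeroSquares, LSeries ↗(residueClass c) σ +
      4 * LSeries (twistedLogCoeff χ) (σ + t * Complex.I) +
      LSeries (twistedLogCoeff (χ ^ 2)) (σ + (2 * t : ℝ) * Complex.I)).re := by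
  have h0 : HasSum (fun n => ∑ c ∈ nonzeroSquares, LSeries.term ↗(residueClass c) σ n)
      (∑ c ∈ nonzeroSquares, LSeries ↗(residueClass c) σ) :=
    hasSum_sum fun c _ => (LSeriesSummable_residueClass c (by simpa using hσ)).hasSum
  have h1 := (LSeriesSummable_twistedLogCoeff χ (s := σ + t * Complex.I) (by simpa using hσ)).hasSum
  have h2 := (LSeriesSummable_twistedLogCoeff (χ ^ 2) (s := σ + (2 * t : ℝ) * Complex.I)
    (by simpa using hσ)).hasSum
  exact (Complex.hasSum_re (((h0.mul_left 6).add (h1.mul_left 4)).add h2)).nonneg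
    (vonMangoldt_three_four_one χ t σ)

lemma twistedLFunction_ne_zero_of_re_eq_one (χ : DirichletCharacter ℂ 23) (t : ℝ) :
    twistedLFunction χ (1 + t * Complex.I) ≠ 0 := by
  intro h
  obtain ⟨m, hm, h1⟩ := exists_tendsto_twistedLogCoeff χ t
  obtain ⟨m', -, h2⟩ := exists_tendsto_twistedLogCoeff (χ ^ 2) (2 * t)
  obtain ⟨g, hg, h0⟩ := exists_LSeries_sum_residueClass nonzeroSquares
    fun c hc => isUnit_of_mem_nonzeroSquares hc
  have hmap : Tendsto (fun σ : ℝ => (σ : ℂ)) (𝓝[>] 1) (𝓝[{s | 1 ≤ s.re}] 1) := by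
    refine tendsto_nhdsWithin_iff.2 ⟨?_, ?_⟩
    · simpa using (Complex.continuous_ofReal.tendsto 1).mono_left nhdsWithin_le_nhds
    · filter_upwards [self_mem_nhdsWithin] with σ hσ
      simpa using (mem_Ioi.1 hσ).le
  have h0' : Tendsto (fun σ : ℝ => ((σ : ℂ) - 1) *
      ∑ c ∈ nonzeroSquares, LSeries ↗(residueClass c) σ) (𝓝[>] 1) (𝓝 (1 / 2)) := by
    have hs : Tendsto (fun s : ℂ => 1 / 2 + (s - 1) * g s) (𝓝[{s | 1 ≤ s.re}] 1)
        (𝓝 (1 / 2 + (1 - 1) * g 1)) :=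
      (continuousWithinAt_const.add ((continuousWithinAt_id.sub continuousWithinAt_const).mul
        (hg 1 (by simp)))).tendsto
    rw [sub_self, zero_mul, add_zero] at hs
    refine (hs.comp hmap).congr' ?_
    filter_upwards [self_mem_nhdsWithin] with σ hσ
    have hσ1 : (σ : ℂ) - 1 ≠ 0 := sub_ne_zero.2 (by exact_mod_cast (mem_Ioi.1 hσ).ne')
    rw [h0 σ (by simpa using hσ), card_nonzeroSquares, Nat.totient_prime (by norm_num),
      Function.comp_apply]
    push_cast
    field_simp
    ring
  have htot := (Complex.continuous_re.tendsto _).comp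
    (((h0'.const_mul 6).add (h1.const_mul 4)).add h2)
  have := ge_of_tendsto htot (b := 0) (by
    filter_upwards [self_mem_nhdsWithin] with σ hσ
    have hσ : 1 < σ := hσ
    have h3 := mul_nonneg (sub_pos.2 hσ).le (LSeries_three_four_one χ t hσ)
    rw [← Complex.re_ofReal_mul] at h3
    refine h3.trans_eq ?_
    simp only [Function.comp_apply]
    congr 1
    push_cast
    ring)
  simp only [Complex.add_re, Complex.mul_re, Complex.neg_re, Complex.natCast_re] at this
  norm_num at this
  have hm1 : (1 : ℝ) ≤ m := by exact_mod_cast Nat.one_le_iff_ne_zero.2 (hm h)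
  have hm2 : (0 : ℝ) ≤ m' := Nat.cast_nonneg _
  linarith

lemma twistedLFunction_ne_zero (χ : DirichletCharacter ℂ 23) {s : ℂ} (hs : 1 ≤ s.re) :
    twistedLFunction χ s ≠ 0 := by
  rcases hs.eq_or_lt with hs | hs
  · rw [← Complex.re_add_im s, ← hs]
    exact_mod_cast twistedLFunction_ne_zero_of_re_eq_one χ s.im
  intro h
  have hs2 : 1 / 2 < s.re := by linarith
  obtain ⟨m, hm, h1⟩ := exists_tendsto_sub_mul_logDeriv (analyticOnNhd_twistedLFunction χ s hs2)
    (not_eventually_twistedLFunction_eq_zero χ hs2)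
  have hnz := (analyticOnNhd_twistedLFunction χ s hs2).eventually_eq_zero_or_eventually_ne_zero.resolve_left
    (not_eventually_twistedLFunction_eq_zero χ hs2)
  have hc : ContinuousAt (LSeries (twistedLogCoeff χ)) s :=
    (LSeries_analyticOnNhd _ s ((abscissaOfAbsConv_twistedLogCoeff_le χ).trans_lt
      (by exact_mod_cast hs))).continuousAt
  have h2 : Tendsto (fun z => (z - s) * -LSeries (twistedLogCoeff χ) z) (𝓝[≠] s)
      (𝓝 ((s - s) * -LSeries (twistedLogCoeff χ) s)) :=
    (((continuousAt_id.sub continuousAt_const).mul hc.neg).tendsto).mono_left nhdsWithin_le_nhds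
  rw [sub_self, zero_mul] at h2
  have h3 := tendsto_nhds_unique (h1.congr' (by
    filter_upwards [hnz, nhdsWithin_le_nhds
      ((isOpen_lt continuous_const Complex.continuous_re).mem_nhds hs)] with z hz hz1
    rw [deriv_twistedLFunction χ hz1]
    field_simp)) h2
  exact hm h (by exact_mod_cast h3)

lemma exists_continuousOn_LSeries_twistedLogCoeff (χ : DirichletCharacter ℂ 23) :
    ∃ g : ℂ → ℂ, ContinuousOn g {s | 1 ≤ s.re} ∧
      ∀ s : ℂ, 1 < s.re → LSeries (twistedLogCoeff χ) s = g s := by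
  refine ⟨fun s => -(deriv (twistedLFunction χ) s / twistedLFunction χ s), ?_, fun s hs => ?_⟩
  · intro s hs
    have hs1 : 1 ≤ s.re := hs
    have := analyticOnNhd_twistedLFunction χ s (show 1 / 2 < s.re by linarith)
    exact (this.deriv.continuousAt.div this.continuousAt
      (twistedLFunction_ne_zero χ hs)).neg.continuousWithinAt
  · have := twistedLFunction_ne_zero χ hs.le
    simp only
    rw [deriv_twistedLFunction χ hs]
    field_simp

lemma sum_vonMangoldt_Icc (n : ℕ) : ∑ k ∈ Finset.Icc 1 n, Λ k = Chebyshev.psi n := by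
  rw [Chebyshev.psi, Nat.floor_natCast, ← Finset.Icc_add_one_left_eq_Ioc, zero_add]

lemma sum_log_prime_Icc (n : ℕ) :
    ∑ k ∈ Finset.Icc 1 n, (if k.Prime then Real.log k else 0) = Chebyshev.theta n := by
  rw [Chebyshev.theta, Nat.floor_natCast, ← Finset.Icc_add_one_left_eq_Ioc, zero_add,
    Finset.sum_filter]

lemma card_prime_Icc (n : ℕ) : ((Finset.Icc 1 n).filter Nat.Prime).card = n.primeCounting := by
  rw [← Nat.primesLE_card_eq_primeCounting, Nat.primesLE_eq_filter_Icc_zero]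
  refine congrArg _ (Finset.ext fun p => ?_)
  simp only [Finset.mem_filter, Finset.mem_Icc]
  exact ⟨fun h => ⟨⟨zero_le, h.1.2⟩, h.2⟩, fun h => ⟨⟨h.2.one_lt.le, h.1.2⟩, h.2⟩⟩

lemma tendsto_psi_sub_theta_div : Tendsto
    (fun n : ℕ => (Chebyshev.psi n - Chebyshev.theta n) / n) atTop (𝓝 0) := by
  have h : Real.sqrt =o[atTop] (fun x : ℝ => x) := by
    refine (Asymptotics.isLittleO_iff_tendsto' (by
      filter_upwards [eventually_gt_atTop 0] with x hx h using absurd h hx.ne')).2 ?_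
    refine (Real.tendsto_sqrt_atTop.inv_tendsto_atTop).congr' ?_
    filter_upwards [eventually_gt_atTop 0] with x hx
    rw [Pi.inv_apply, Real.sqrt_div_self']
    simp
  exact ((Chebyshev.isBigO_psi_sub_theta_sqrt.trans_isLittleO h).tendsto_div_nhds_zero).comp
    tendsto_natCast_atTop_atTop

lemma tendsto_primeCounting_mul_log_sub_theta_div : Tendsto
    (fun n : ℕ => (n.primeCounting * Real.log n - Chebyshev.theta n) / n) atTop (𝓝 0) := by
  have h1 := (Chebyshev.primeCounting_sub_theta_div_log_isBigO.mul
    (Asymptotics.isBigO_refl Real.log atTop)).trans_isLittleO (k := fun x : ℝ => x) (by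
      refine (Asymptotics.isLittleO_iff_tendsto' (by
        filter_upwards [eventually_gt_atTop 0] with x hx h using absurd h hx.ne')).2 ?_
      refine (Real.tendsto_log_atTop.inv_tendsto_atTop).congr' ?_
      filter_upwards [eventually_gt_atTop 1] with x hx
      have := Real.log_pos hx
      rw [Pi.inv_apply]
      field_simp)
  refine (h1.tendsto_div_nhds_zero.comp tendsto_natCast_atTop_atTop).congr' ?_
  filter_upwards [eventually_gt_atTop 1] with n hn
  have := Real.log_pos (show (1 : ℝ) < n by exact_mod_cast hn)
  simp only [Function.comp_apply, Nat.floor_natCast]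
  field_simp

/-- Passage from a weighted sum of prime powers to a count of primes. -/
lemma tendsto_card_mul_log_div {S : ℕ → Prop} [DecidablePred S] {w : ℕ → ℝ} {A : ℝ}
    (h0 : ∀ n, 0 ≤ w n) (hΛ : ∀ n, w n ≤ Λ n)
    (hw : ∀ p : ℕ, p.Prime → w p = if S p then Real.log p else 0)
    (hlim : Tendsto (fun n : ℕ => (∑ k ∈ Finset.Icc 1 n, w k) / n) atTop (𝓝 A)) :
    Tendsto (fun n : ℕ => ((Finset.Icc 1 n).filter fun p => p.Prime ∧ S p).card * Real.log n / n)
      atTop (𝓝 A) := by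
  have key : ∀ n : ℕ, |((Finset.Icc 1 n).filter fun p => p.Prime ∧ S p).card * Real.log n -
      ∑ k ∈ Finset.Icc 1 n, w k| ≤ (Chebyshev.psi n - Chebyshev.theta n) +
        (n.primeCounting * Real.log n - Chebyshev.theta n) := by
    intro n
    rw [← sum_vonMangoldt_Icc, ← sum_log_prime_Icc, ← card_prime_Icc, Finset.card_filter,
      Finset.card_filter]
    push_cast
    rw [Finset.sum_mul, Finset.sum_mul, ← Finset.sum_sub_distrib, ← Finset.sum_sub_distrib,
      ← Finset.sum_sub_distrib, ← Finset.sum_add_distrib]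
    refine (Finset.abs_sum_le_sum_abs _ _).trans (Finset.sum_le_sum fun k hk => ?_)
    rw [Finset.mem_Icc] at hk
    have hlog : Real.log k ≤ Real.log n :=
      Real.log_le_log (by exact_mod_cast hk.1) (by exact_mod_cast hk.2)
    by_cases hp : k.Prime
    · rw [hw k hp, ArithmeticFunction.vonMangoldt_apply_prime hp]
      by_cases hS : S k
      · simp only [hp, hS, and_self, if_true, one_mul, sub_self, zero_add]
        rw [abs_of_nonneg (sub_nonneg.2 hlog)]
      · simp [hp, hS, hlog]
    · simp [hp, abs_of_nonneg (h0 k), hΛ k]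
  have hz : Tendsto (fun n : ℕ => (((Finset.Icc 1 n).filter fun p => p.Prime ∧ S p).card *
      Real.log n - ∑ k ∈ Finset.Icc 1 n, w k) / n) atTop (𝓝 0) := by
    refine squeeze_zero_norm (fun n => ?_) (by
      simpa using tendsto_psi_sub_theta_div.add tendsto_primeCounting_mul_log_sub_theta_div)
    rw [Real.norm_eq_abs, abs_div, Nat.abs_cast, ← add_div]
    exact div_le_div_of_nonneg_right (key n) (Nat.cast_nonneg _)
  simpa [← add_div] using hz.add hlim

lemma sum_le_of_le_vonMangoldt {w : ℕ → ℝ} (hΛ : ∀ n, w n ≤ Λ n) (n : ℕ) :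
    ∑ k ∈ Finset.Icc 1 n, w k ≤ (Real.log 4 + 4) * n :=
  (Finset.sum_le_sum fun k _ => hΛ k).trans
    ((sum_vonMangoldt_Icc n).trans_le (Chebyshev.psi_le_const_mul_self (Nat.cast_nonneg n)))

/-- The prime number theorem for `Λ`. -/
lemma tendsto_sum_vonMangoldt_div :
    Tendsto (fun n : ℕ => (∑ k ∈ Finset.Icc 1 n, Λ k) / n) atTop (𝓝 1) := by
  obtain ⟨g, hg, h⟩ := exists_LSeries_sum_residueClass (q := 1) {1} (by simp)
  refine wienerIkehara_of_le (fun n => ArithmeticFunction.vonMangoldt_nonneg)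
    (sum_le_of_le_vonMangoldt fun n => le_rfl) hg fun s hs => ?_
  have hs' := h s hs
  simp only [Finset.sum_singleton, Finset.card_singleton, Nat.totient_one, Nat.cast_one,
    div_one] at hs'
  rw [Complex.ofReal_one, ← hs']
  refine LSeries_congr (fun {n} _ => ?_) s
  rw [residueClass, indicator_of_mem]
  exact Subsingleton.elim _ _

/-- The part of `Λ` at prime powers in the classes of `U` with trivial Frobenius. -/
noncomputable def splitWeight (U : Finset (ZMod 23)) (n : ℕ) : ℝ :=
  if (n : ZMod 23) ∈ U then Λ n * (1 + frobTrace n) / 3 else 0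

lemma splitWeight_bounds {U : Finset (ZMod 23)} (hU : U ⊆ nonzeroSquares) (n : ℕ) :
    0 ≤ splitWeight U n ∧ splitWeight U n ≤ Λ n := by
  have hΛ : 0 ≤ Λ n := ArithmeticFunction.vonMangoldt_nonneg
  rw [splitWeight]
  split_ifs with h
  · by_cases hpp : IsPrimePow n
    · have h1 := (natCast_mem_nonzeroSquares_iff n).1 (hU h)
      rcases frobTrace_values hpp h1.1 with ⟨-, h2 | h2⟩ | ⟨h2, -⟩
      · rw [h2]; constructor <;> linarith
      · rw [h2]; constructor <;> linarith
      · omega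
    · have : Λ n = 0 := by
        by_contra h
        exact hpp (ArithmeticFunction.vonMangoldt_ne_zero_iff.1 h)
      simp [this]
  · exact ⟨le_rfl, hΛ⟩

lemma splitWeight_eq {U : Finset (ZMod 23)} (hU : U ⊆ nonzeroSquares) (n : ℕ) :
    (splitWeight U n : ℂ) = 1 / 3 * ∑ c ∈ U, (residueClass c n : ℂ) +
      1 / 66 * ∑ c ∈ U, ∑ χ : DirichletCharacter ℂ 23, χ c⁻¹ * twistedLogCoeff χ n := by
  have h : ∀ c ∈ U, ∑ χ : DirichletCharacter ℂ 23, χ c⁻¹ * twistedLogCoeff χ n =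
      if c = n then 22 * (Λ n * frobTrace n : ℂ) else 0 := by
    intro c hc
    have := DirichletCharacter.sum_char_inv_mul_char_eq ℂ
      (isUnit_of_mem_nonzeroSquares (hU hc)) (n : ZMod 23)
    rw [Nat.totient_prime (by norm_num)] at this
    simp only [twistedLogCoeff, mul_left_comm (_ : ℂ) ((Λ n * frobTrace n : ℝ) : ℂ)]
    rw [← Finset.mul_sum, this]
    split_ifs
    · push_cast; ring
    · simp
  rw [Finset.sum_congr rfl h, ← Complex.ofReal_sum, sum_residueClass, splitWeight,
    Finset.sum_ite_eq']
  split_ifs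
  · push_cast; ring
  · simp

lemma tendsto_sum_splitWeight_div {U : Finset (ZMod 23)} (hU : U ⊆ nonzeroSquares) :
    Tendsto (fun n : ℕ => (∑ k ∈ Finset.Icc 1 n, splitWeight U k) / n) atTop
      (𝓝 (U.card / 66)) := by
  obtain ⟨g, hg, h⟩ := exists_LSeries_sum_residueClass U
    fun c hc => isUnit_of_mem_nonzeroSquares (hU hc)
  choose G hG hGL using exists_continuousOn_LSeries_twistedLogCoeff
  refine wienerIkehara_of_le (fun n => (splitWeight_bounds hU n).1)
    (sum_le_of_le_vonMangoldt fun n => (splitWeight_bounds hU n).2)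
    (g := fun s => 1 / 3 * g s +
      1 / 66 * ∑ c ∈ U, ∑ χ : DirichletCharacter ℂ 23, χ c⁻¹ * G χ s) ?_ fun s hs => ?_
  · exact (continuousOn_const.mul hg).add (continuousOn_const.mul (continuousOn_finsetSum _
      fun c _ => continuousOn_finsetSum _ fun χ _ => continuousOn_const.mul (hG χ)))
  have h1 : HasSum (fun n => ∑ c ∈ U, LSeries.term ↗(residueClass c) s n)
      (∑ c ∈ U, LSeries ↗(residueClass c) s) :=
    hasSum_sum fun c _ => (LSeriesSummable_residueClass c hs).hasSum
  have h2 : HasSum (fun n => ∑ c ∈ U, ∑ χ : DirichletCharacter ℂ 23,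
      χ c⁻¹ * LSeries.term (twistedLogCoeff χ) s n)
      (∑ c ∈ U, ∑ χ : DirichletCharacter ℂ 23, χ c⁻¹ * LSeries (twistedLogCoeff χ) s) :=
    hasSum_sum fun c _ => hasSum_sum fun χ _ =>
      ((LSeriesSummable_twistedLogCoeff χ hs).hasSum).mul_left _
  have h3 : LSeries (fun n => (splitWeight U n : ℂ)) s =
      1 / 3 * ∑ c ∈ U, LSeries ↗(residueClass c) s +
      1 / 66 * ∑ c ∈ U, ∑ χ : DirichletCharacter ℂ 23, χ c⁻¹ * LSeries (twistedLogCoeff χ) s := by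
    rw [← ((h1.mul_left (1 / 3)).add (h2.mul_left (1 / 66))).tsum_eq, LSeries]
    refine tsum_congr fun n => ?_
    rcases eq_or_ne n 0 with rfl | hn
    · simp
    simp only [LSeries.term_of_ne_zero hn]
    rw [splitWeight_eq hU, add_div, mul_div_assoc, mul_div_assoc, Finset.sum_div, Finset.sum_div]
    simp only [Finset.sum_div, mul_div_assoc]
  rw [h3, h s hs, Nat.totient_prime (by norm_num)]
  simp only [hGL _ s hs]
  push_cast
  ring

/-- The predicate counted in the main theorem. -/
def IsSplitPrime (p : ℕ) : Prop :=
  p ≠ 23 ∧ (∃ x y : ℤ, (p : ℤ) = x ^ 2 + 23 * y ^ 2) ∧ p % 23 ≠ 1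

open Classical in
lemma splitWeight_prime {p : ℕ} (hp : p.Prime) :
    splitWeight (nonzeroSquares.erase 1) p = if IsSplitPrime p then Real.log p else 0 := by
  have h1 : (p : ZMod 23) = 1 ↔ p % 23 = 1 := by
    rw [← Nat.cast_one, ZMod.natCast_eq_natCast_iff']
  simp only [splitWeight, Finset.mem_erase, natCast_mem_nonzeroSquares_iff, Ne, h1]
  by_cases h23 : p = 23
  · subst h23
    simp [IsSplitPrime]
  have hd : ¬ 23 ∣ p := fun h => h23 ((Nat.prime_dvd_prime_iff_eq (by norm_num) hp).1 h).symm
  rw [ArithmeticFunction.vonMangoldt_apply_prime hp, frobTrace_prime hp h23]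
  by_cases hm : p % 23 = 1
  · simp [IsSplitPrime, hm]
  rcases formCoeff_prime hp h23 with ⟨h, h', h''⟩ | ⟨h, h', h''⟩ | ⟨h, h', h''⟩
  · rw [if_pos ⟨hm, hd, h⟩, if_pos ⟨h23, h', hm⟩, h'']
    ring
  · rw [if_pos ⟨hm, hd, h⟩, if_neg (fun H => h' H.2.1), h'']
    ring
  · rw [if_neg (fun H => by omega), if_neg (fun H => h' H.2.1)]

lemma ncard_setOf_le_prime (S : ℕ → Prop) [DecidablePred S] (n : ℕ) :
    {p : ℕ | p ≤ n ∧ p.Prime ∧ S p}.ncard =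
      ((Finset.Icc 1 n).filter fun p => p.Prime ∧ S p).card := by
  rw [← Set.ncard_coe_finset]
  congr 1
  ext p
  simp only [Finset.coe_filter, Finset.mem_Icc, Set.mem_ofPred_eq]
  exact ⟨fun h => ⟨⟨h.2.1.one_lt.le, h.1⟩, h.2⟩, fun h => ⟨h.1.2, h.2⟩⟩

/-- The set of primes `p ≠ 23` with `p = x² + 23y²` and `p ≢ 1 (mod 23)` has relative
natural density `5/33` among all primes. -/
theorem stmt_12 :
    Filter.Tendsto
      (fun N : ℕ =>
        (({p : ℕ | p ≤ N ∧ p.Prime ∧ p ≠ 23 ∧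
            (∃ x y : ℤ, (p : ℤ) = x ^ 2 + 23 * y ^ 2) ∧ p % 23 ≠ 1}.ncard : ℝ)) /
          ({p : ℕ | p ≤ N ∧ p.Prime}.ncard : ℝ))
      Filter.atTop
      (nhds (5 / 33)) := by
  classical
  have hU : nonzeroSquares.erase 1 ⊆ nonzeroSquares := Finset.erase_subset _ _
  have h1 := tendsto_card_mul_log_div (fun n => (splitWeight_bounds hU n).1)
    (fun n => (splitWeight_bounds hU n).2) (fun p hp => splitWeight_prime hp)
    (tendsto_sum_splitWeight_div hU)
  have h2 := tendsto_card_mul_log_div (S := fun _ => True)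
    (fun n => ArithmeticFunction.vonMangoldt_nonneg) (fun n => le_rfl)
    (fun p hp => by rw [if_pos trivial, ArithmeticFunction.vonMangoldt_apply_prime hp])
    tendsto_sum_vonMangoldt_div
  have hcard : (nonzeroSquares.erase 1).card = 10 := by decide
  have h := h1.div h2 one_ne_zero
  rw [hcard, show ((10 : ℕ) : ℝ) / 66 / 1 = 5 / 33 by norm_num] at h
  refine h.congr' ?_
  filter_upwards [eventually_gt_atTop 1] with n hn
  have hlog := Real.log_pos (show (1 : ℝ) < n by exact_mod_cast hn)
  have hn0 : (0 : ℝ) < n := by positivity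
  have e1 : {p : ℕ | p ≤ n ∧ p.Prime ∧ p ≠ 23 ∧ (∃ x y : ℤ, (p : ℤ) = x ^ 2 + 23 * y ^ 2) ∧
      p % 23 ≠ 1}.ncard = ((Finset.Icc 1 n).filter fun p => p.Prime ∧ IsSplitPrime p).card :=
    ncard_setOf_le_prime IsSplitPrime n
  have e2 : {p : ℕ | p ≤ n ∧ p.Prime}.ncard =
      ((Finset.Icc 1 n).filter fun p => p.Prime ∧ True).card := by
    simpa only [and_true] using ncard_setOf_le_prime (fun _ => True) n
  rw [Pi.div_apply, e1, e2, div_div_div_cancel_right₀ hn0.ne', mul_div_mul_right _ _ hlog.ne']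
end

section
/- The class group of the order ℤ[√−23] (the subring of ℚ(√−23) generated by a square root of −23 over ℤ) has exactly 3 elements; equivalently, the class number h(−92) of primitive positive definite binary quadratic forms of discriminant −92 equals 3. -/
section FractionalIdeal

open scoped nonZeroDivisors

variable {R : Type*} [CommRing R]

theorem Ideal.le_of_mul_le_mul_of_isUnit_coeIdeal {I J Q : Ideal R}
    (hQ : IsUnit (Q : FractionalIdeal R⁰ (FractionRing R))) (h : I * Q ≤ J * Q) : I ≤ J := by
  obtain ⟨u, hu⟩ := hQ
  rw [← FractionalIdeal.coeIdeal_le_coeIdeal (FractionRing R), FractionalIdeal.coeIdeal_mul,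
    FractionalIdeal.coeIdeal_mul, ← hu] at h
  rw [← FractionalIdeal.coeIdeal_le_coeIdeal (FractionRing R)]
  have h' := mul_le_mul_left h ((u⁻¹ : _ˣ) : FractionalIdeal R⁰ (FractionRing R))
  simpa [mul_assoc] using h'

variable [IsDomain R]

theorem FractionalIdeal.isUnit_coeIdeal_span_singleton {c : R} (hc : c ≠ 0) :
    IsUnit ((Ideal.span {c} : Ideal R) : FractionalIdeal R⁰ (FractionRing R)) := by
  rw [FractionalIdeal.coeIdeal_span_singleton]
  have hc' : algebraMap R (FractionRing R) c ≠ 0 := by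
    simpa using hc
  exact ⟨toPrincipalIdeal R (FractionRing R) (Units.mk0 _ hc'), by simp⟩

theorem FractionalIdeal.isUnit_coeIdeal_of_mul_eq_span_singleton {I J : Ideal R} {c : R}
    (hc : c ≠ 0) (h : I * J = Ideal.span {c}) :
    IsUnit (I : FractionalIdeal R⁰ (FractionRing R)) := by
  have hu := FractionalIdeal.isUnit_coeIdeal_span_singleton hc
  rw [← h, FractionalIdeal.coeIdeal_mul] at hu
  exact isUnit_of_mul_isUnit_left hu

theorem FractionalIdeal.isUnit_coeIdeal_of_span_singleton_mul_eq {I J : Ideal R} {a b : R}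
    (ha : a ≠ 0) (h : Ideal.span {a} * I = Ideal.span {b} * J)
    (hI : IsUnit (I : FractionalIdeal R⁰ (FractionRing R))) :
    IsUnit (J : FractionalIdeal R⁰ (FractionRing R)) := by
  have hu := (FractionalIdeal.isUnit_coeIdeal_span_singleton ha).mul hI
  rw [← FractionalIdeal.coeIdeal_mul, h, FractionalIdeal.coeIdeal_mul] at hu
  exact isUnit_of_mul_isUnit_right hu

/-- Every class of the class group of a domain is the class of an integral ideal. -/
theorem ClassGroup.exists_mk_eq_of_coeIdeal (c : ClassGroup R) :
    ∃ (u : (FractionalIdeal R⁰ (FractionRing R))ˣ) (I : Ideal R),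
      (u : FractionalIdeal R⁰ (FractionRing R)) = I ∧ ClassGroup.mk (FractionRing R) u = c := by
  refine ClassGroup.induction (FractionRing R) (fun v ↦ ?_) c
  have hden : algebraMap R (FractionRing R) v.1.den ≠ 0 :=
    IsFractionRing.to_map_ne_zero_of_mem_nonZeroDivisors (SetLike.coe_mem _)
  refine ⟨v * toPrincipalIdeal R (FractionRing R) (Units.mk0 _ hden), v.1.num, ?_, ?_⟩
  · rw [mul_comm, Units.val_mul, coe_toPrincipalIdeal, Units.val_mk0]
    exact FractionalIdeal.den_mul_self_eq_num' R⁰ (FractionRing R) v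
  · exact (ClassGroup.mk_eq_mk.2 ⟨_, rfl⟩).symm

end FractionalIdeal

namespace Zsqrtd

theorem isDomain_of_neg {D : ℤ} (hD : D < 0) : IsDomain (ℤ√D) := by
  have : NoZeroDivisors (ℤ√D) := ⟨fun {a b} h ↦ by
    have h' := congrArg Zsqrtd.norm h
    rw [norm_mul, norm_zero, mul_eq_zero, norm_eq_zero_iff hD, norm_eq_zero_iff hD] at h'
    exact h'⟩
  exact NoZeroDivisors.to_isDomain _

/-- Reduction theory of ideals in an imaginary quadratic order `ℤ[√D]`. -/
theorem exists_span_mul_eq_span_mul_of_neg {D : ℤ} (hD : D < 0) {I : Ideal (ℤ√D)} (hI : I ≠ ⊥) :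
    ∃ (a b : ℤ√D) (n k : ℤ), a ≠ 0 ∧ b ≠ 0 ∧ 0 < n ∧ 2 * |k| ≤ n ∧ n ∣ k ^ 2 - D ∧
      n ^ 2 ≤ k ^ 2 - D ∧
      Ideal.span {a} * I = Ideal.span {b} * Ideal.span {(n : ℤ√D), ⟨k, 1⟩} := by
  have := isDomain_of_neg hD
  have norm_pos : ∀ x : ℤ√D, x ≠ 0 → 0 < x.norm := fun x hx ↦
    lt_of_le_of_ne (norm_nonneg hD.le x) fun h ↦ hx ((norm_eq_zero_iff hD x).1 h.symm)
  obtain ⟨α, hαI, hα, hmin⟩ : ∃ α ∈ I, α ≠ 0 ∧ ∀ y ∈ I, y ≠ 0 → α.norm ≤ y.norm := by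
    obtain ⟨x, hx, hx0⟩ := Submodule.exists_mem_ne_zero_of_ne_bot hI
    obtain ⟨α, ⟨hαI, hα⟩, h⟩ := exists_minimalFor_of_wellFoundedLT (fun x ↦ x ∈ I ∧ x ≠ 0)
      (fun x : ℤ√D ↦ x.norm.toNat) ⟨x, hx, hx0⟩
    refine ⟨α, hαI, hα, fun y hy hy0 ↦ ?_⟩
    have h1 := norm_pos y hy0
    by_contra! hlt
    have h2 : α.norm.toNat ≤ y.norm.toNat := h ⟨hy, hy0⟩ (by dsimp only; omega)
    omega
  set N := α.norm
  have hN0 : 0 < N := norm_pos α hα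
  have hα' : star α ≠ 0 := fun h ↦ hα (by simpa using h)
  set J := Ideal.span {star α} * I
  have hNJ : (N : ℤ√D) ∈ J := by
    have hNα : (N : ℤ√D) = star α * α := (norm_eq_mul_conj α).trans (mul_comm _ _)
    rw [hNα]
    exact Ideal.mul_mem_mul (Ideal.mem_span_singleton_self _) hαI
  have hnorm : ∀ x ∈ J, x ≠ 0 → N ^ 2 ≤ x.norm := by
    intro x hx hx0
    obtain ⟨y, hy, rfl⟩ := Ideal.mem_span_singleton_mul.1 hx
    have hy0 : y ≠ 0 := right_ne_zero_of_mul hx0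
    rw [norm_mul, norm_conj, sq]
    exact mul_le_mul_of_nonneg_left (hmin y hy hy0) hN0.le
  have hint : ∀ x : ℤ, (x : ℤ√D) ∈ J → N ∣ x := by
    intro x hx
    have hr : ((x % N : ℤ) : ℤ√D) ∈ J := by
      have : ((x % N : ℤ) : ℤ√D) = x - ((x / N : ℤ) : ℤ√D) * N := by
        rw [Int.emod_def]; push_cast; ring
      rw [this]
      exact J.sub_mem hx (J.mul_mem_left _ hNJ)
    by_contra hdvd
    have hne : x % N ≠ 0 := fun h ↦ hdvd (Int.dvd_of_emod_eq_zero h)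
    have h1 := hnorm _ hr (by exact_mod_cast hne)
    rw [norm_intCast] at h1
    nlinarith [Int.emod_nonneg x hN0.ne', Int.emod_lt_of_pos x hN0]
  let S : Ideal ℤ :=
    { carrier := {m | ∃ x ∈ J, x.im = m}
      zero_mem' := ⟨0, J.zero_mem, rfl⟩
      add_mem' := by
        rintro _ _ ⟨x, hx, rfl⟩ ⟨y, hy, rfl⟩
        exact ⟨x + y, J.add_mem hx hy, rfl⟩
      smul_mem' := by
        rintro c _ ⟨x, hx, rfl⟩
        exact ⟨c * x, J.mul_mem_left _ hx, by simp⟩ }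
  have hS : ∀ m, m ∈ S ↔ ∃ x ∈ J, x.im = m := fun _ ↦ Iff.rfl
  obtain ⟨δ, hδ, hSδ⟩ : ∃ δ : ℤ, 0 ≤ δ ∧ S = Ideal.span {δ} := by
    obtain ⟨δ, h⟩ := IsPrincipalIdealRing.principal S
    exact ⟨|δ|, abs_nonneg _, by rw [h, Ideal.submodule_span_eq, Ideal.span_singleton_abs]⟩
  obtain ⟨n, hn⟩ : δ ∣ N := by
    rw [← Ideal.mem_span_singleton, ← hSδ, hS]
    exact ⟨(sqrtd : ℤ√D) * N, J.mul_mem_left _ hNJ, by simp⟩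
  have hδ0 : 0 < δ := lt_of_le_of_ne hδ (by rintro rfl; simp at hn; omega)
  have hn0 : 0 < n := by
    by_contra h
    nlinarith
  obtain ⟨β, hβ, hβim⟩ := (hS δ).1 (hSδ ▸ Ideal.mem_span_singleton_self δ)
  obtain ⟨k₁, hk₁⟩ : δ ∣ β.re := by
    have : N ∣ n * β.re := by
      refine hint _ ?_
      have : ((n * β.re : ℤ) : ℤ√D) = n * β - (sqrtd : ℤ√D) * N := by
        ext <;> simp [hβim, hn, mul_comm]
      rw [this]
      exact J.sub_mem (J.mul_mem_left _ hβ) (J.mul_mem_left _ hNJ)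
    rw [hn, mul_comm] at this
    exact Int.dvd_of_mul_dvd_mul_left hn0.ne' this
  obtain ⟨k, q, hk, hkn⟩ : ∃ k q : ℤ, k = k₁ - n * q ∧ 2 * |k| ≤ n := by
    refine ⟨(k₁ + n / 2) % n - n / 2, (k₁ + n / 2) / n, ?_, ?_⟩
    · rw [Int.emod_def]; ring
    · have h1 := Int.emod_nonneg (k₁ + n / 2) hn0.ne'
      have h2 := Int.emod_lt_of_pos (k₁ + n / 2) hn0
      rcases abs_cases ((k₁ + n / 2) % n - n / 2) with h | h <;> omega
  have hkJ : (⟨δ * k, δ⟩ : ℤ√D) ∈ J := by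
    have : (⟨δ * k, δ⟩ : ℤ√D) = β - q * N := by
      ext
      · simp [hk₁, hk, hn]; ring
      · simp [hβim]
    rw [this]
    exact J.sub_mem hβ (J.mul_mem_left _ hNJ)
  refine ⟨star α, δ, n, k, hα', by exact_mod_cast hδ0.ne', hn0, hkn, ?_, ?_, ?_⟩
  · have : N ∣ δ * (k ^ 2 - D) := by
      refine hint _ ?_
      have : ((δ * (k ^ 2 - D) : ℤ) : ℤ√D) = ⟨k, -1⟩ * ⟨δ * k, δ⟩ := by
        rw [intCast_val]
        ext <;> simp <;> ring
      rw [this]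
      exact J.mul_mem_left _ hkJ
    rw [hn] at this
    exact Int.dvd_of_mul_dvd_mul_left hδ0.ne' this
  · have h := hnorm _ hkJ fun h ↦ hδ0.ne' (congrArg im h)
    rw [norm_def, hn] at h
    have h' : δ ^ 2 * n ^ 2 ≤ δ ^ 2 * (k ^ 2 - D) := by
      simp only at h
      linarith
    exact le_of_mul_le_mul_left h' (by positivity)
  · change J = _
    apply _root_.le_antisymm
    · intro x hx
      obtain ⟨t, ht⟩ : δ ∣ x.im := by
        rw [← Ideal.mem_span_singleton, ← hSδ, hS]
        exact ⟨x, hx, rfl⟩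
      obtain ⟨s, hs⟩ : N ∣ x.re - t * (δ * k) := by
        refine hint _ ?_
        have : ((x.re - t * (δ * k) : ℤ) : ℤ√D) = x - t * ⟨δ * k, δ⟩ := by
          rw [intCast_val]
          ext <;> simp [ht, mul_comm]
        rw [this]
        exact J.sub_mem hx (J.mul_mem_left _ hkJ)
      refine Ideal.mem_span_singleton_mul.2
        ⟨s * n + t * ⟨k, 1⟩, Ideal.mem_span_pair.2 ⟨s, t, rfl⟩, ?_⟩
      have hre : x.re = δ * n * s + t * (δ * k) := by rw [← hn]; linarith
      ext
      · simp [hre]; ring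
      · simp [ht]
    · rw [Ideal.span_singleton_mul_le_iff]
      intro z hz
      obtain ⟨s, t, rfl⟩ := Ideal.mem_span_pair.1 hz
      have : (δ : ℤ√D) * (s * n + t * ⟨k, 1⟩) = s * N + t * ⟨δ * k, δ⟩ := by
        have : (⟨δ * k, δ⟩ : ℤ√D) = δ * ⟨k, 1⟩ := by ext <;> simp
        rw [this, hn]; push_cast; ring
      rw [this]
      exact J.add_mem (J.mul_mem_left _ hNJ) (J.mul_mem_left _ hkJ)

open scoped nonZeroDivisors

instance isDomain_neg_twentyThree : IsDomain (ℤ√(-23)) := isDomain_of_neg (by norm_num)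

theorem not_isUnit_coeIdeal_span_pair {n k : ℤ} (hn : 2 ∣ n) (hk : 2 * n ∣ k ^ 2 + 23) :
    ¬ IsUnit ((Ideal.span {(n : ℤ√(-23)), ⟨k, 1⟩} : Ideal (ℤ√(-23))) :
      FractionalIdeal (ℤ√(-23))⁰ (FractionRing (ℤ√(-23)))) := by
  intro hu
  obtain ⟨m, rfl⟩ := hn
  obtain ⟨l, hl⟩ := hk
  have hle : Ideal.span {(⟨k, 1⟩ : ℤ√(-23))} ≤ Ideal.span {((2 : ℤ) : ℤ√(-23))} := by
    refine Ideal.le_of_mul_le_mul_of_isUnit_coeIdeal hu ?_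
    rw [Ideal.span_singleton_mul_le_iff]
    intro z hz
    obtain ⟨s, t, rfl⟩ := Ideal.mem_span_pair.1 hz
    refine Ideal.mem_span_singleton_mul.2
      ⟨(-t * l) * ((2 * m : ℤ) : ℤ√(-23)) + (s * m + t * k) * ⟨k, 1⟩,
        Ideal.mem_span_pair.2 ⟨_, _, rfl⟩, ?_⟩
    have hsq : (⟨k, 1⟩ * ⟨k, 1⟩ : ℤ√(-23)) = 2 * k * ⟨k, 1⟩ - ((k ^ 2 + 23 : ℤ) : ℤ√(-23)) := by
      ext
      · simp only [re_mul, re_sub, re_intCast, im_intCast, re_ofNat, im_ofNat, im_mul]; ring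
      · simp only [re_mul, im_sub, re_intCast, im_intCast, re_ofNat, im_ofNat, im_mul]; ring
    rw [hl] at hsq
    push_cast at hsq ⊢
    linear_combination -t * hsq
  rw [Ideal.span_singleton_le_span_singleton, intCast_dvd] at hle
  simp at hle

theorem span_three_mul_span_three :
    (Ideal.span {((3 : ℤ) : ℤ√(-23)), ⟨1, 1⟩} : Ideal (ℤ√(-23))) *
      Ideal.span {((3 : ℤ) : ℤ√(-23)), ⟨-1, 1⟩} = Ideal.span {3} := by
  rw [Ideal.span_pair_mul_span_pair]
  apply _root_.le_antisymm
  · rw [Ideal.span_le]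
    rintro x (rfl | rfl | rfl | rfl) <;> rw [SetLike.mem_coe, Ideal.mem_span_singleton]
    · exact ⟨3, by decide⟩
    · exact ⟨⟨-1, 1⟩, by decide⟩
    · exact ⟨⟨1, 1⟩, by decide⟩
    · exact ⟨-8, by decide⟩
  · rw [Ideal.span_singleton_le_iff_mem, show (3 : ℤ√(-23)) = ((3 : ℤ) : ℤ√(-23)) * (3 : ℤ) +
      (((3 : ℤ) : ℤ√(-23)) * ⟨-1, 1⟩ - ⟨1, 1⟩ * ((3 : ℤ) : ℤ√(-23))) by decide]
    refine add_mem (Ideal.subset_span ?_) (sub_mem (Ideal.subset_span ?_) (Ideal.subset_span ?_)) <;>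
      simp

theorem span_three_pow_two :
    (Ideal.span {((3 : ℤ) : ℤ√(-23)), ⟨1, 1⟩} : Ideal (ℤ√(-23))) ^ 2 =
      Ideal.span {9, ⟨-2, 1⟩} := by
  rw [sq, Ideal.span_pair_mul_span_pair]
  apply _root_.le_antisymm
  · rw [Ideal.span_le]
    rintro x (rfl | rfl | rfl | rfl) <;> rw [SetLike.mem_coe, Ideal.mem_span_pair]
    · exact ⟨1, 0, by decide⟩
    · exact ⟨1, 3, by decide⟩
    · exact ⟨1, 3, by decide⟩
    · exact ⟨-2, 2, by decide⟩
  · rw [Ideal.span_le]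
    rintro x (rfl | rfl)
    · exact Ideal.subset_span (Or.inl (by decide))
    · rw [SetLike.mem_coe, show (⟨-2, 1⟩ : ℤ√(-23)) = ((3 : ℤ) : ℤ√(-23)) * ⟨1, 1⟩ -
        ⟨1, 1⟩ * ⟨1, 1⟩ - 3 * (((3 : ℤ) : ℤ√(-23)) * (3 : ℤ)) by decide]
      refine sub_mem (sub_mem (Ideal.subset_span ?_) (Ideal.subset_span ?_))
        (Ideal.mul_mem_left _ _ (Ideal.subset_span ?_)) <;> simp

theorem span_three_pow_three :
    (Ideal.span {((3 : ℤ) : ℤ√(-23)), ⟨1, 1⟩} : Ideal (ℤ√(-23))) ^ 3 = Ideal.span {⟨2, -1⟩} := by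
  rw [pow_succ, span_three_pow_two, Ideal.span_pair_mul_span_pair]
  apply _root_.le_antisymm
  · rw [Ideal.span_le]
    rintro x (rfl | rfl | rfl | rfl) <;> rw [SetLike.mem_coe, Ideal.mem_span_singleton]
    · exact ⟨⟨2, 1⟩, by decide⟩
    · exact ⟨⟨-7, 1⟩, by decide⟩
    · exact ⟨-3, by decide⟩
    · exact ⟨⟨-1, -1⟩, by decide⟩
  · rw [Ideal.span_singleton_le_iff_mem, show (⟨2, -1⟩ : ℤ√(-23)) =
      9 * ((3 : ℤ) : ℤ√(-23)) + ⟨-2, 1⟩ * ⟨1, 1⟩ by decide]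
    refine add_mem (Ideal.subset_span ?_) (Ideal.subset_span ?_) <;> simp

theorem span_three_ne_span_singleton (x : ℤ√(-23)) :
    (Ideal.span {((3 : ℤ) : ℤ√(-23)), ⟨1, 1⟩} : Ideal (ℤ√(-23))) ≠ Ideal.span {x} := by
  intro h
  have h3 : x ∣ ((3 : ℤ) : ℤ√(-23)) := by
    rw [← Ideal.mem_span_singleton, ← h]
    exact Ideal.subset_span (by simp)
  have h1 : x ∣ ⟨1, 1⟩ := by
    rw [← Ideal.mem_span_singleton, ← h]
    exact Ideal.subset_span (by simp)
  have h3' : x.norm ∣ 9 := map_dvd normMonoidHom h3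
  have h1' : x.norm ∣ 24 := map_dvd normMonoidHom h1
  have hdvd : x.norm ∣ 3 := by
    rw [show (3 : ℤ) = 3 * 9 - 24 by norm_num]
    exact dvd_sub (h3'.mul_left 3) h1'
  have hnonneg : 0 ≤ x.norm := norm_nonneg (by norm_num) x
  have hle : x.norm ≤ 3 := Int.le_of_dvd (by norm_num) hdvd
  obtain hx | hx : x.norm = 1 ∨ x.norm = 3 := by
    interval_cases x.norm <;> omega
  · rw [norm_eq_one_iff' (by norm_num)] at hx
    rw [Ideal.span_singleton_eq_top.2 hx, Ideal.eq_top_iff_one, Ideal.mem_span_pair] at h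
    obtain ⟨s, t, h⟩ := h
    have hre := congrArg re h
    have him := congrArg im h
    simp at hre him
    omega
  · rw [norm_def] at hx
    have him : x.im = 0 := by
      by_contra him
      have : 1 ≤ x.im * x.im := by
        have := mul_self_pos.2 him
        omega
      nlinarith [mul_self_nonneg x.re]
    rw [him] at hx
    have h2 : x.re ≤ 1 := by nlinarith
    have h3 : -1 ≤ x.re := by nlinarith
    interval_cases x.re <;> omega

theorem card_classGroup_neg_twentyThree : Nat.card (ClassGroup (ℤ√(-23))) = 3 := by
  have hu := FractionalIdeal.isUnit_coeIdeal_of_mul_eq_span_singleton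
    (by decide) span_three_mul_span_three
  have hv := FractionalIdeal.isUnit_coeIdeal_of_mul_eq_span_singleton
    (by decide) ((mul_comm _ _).trans span_three_mul_span_three)
  obtain ⟨u, hu⟩ := hu
  obtain ⟨v, hv⟩ := hv
  have h1 : ClassGroup.mk (FractionRing (ℤ√(-23))) u ^ 3 = 1 := by
    rw [← map_pow, ClassGroup.mk_eq_one_of_coe_ideal
      (by rw [Units.val_pow_eq_pow_val, hu, ← FractionalIdeal.coeIdeal_pow])]
    exact ⟨_, by decide, span_three_pow_three⟩
  have h2 : ClassGroup.mk (FractionRing (ℤ√(-23))) u ≠ 1 := by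
    rw [Ne, ClassGroup.mk_eq_one_of_coe_ideal hu]
    rintro ⟨x, -, hx⟩
    exact span_three_ne_span_singleton x hx
  have h3 : ClassGroup.mk (FractionRing (ℤ√(-23))) v =
      (ClassGroup.mk (FractionRing (ℤ√(-23))) u)⁻¹ := by
    rw [eq_inv_iff_mul_eq_one, mul_comm, ← map_mul, ClassGroup.mk_eq_one_of_coe_ideal
      (by rw [Units.val_mul, hu, hv, ← FractionalIdeal.coeIdeal_mul])]
    exact ⟨_, by decide, span_three_mul_span_three⟩
  rw [← orderOf_eq_card_of_forall_mem_zpowers (g := ClassGroup.mk (FractionRing (ℤ√(-23))) u)]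
  · exact orderOf_eq_prime h1 h2
  intro c
  obtain ⟨w, I, hw, rfl⟩ := ClassGroup.exists_mk_eq_of_coeIdeal c
  have hI : I ≠ ⊥ := by
    rintro rfl
    exact w.ne_zero (by simp [hw])
  obtain ⟨a, b, n, k, ha, hb, hn, hk, hdvd, hle, h⟩ :=
    exists_span_mul_eq_span_mul_of_neg (by norm_num) hI
  have hQ := FractionalIdeal.isUnit_coeIdeal_of_span_singleton_mul_eq ha h ⟨w, hw⟩
  have key : ∀ y : (FractionalIdeal (ℤ√(-23))⁰ (FractionRing (ℤ√(-23))))ˣ, (y : FractionalIdeal (ℤ√(-23))⁰ (FractionRing (ℤ√(-23)))) =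
      (Ideal.span {(n : ℤ√(-23)), ⟨k, 1⟩} : Ideal (ℤ√(-23))) →
      ClassGroup.mk (FractionRing (ℤ√(-23))) w =
        ClassGroup.mk (FractionRing (ℤ√(-23))) y := fun y hy ↦
    (ClassGroup.mk_eq_mk_of_coe_ideal hw hy).2 ⟨a, b, ha, hb, h⟩
  have hk2 : |k| ^ 2 = k ^ 2 := sq_abs k
  have hn5 : n ≤ 5 := by nlinarith [abs_nonneg k]
  have hk3 := abs_le.1 (show |k| ≤ 2 by omega)
  obtain ⟨hk3, hk4⟩ := hk3
  obtain ⟨rfl, rfl⟩ | ⟨rfl, rfl⟩ | ⟨rfl, rfl⟩ | ⟨h2n, h2k⟩ :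
      (n = 1 ∧ k = 0) ∨ (n = 3 ∧ k = 1) ∨ (n = 3 ∧ k = -1) ∨ (2 ∣ n ∧ 2 * n ∣ k ^ 2 + 23) := by
    clear key hQ h
    interval_cases n <;> interval_cases k <;> revert hk hdvd <;> decide
  · have htop : (Ideal.span {((1 : ℤ) : ℤ√(-23)), ⟨0, 1⟩} : Ideal (ℤ√(-23))) = ⊤ :=
      (Ideal.eq_top_iff_one _).2 (Ideal.subset_span (by simp))
    rw [key 1 (by rw [htop, FractionalIdeal.coeIdeal_top, Units.val_one]), map_one]
    exact one_mem _
  · rw [key u hu]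
    exact Subgroup.mem_zpowers _
  · rw [key v hv, h3]
    exact inv_mem (Subgroup.mem_zpowers _)
  · exact absurd hQ (not_isUnit_coeIdeal_span_pair h2n h2k)

/-- The subring of `ℂ` generated by `√23·i` is isomorphic to `ℤ√(-23)`. -/
noncomputable def equivAdjoin :
    ℤ√(-23) ≃+* Algebra.adjoin ℤ {(Real.sqrt 23 : ℂ) * Complex.I} :=
  let r : {r : ℂ // r * r = ((-23 : ℤ) : ℂ)} := ⟨(Real.sqrt 23 : ℂ) * Complex.I, by
    rw [mul_mul_mul_comm, Complex.I_mul_I, ← Complex.ofReal_mul,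
      Real.mul_self_sqrt (by norm_num)]
    norm_num⟩
  have hinj : Function.Injective (lift r).toIntAlgHom :=
    lift_injective r fun n hn ↦ by nlinarith [mul_self_nonneg n]
  have hrange : (lift r).toIntAlgHom.range =
      Algebra.adjoin ℤ {(Real.sqrt 23 : ℂ) * Complex.I} := by
    apply _root_.le_antisymm
    · rintro _ ⟨x, rfl⟩
      refine add_mem (intCast_mem _ _) (mul_mem (intCast_mem _ _) ?_)
      exact Algebra.subset_adjoin rfl
    · rw [Algebra.adjoin_le_iff, Set.singleton_subset_iff]
      exact ⟨sqrtd, by simp [r]⟩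
  ((AlgEquiv.ofInjective _ hinj).trans (Subalgebra.equivOfEq _ _ hrange)).toRingEquiv

end Zsqrtd

/-- The class group of the order `ℤ[√−23]` (realized as the subring of `ℂ` generated by
`√23·i`, a square root of `−23`) has exactly `3` elements; equivalently, the class number
`h(−92)` equals `3`. -/
theorem stmt_13 :
    Nat.card (ClassGroup (Algebra.adjoin ℤ {(Real.sqrt 23 : ℂ) * Complex.I})) = 3 := by
  rw [← Nat.card_congr (ClassGroup.mulEquiv Zsqrtd.equivAdjoin).toEquiv]
  exact Zsqrtd.card_classGroup_neg_twentyThree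
end
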